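/- Let n ≥ 3, α, τ ∈ (0,1), and let φ: B₁(0) ⊂ ℝⁿ → ℂ^N be a map of class C^{1,α}, not identically zero, with φ(0) = 0, satisfying Dφ(x) = f(φ(x)) φ(x) on B₁ for some function f: ℂ^N → ℝ that is bounded on the range of φ (say |f(φ(x))| ≤ C_L for all x). Assume moreover that the map x ↦ f(φ(x))φ(x) is differentiable on B₁ with |D( f(φ(·))φ(·) )(x)| ≤ C_f ( |φ(x)| + |φ(x)|^τ |∇φ(x)| ) for all x ∈ B₁. Define H(s) = ∫_{∂B_s} |φ|² dS, D(s) = ∫_{∂B_s} Re⟨∂_ν φ, φ⟩ dS and the frequency N(s) = s D(s)/H(s). Then for every constant C_N > 0 there exist β ∈ (0,1), r_am ∈ (0,1) and C_am > 0, depending on n, N, τ, C_L, C_f, α and on bounds for φ in C^{1,α} but not otherwise on φ, such that H(s) > 0 for all s ∈ (0, r_am) and the function s ↦ exp( (C_am/(β+1)) s^{β+1} ) ( N(s) + C_N ) is non-decreasing on (0, r_am). In particular the limit N(0) := lim_{s→0⁺} N(s) exists. -/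

import Mathlib

open MeasureTheory

/-- The Euclidean Dirac operator `Dφ = Σ_j γ_j ∂_j φ`. -/
noncomputable def dirac {n N : ℕ} (γ : Fin n → Matrix (Fin N) (Fin N) ℂ)
    (φ : EuclideanSpace ℝ (Fin n) → EuclideanSpace ℂ (Fin N))
    (x : EuclideanSpace ℝ (Fin n)) : EuclideanSpace ℂ (Fin N) :=
  (WithLp.equiv 2 (Fin N → ℂ)).symm
    (∑ j, (γ j).mulVec
      (WithLp.equiv 2 (Fin N → ℂ) (fderiv ℝ φ x (EuclideanSpace.single j 1))))

/-- The radial derivative `∂_ν φ(x) = Σ_j (x_j/|x|) ∂_j φ(x)`. -/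
noncomputable def radialDeriv {n N : ℕ}
    (φ : EuclideanSpace ℝ (Fin n) → EuclideanSpace ℂ (Fin N))
    (x : EuclideanSpace ℝ (Fin n)) : EuclideanSpace ℂ (Fin N) :=
  ∑ j, (x j / ‖x‖) • fderiv ℝ φ x (EuclideanSpace.single j 1)

/-- The height function `H(s) = ∫_{∂B_s} |φ|² dS`. -/
noncomputable def Hfn {n N : ℕ}
    (φ : EuclideanSpace ℝ (Fin n) → EuclideanSpace ℂ (Fin N)) (s : ℝ) : ℝ :=
  ∫ x in Metric.sphere (0 : EuclideanSpace ℝ (Fin n)) s, ‖φ x‖ ^ 2 ∂μH[(n : ℝ) - 1]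

/-- The Dirichlet-type boundary function `D(s) = ∫_{∂B_s} Re⟨∂_ν φ, φ⟩ dS`. -/
noncomputable def Dfn {n N : ℕ}
    (φ : EuclideanSpace ℝ (Fin n) → EuclideanSpace ℂ (Fin N)) (s : ℝ) : ℝ :=
  ∫ x in Metric.sphere (0 : EuclideanSpace ℝ (Fin n)) s,
    (inner (𝕜 := ℂ) (radialDeriv φ x) (φ x)).re ∂μH[(n : ℝ) - 1]

/-- The Almgren-type frequency function `N(s) = s D(s)/H(s)`. -/
noncomputable def freq {n N : ℕ}
    (φ : EuclideanSpace ℝ (Fin n) → EuclideanSpace ℂ (Fin N)) (s : ℝ) : ℝ :=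
  s * Dfn φ s / Hfn φ s

section FrequencyMonotonicity

open Set
open scoped ContDiff

lemma energy_le_of_green {C T s h p E K : ℝ} (hC : 0 < C) (hs : 0 < s)
    (hT1 : T ≤ 1) (hCs : 6 * C * s ≤ 1) (hE : 0 ≤ E)
    (green : E + K = s * p) (hK : |K| ≤ C * (2 * T * s * h + 3 * T * s * E)) :
    E ≤ 2 * (s * p) + 4 * C * T * s * h := by
  have h1 := (abs_le.1 hK).1
  have h2 : C * s * T * E ≤ C * s * E := by
    have : C * s * E * T ≤ C * s * E * 1 := by gcongr
    linarith
  nlinarith [mul_le_mul_of_nonneg_right hCs hE]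

set_option maxHeartbeats 1000000 in
lemma freq_deriv_lower_bound {n C T s h p q e k E K L : ℝ} (hn : 3 ≤ n) (hC : 0 < C)
    (hs : 0 < s) (hs1 : s ≤ 1) (hsT : s ≤ T) (hT1 : T ≤ 1) (hCs : 6 * C * s ≤ 1)
    (hh : 0 < h) (hE : 0 ≤ E) (hpq : p ^ 2 ≤ h * q)
    (green : E + K = s * p) (poho : s ^ 2 * (e - 2 * q) = (n - 2) * E - 2 * L)
    (hK : |K| ≤ C * (2 * T * s * h + 3 * T * s * E))
    (hL : |L| ≤ C * (s ^ 2 * h + 3 * T * s * E))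
    (hk : ∀ μ > 0, |k| ≤ C * (h + T * (μ * e + h / μ))) :
    -(C * (14 * n + 1)) * T * (s * p / h + 1) ≤
      (s / h) * (e + k - (n - 2) * p / s - 2 * p ^ 2 / h) := by
  have hT : 0 < T := hs.trans_le hsT
  have hEb := energy_le_of_green hC hs hT1 hCs hE green hK
  obtain ⟨N, hN⟩ : ∃ N, N = s * p / h := ⟨_, rfl⟩
  have hsp : s * p = N * h := by rw [hN]; field_simp
  rw [hsp] at hEb
  have hp : p = N * h / s := by rw [← hsp]; field_simp
  have hCs2 : 0 < C * s := by positivity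
  have hCTs : C * T * s ≤ 1 / 6 := by nlinarith
  have hN2 : -(1 / 2) ≤ N := by
    by_contra hcon
    push Not at hcon
    have : N * h ≤ -(1 / 2) * h := by gcongr
    have : C * T * s * h ≤ 1 / 6 * h := by gcongr
    linarith
  obtain ⟨G, hG⟩ : ∃ G, G = N + 1 := ⟨_, rfl⟩
  have hG2 : 1 / 2 ≤ G := by linarith
  have hEG : E ≤ 2 * h * G := by
    have : C * T * s * h ≤ 1 / 6 * h := by gcongr
    rw [hG]; linarith
  obtain ⟨Q, hQ⟩ : ∃ Q, Q = q - p ^ 2 / h := ⟨_, rfl⟩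
  have hQ0 : 0 ≤ Q := by
    rw [hQ, sub_nonneg, div_le_iff₀ hh]; linarith
  have hq : q = Q + N ^ 2 * h / s ^ 2 := by
    rw [hQ, hp]; field_simp; ring
  have hNG : N ^ 2 ≤ G ^ 2 := by rw [hG]; nlinarith
  have he : e = 2 * q + ((n - 2) * E - 2 * L) / s ^ 2 := by
    rw [← poho]; field_simp; ring
  have hLG : |L| ≤ C * (s ^ 2 * h + 6 * T * s * (h * G)) := by
    refine hL.trans ?_
    have : T * s * E ≤ T * s * (2 * h * G) := by gcongr
    gcongr C * (_ + ?_); linarith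
  have hKG : |K| ≤ C * (2 * T * s * h + 6 * T * s * (h * G)) := by
    refine hK.trans ?_
    have : T * s * E ≤ T * s * (2 * h * G) := by gcongr
    gcongr C * (_ + ?_); linarith
  have key : (s / h) * (e + k - (n - 2) * p / s - 2 * p ^ 2 / h)
      = (s / h) * (2 * Q) + (s / h) * k - (2 * L + (n - 2) * K) / (s * h) := by
    have hKe : K = N * h - E := by linarith
    rw [he, hq, hp, hKe]; field_simp; ring
  have b1 : (2 * L + (n - 2) * K) / (s * h) ≤ C * T * G * (10 * n - 4) := by
    rw [div_le_iff₀ (by positivity)]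
    have h1 := (le_abs_self L).trans hLG
    have h2 : (n - 2) * K ≤ (n - 2) * (C * (2 * T * s * h + 6 * T * s * (h * G))) :=
      mul_le_mul_of_nonneg_left ((le_abs_self K).trans hKG) (by linarith)
    have h3 : C * s * h * s ≤ C * s * h * (2 * T * G) := by
      gcongr; nlinarith
    have h4 : C * T * s * h * 1 ≤ C * T * s * h * (2 * G) := by gcongr; linarith
    have h5 : (n - 2) * (C * T * s * h * 1) ≤ (n - 2) * (C * T * s * h * (2 * G)) := by
      gcongr; linarith
    linarith
  have b2 : (s / h) * |k| ≤ (s / h) * (2 * Q) + C * T * G * (4 * n + 5) := by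
    have hkG := hk (s / G) (by positivity)
    have hsG : s / G ≤ 2 * s := by
      rw [div_le_iff₀ (by positivity)]; nlinarith
    have hle : (s / G) * e ≤ 4 * s * Q + 2 * G * h / s + 4 * (n - 2) * h * G / s
        + (4 * C * s * h + 12 * C * T * h) := by
      have e1 : (s / G) * (2 * Q) ≤ 2 * s * (2 * Q) := by gcongr
      have e2 : (s / G) * (2 * (N ^ 2 * h / s ^ 2)) ≤ (s / G) * (2 * (G ^ 2 * h / s ^ 2)) := by
        gcongr
      have e2' : (s / G) * (2 * (G ^ 2 * h / s ^ 2)) = 2 * G * h / s := by field_simp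
      have e3 : (s / G) * ((n - 2) * E / s ^ 2) ≤ (2 * s) * ((n - 2) * (2 * h * G) / s ^ 2) := by
        have : 0 ≤ n - 2 := by linarith
        gcongr
      have e3' : (2 * s) * ((n - 2) * (2 * h * G) / s ^ 2) = 4 * (n - 2) * h * G / s := by
        field_simp; ring
      have e4 : (s / G) * (-2 * L / s ^ 2) ≤
          (s / G) * (2 * (C * (s ^ 2 * h + 6 * T * s * (h * G))) / s ^ 2) := by
        have : -2 * L ≤ 2 * (C * (s ^ 2 * h + 6 * T * s * (h * G))) := by
          linarith [(abs_le.1 hLG).1]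
        gcongr
      have e4' : (s / G) * (2 * (C * (s ^ 2 * h + 6 * T * s * (h * G))) / s ^ 2)
          = 2 * C * h * (s / G) + 12 * C * T * h := by
        field_simp; ring
      have e5 : 2 * C * h * (s / G) ≤ 2 * C * h * (2 * s) := by gcongr
      have e6 : (s / G) * e = (s / G) * (2 * Q) + (s / G) * (2 * (N ^ 2 * h / s ^ 2))
          + (s / G) * ((n - 2) * E / s ^ 2) + (s / G) * (-2 * L / s ^ 2) := by
        rw [he, hq]; ring
      linarith
    have hmain : (s / h) * |k| ≤ (s / h) * (C * (h + T * (4 * s * Q + 2 * G * h / s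
        + 4 * (n - 2) * h * G / s + (4 * C * s * h + 12 * C * T * h) + h / (s / G)))) := by
      gcongr
      refine hkG.trans ?_
      gcongr
    refine hmain.trans ?_
    have expand : (s / h) * (C * (h + T * (4 * s * Q + 2 * G * h / s
        + 4 * (n - 2) * h * G / s + (4 * C * s * h + 12 * C * T * h) + h / (s / G))))
        = (s / h) * (4 * (C * T * s) * Q) + C * (s + T * (3 * G + 4 * (n - 2) * G
          + 4 * (C * s) * s + 12 * (C * T * s))) := by
      field_simp; ring
    rw [expand]
    have f1 : (s / h) * (4 * (C * T * s) * Q) ≤ (s / h) * (2 * Q) := by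
      gcongr; linarith
    have f2 : s + T * (3 * G + 4 * (n - 2) * G + 4 * (C * s) * s + 12 * (C * T * s))
        ≤ T * (G * (4 * n + 5)) := by
      have : 4 * (C * s) * s ≤ 1 := by nlinarith
      have g1 : T * (3 * G + 4 * (n - 2) * G + 4 * (C * s) * s + 12 * (C * T * s))
        ≤ T * (3 * G + 4 * (n - 2) * G + 1 + 2) := by gcongr; linarith
      have g2 : s ≤ T * (2 * G) := by nlinarith
      have g3 : T * 3 ≤ T * (6 * G) := by gcongr; linarith
      linarith
    have f3 := mul_le_mul_of_nonneg_left f2 hC.le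
    linarith
  have b3 : -((s / h) * |k|) ≤ (s / h) * k := by
    rw [← mul_neg]; gcongr; exact neg_abs_le k
  rw [key, ← hN, ← hG]
  linarith

/-- The one-variable data (spherical averages as functions of the radius) of a weak solution of a
semilinear Laplace equation: `h` is the height, `p` its half derivative, `e` and `q` the averages of
the squared gradient and of the squared radial derivative, `k` and `l` the averages of the
right-hand side against the solution and against its radial derivative. -/
structure IsRadialProfile (n : ℕ) (τ C R : ℝ) (h p e q k l : ℝ → ℝ) : Prop where
  continuous_h : Continuous h
  continuous_p : Continuous p
  continuous_e : Continuous e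
  continuous_q : Continuous q
  h_nonneg : ∀ t, 0 ≤ h t
  hasDerivAt_h : ∀ t ∈ Ioo 0 R, HasDerivAt h (2 * p t) t
  sq_p_le : ∀ t, p t ^ 2 ≤ h t * q t
  q_nonneg : ∀ t, 0 ≤ q t
  q_le_e : ∀ t, q t ≤ e t
  integrable_k : ∀ s ∈ Ioo 0 R, IntervalIntegrable k volume 0 s
  integrable_l : ∀ s ∈ Ioo 0 R, IntervalIntegrable l volume 0 s
  green : ∀ s ∈ Ioo 0 R, s ^ (n - 1) * p s = ∫ t in 0..s, t ^ (n - 1) * (e t + k t)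
  pohozaev : ∀ s ∈ Ioo 0 R,
    s ^ n * (e s - 2 * q s) = ∫ t in 0..s, t ^ (n - 1) * ((n - 2) * e t - 2 * t * l t)
  abs_k_le : ∀ t ∈ Ioo 0 R, ∀ μ > 0, |k t| ≤ C * (h t + t ^ τ * (μ * e t + h t / μ))
  abs_l_le : ∀ t ∈ Ioo 0 R, |l t| ≤ C * (h t / t + t * e t + t ^ τ * e t)

namespace IsRadialProfile

variable {n : ℕ} {τ C R : ℝ} {h p e q k l : ℝ → ℝ}

lemma e_nonneg (H : IsRadialProfile n τ C R h p e q k l) (t : ℝ) : 0 ≤ e t :=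
  (H.q_nonneg t).trans (H.q_le_e t)

lemma two_mul_abs_p_le (H : IsRadialProfile n τ C R h p e q k l) (t : ℝ) :
    2 * t * |p t| ≤ h t + t ^ 2 * e t := by
  have h1 : (2 * t * |p t|) ^ 2 ≤ (h t + t ^ 2 * q t) ^ 2 := by
    rw [mul_pow, sq_abs]
    nlinarith [H.sq_p_le t, sq_nonneg (h t - t ^ 2 * q t), sq_nonneg t,
      mul_le_mul_of_nonneg_left (H.sq_p_le t) (sq_nonneg t)]
  have h2 := abs_le_of_sq_le_sq' h1
    (add_nonneg (H.h_nonneg t) (mul_nonneg (sq_nonneg t) (H.q_nonneg t)))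
  have h3 := mul_le_mul_of_nonneg_left (H.q_le_e t) (sq_nonneg t)
  linarith [h2.2]

lemma integral_h_le (H : IsRadialProfile n τ C R h p e q k l) (hn : 3 ≤ n) {s : ℝ}
    (hs : s ∈ Ioo 0 R) :
    ∫ t in 0..s, t ^ (n - 1) * h t ≤ s ^ n * h s + s ^ 2 * ∫ t in 0..s, t ^ (n - 1) * e t := by
  have hch := H.continuous_h
  have hce := H.continuous_e
  have hcp := H.continuous_p
  have ftc : ∫ t in 0..s, (n * t ^ (n - 1) * h t + t ^ n * (2 * p t))
      = s ^ n * h s - 0 ^ n * h 0 := by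
    refine intervalIntegral.integral_eq_sub_of_hasDerivAt_of_le
      (f := fun t => t ^ n * h t) hs.1.le (by fun_prop) ?_
      (Continuous.intervalIntegrable (by fun_prop) _ _)
    intro t ht
    exact (hasDerivAt_pow n t).mul (H.hasDerivAt_h t ⟨ht.1, ht.2.trans hs.2⟩)
  rw [zero_pow (by omega), zero_mul, sub_zero] at ftc
  rw [← ftc, ← intervalIntegral.integral_const_mul, ← intervalIntegral.integral_add
    (Continuous.intervalIntegrable (by fun_prop) _ _)
    (Continuous.intervalIntegrable (by fun_prop) _ _)]
  refine intervalIntegral.integral_mono_on hs.1.le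
    (Continuous.intervalIntegrable (by fun_prop) _ _)
    (Continuous.intervalIntegrable (by fun_prop) _ _) ?_
  intro t ht
  have h1 := H.two_mul_abs_p_le t
  have h2 : -(2 * t * p t) ≤ h t + t ^ 2 * e t := by
    nlinarith [neg_abs_le (p t), ht.1]
  have hp : t ^ n = t ^ (n - 1) * t := by rw [← pow_succ]; congr 1; omega
  have ht' : 0 ≤ t ^ (n - 1) := pow_nonneg ht.1 _
  have h3 : t ^ 2 * e t ≤ s ^ 2 * e t :=
    mul_le_mul_of_nonneg_right (pow_le_pow_left₀ ht.1 ht.2 2) (H.e_nonneg t)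
  have h4 : (3 : ℝ) ≤ n := by exact_mod_cast hn
  have h5 := mul_le_mul_of_nonneg_right h4 (H.h_nonneg t)
  have h6 : 0 ≤ h t := H.h_nonneg t
  rw [hp]
  have : t ^ (n - 1) * (h t) ≤ t ^ (n - 1) * (n * h t + 2 * t * p t + s ^ 2 * e t) := by
    gcongr; linarith
  linarith

lemma abs_integral_k_le (H : IsRadialProfile n τ C R h p e q k l) (hC : 0 < C)
    (hτ : 0 < τ) {s : ℝ} (hs : s ∈ Ioo 0 R) :
    |∫ t in 0..s, t ^ (n - 1) * k t| ≤ C * ((∫ t in 0..s, t ^ (n - 1) * h t)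
      + s ^ τ * (s * (∫ t in 0..s, t ^ (n - 1) * e t)
        + (∫ t in 0..s, t ^ (n - 1) * h t) / s)) := by
  have hch := H.continuous_h
  have hce := H.continuous_e
  have hs0 := hs.1
  calc |∫ t in 0..s, t ^ (n - 1) * k t|
      ≤ ∫ t in 0..s, C * (t ^ (n - 1) * h t
        + s ^ τ * (s * (t ^ (n - 1) * e t) + (t ^ (n - 1) * h t) / s)) := by
        rw [← Real.norm_eq_abs]
        refine intervalIntegral.norm_integral_le_of_norm_le hs.1.le ?_
          (Continuous.intervalIntegrable (by fun_prop) _ _)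
        refine Filter.Eventually.of_forall fun t ht => ?_
        have h1 := H.abs_k_le t ⟨ht.1, ht.2.trans_lt hs.2⟩ s hs.1
        have h2 : t ^ τ ≤ s ^ τ := Real.rpow_le_rpow ht.1.le ht.2 hτ.le
        have h3 := H.e_nonneg t
        have h4 := H.h_nonneg t
        rw [norm_mul, Real.norm_eq_abs, Real.norm_eq_abs, abs_of_nonneg (pow_nonneg ht.1.le _)]
        have h5 : |k t| ≤ C * (h t + s ^ τ * (s * e t + h t / s)) := by
          refine h1.trans ?_
          gcongr
        calc t ^ (n - 1) * |k t| ≤ t ^ (n - 1) * (C * (h t + s ^ τ * (s * e t + h t / s))) :=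
              mul_le_mul_of_nonneg_left h5 (pow_nonneg ht.1.le _)
          _ = _ := by ring
    _ = _ := by
        rw [intervalIntegral.integral_const_mul, intervalIntegral.integral_add,
          intervalIntegral.integral_const_mul, intervalIntegral.integral_add,
          intervalIntegral.integral_const_mul, intervalIntegral.integral_div]
        all_goals exact Continuous.intervalIntegrable (by fun_prop) _ _

lemma abs_integral_l_le (H : IsRadialProfile n τ C R h p e q k l) (hC : 0 < C)
    (hτ : 0 < τ) {s : ℝ} (hs : s ∈ Ioo 0 R) :
    |∫ t in 0..s, t ^ (n - 1) * (t * l t)| ≤ C * ((∫ t in 0..s, t ^ (n - 1) * h t)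
      + (s ^ 2 + s * s ^ τ) * ∫ t in 0..s, t ^ (n - 1) * e t) := by
  have hch := H.continuous_h
  have hce := H.continuous_e
  have hs0 := hs.1
  calc |∫ t in 0..s, t ^ (n - 1) * (t * l t)|
      ≤ ∫ t in 0..s, C * (t ^ (n - 1) * h t
        + (s ^ 2 + s * s ^ τ) * (t ^ (n - 1) * e t)) := by
        rw [← Real.norm_eq_abs]
        refine intervalIntegral.norm_integral_le_of_norm_le hs.1.le ?_
          (Continuous.intervalIntegrable (by fun_prop) _ _)
        refine Filter.Eventually.of_forall fun t ht => ?_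
        have ht0 : 0 < t := ht.1
        have h1 := H.abs_l_le t ⟨ht.1, ht.2.trans_lt hs.2⟩
        have h2 : t ^ τ ≤ s ^ τ := Real.rpow_le_rpow ht.1.le ht.2 hτ.le
        have h3 := H.e_nonneg t
        have h4 := H.h_nonneg t
        rw [norm_mul, norm_mul, Real.norm_eq_abs, Real.norm_eq_abs, Real.norm_eq_abs,
          abs_of_nonneg (pow_nonneg ht.1.le _), abs_of_pos ht0]
        have h5 : t * |l t| ≤ C * (h t + (s ^ 2 + s * s ^ τ) * e t) := by
          calc t * |l t| ≤ t * (C * (h t / t + t * e t + t ^ τ * e t)) := by gcongr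
            _ = C * (h t + (t ^ 2 + t * t ^ τ) * e t) := by field_simp; ring
            _ ≤ _ := by
              have := ht.2
              gcongr
        calc t ^ (n - 1) * (t * |l t|) ≤ t ^ (n - 1) * (C * (h t + (s ^ 2 + s * s ^ τ) * e t)) :=
              mul_le_mul_of_nonneg_left h5 (pow_nonneg ht.1.le _)
          _ = _ := by ring
    _ = _ := by
        rw [intervalIntegral.integral_const_mul, intervalIntegral.integral_add,
          intervalIntegral.integral_const_mul]
        all_goals exact Continuous.intervalIntegrable (by fun_prop) _ _

/-- The normalised energy, together with the bounds on the lower-order terms. -/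
lemma exists_energy (H : IsRadialProfile n τ C R h p e q k l) (hC : 0 < C) (hn : 3 ≤ n)
    (hτ : 0 < τ) (hτ1 : τ < 1) (hR : R ≤ 1) {s : ℝ} (hs : s ∈ Ioo 0 R) :
    ∃ E K L : ℝ, 0 ≤ E ∧ (∫ t in 0..s, t ^ (n - 1) * e t) = s ^ (n - 2) * E ∧
      E + K = s * p s ∧ s ^ 2 * (e s - 2 * q s) = (n - 2) * E - 2 * L ∧
      |K| ≤ C * (2 * s ^ τ * s * h s + 3 * s ^ τ * s * E) ∧
      |L| ≤ C * (s ^ 2 * h s + 3 * s ^ τ * s * E) := by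
  have hch := H.continuous_h
  have hce := H.continuous_e
  obtain ⟨X, hX⟩ : ∃ X, X = s ^ (n - 2) := ⟨_, rfl⟩
  have hs0 := hs.1
  have hX0 : 0 < X := hX ▸ pow_pos hs.1 _
  have hX1 : s ^ (n - 1) = X * s := by rw [hX, ← pow_succ]; congr 1; omega
  have hX2 : s ^ n = X * s ^ 2 := by rw [hX, ← pow_add]; congr 1; omega
  obtain ⟨E0, hE0⟩ : ∃ E0, E0 = ∫ t in 0..s, t ^ (n - 1) * e t := ⟨_, rfl⟩
  obtain ⟨J0, hJ0⟩ : ∃ E0, E0 = ∫ t in 0..s, t ^ (n - 1) * h t := ⟨_, rfl⟩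
  obtain ⟨K0, hK0⟩ : ∃ E0, E0 = ∫ t in 0..s, t ^ (n - 1) * k t := ⟨_, rfl⟩
  obtain ⟨L0, hL0⟩ : ∃ E0, E0 = ∫ t in 0..s, t ^ (n - 1) * (t * l t) := ⟨_, rfl⟩
  have hJ := H.integral_h_le hn hs
  have hK := H.abs_integral_k_le hC hτ hs
  have hL := H.abs_integral_l_le hC hτ hs
  have hki : IntervalIntegrable (fun t => t ^ (n - 1) * k t) volume 0 s :=
    (H.integrable_k s hs).continuousOn_mul (by fun_prop)
  have hli : IntervalIntegrable (fun t => t ^ (n - 1) * (t * l t)) volume 0 s :=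
    ((H.integrable_l s hs).continuousOn_mul (g := fun t => t) (by fun_prop)).continuousOn_mul
      (by fun_prop)
  have g1 : X * s * p s = E0 + K0 := by
    rw [← hX1, H.green s hs, hE0, hK0, ← intervalIntegral.integral_add
      (Continuous.intervalIntegrable (by fun_prop) _ _) hki]
    simp only [mul_add]
  have g2 : X * s ^ 2 * (e s - 2 * q s) = (n - 2) * E0 - 2 * L0 := by
    rw [← hX2, H.pohozaev s hs, hE0, hL0, ← intervalIntegral.integral_const_mul,
      ← intervalIntegral.integral_const_mul, ← intervalIntegral.integral_sub
      (Continuous.intervalIntegrable (by fun_prop) _ _) (hli.const_mul 2)]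
    refine intervalIntegral.integral_congr fun t _ => ?_
    ring
  rw [← hE0, ← hJ0, ← hK0] at hK
  rw [← hE0, ← hJ0, ← hL0] at hL
  rw [← hE0, ← hJ0, hX2] at hJ
  have hE0n : 0 ≤ E0 := by
    rw [hE0]
    refine intervalIntegral.integral_nonneg hs.1.le fun t ht => ?_
    exact mul_nonneg (pow_nonneg ht.1 _) (H.e_nonneg t)
  have hs1 : s ≤ 1 := hs.2.le.trans hR
  have hsT : s ≤ s ^ τ := by
    conv_lhs => rw [← Real.rpow_one s]
    exact Real.rpow_le_rpow_of_exponent_ge hs.1 hs1 hτ1.le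
  have hT0 : 0 < s ^ τ := Real.rpow_pos_of_pos hs.1 _
  have hhs := H.h_nonneg s
  refine ⟨E0 / X, K0 / X, L0 / X, by positivity, ?_, ?_, ?_, ?_, ?_⟩
  · rw [← hE0, ← hX]; field_simp
  · field_simp; linarith
  · field_simp; linarith
  · rw [abs_div, abs_of_pos hX0, div_le_iff₀ hX0]
    refine hK.trans ?_
    have : J0 / s ≤ X * s * h s + s * E0 := by
      rw [div_le_iff₀ hs0]; linarith
    calc C * (J0 + s ^ τ * (s * E0 + J0 / s))
        ≤ C * ((X * s ^ 2 * h s + s ^ 2 * E0) + s ^ τ * (s * E0 + (X * s * h s + s * E0))) := by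
          gcongr
      _ = C * (X * s * h s * s + s * E0 * s + s ^ τ * (2 * s * E0 + X * s * h s)) := by ring
      _ ≤ C * (X * s * h s * s ^ τ + s * E0 * s ^ τ + s ^ τ * (2 * s * E0 + X * s * h s)) := by
          gcongr
      _ = _ := by field_simp; ring
  · rw [abs_div, abs_of_pos hX0, div_le_iff₀ hX0]
    refine hL.trans ?_
    calc C * (J0 + (s ^ 2 + s * s ^ τ) * E0)
        ≤ C * ((X * s ^ 2 * h s + s ^ 2 * E0) + (s ^ 2 + s * s ^ τ) * E0) := by gcongr
      _ = C * (X * s ^ 2 * h s + (2 * s * E0 * s + s * s ^ τ * E0)) := by ring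
      _ ≤ C * (X * s ^ 2 * h s + (2 * s * E0 * s ^ τ + s * s ^ τ * E0)) := by gcongr
      _ = _ := by field_simp; ring

lemma p_eq (H : IsRadialProfile n τ C R h p e q k l) {s : ℝ} (hs : s ∈ Ioo 0 R) :
    p s = (s ^ (n - 1))⁻¹ * ∫ t in 0..s, t ^ (n - 1) * (e t + k t) := by
  rw [← H.green s hs, inv_mul_cancel_left₀ (pow_pos hs.1 _).ne']

lemma intervalIntegrable_green (H : IsRadialProfile n τ C R h p e q k l) {s : ℝ}
    (hs : s ∈ Ioo 0 R) :
    IntervalIntegrable (fun t => t ^ (n - 1) * (e t + k t)) volume 0 s :=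
  ((H.continuous_e.intervalIntegrable _ _).add (H.integrable_k s hs)).continuousOn_mul
    (by fun_prop)

lemma ae_hasDerivAt_p (H : IsRadialProfile n τ C R h p e q k l) (hn : 3 ≤ n) {b : ℝ}
    (hb : b ∈ Ioo 0 R) :
    ∀ᵐ s, s ∈ Ioo 0 b → HasDerivAt p (e s + k s - (n - 1) * p s / s) s := by
  filter_upwards [(H.intervalIntegrable_green hb).ae_hasDerivAt_integral] with s hs hsb
  have hs0 := hsb.1
  have h1 := hs (by rw [uIcc_of_le hb.1.le]; exact Ioo_subset_Icc_self hsb) 0 (by simp)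
  have h2 := ((hasDerivAt_pow (n - 1) s).inv (pow_pos hs0 _).ne').mul h1
  refine (h2.congr_of_eventuallyEq ?_).congr_deriv ?_
  · filter_upwards [Ioo_mem_nhds hsb.1 hsb.2] with t ht
    exact H.p_eq ⟨ht.1, ht.2.trans hb.2⟩
  · rw [← H.green s ⟨hs0, hsb.2.trans hb.2⟩]
    have e1 : s ^ (n - 1) = s ^ (n - 1 - 1) * s := by rw [← pow_succ]; congr 1; omega
    have e2 : ((n - 1 : ℕ) : ℝ) = n - 1 := by push_cast [show 1 ≤ n by omega]; ring
    have e3 : s ^ (n - 1 - 1) ≠ 0 := (pow_pos hs0 _).ne'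
    rw [e2]
    simp only [Pi.inv_apply]
    rw [e1]
    field_simp
    ring

lemma ae_freq_deriv (H : IsRadialProfile n τ C R h p e q k l) (hC : 0 < C) (hn : 3 ≤ n)
    (hτ : 0 < τ) (hτ1 : τ < 1) (hR : R ≤ 1) {b : ℝ} (hb : b ∈ Ioo 0 R) (hCb : 6 * C * b ≤ 1) :
    ∀ᵐ s, s ∈ Ioo 0 b → 0 < h s → ∃ N', HasDerivAt (fun s => s * p s / h s) N' s ∧
      -(C * (14 * n + 1)) * s ^ τ * (s * p s / h s + 1) ≤ N' := by
  filter_upwards [H.ae_hasDerivAt_p hn hb] with s hs hsb hh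
  have hs0 := hsb.1
  have hsR : s ∈ Ioo 0 R := ⟨hs0, hsb.2.trans hb.2⟩
  have hs1 : s ≤ 1 := hsR.2.le.trans hR
  refine ⟨_, ((hasDerivAt_id s).mul (hs hsb)).div (H.hasDerivAt_h s hsR) hh.ne', ?_⟩
  obtain ⟨E, K, L, hE, -, green, poho, hK, hL⟩ := H.exists_energy hC hn hτ hτ1 hR hsR
  have hsT : s ≤ s ^ τ := by
    conv_lhs => rw [← Real.rpow_one s]
    exact Real.rpow_le_rpow_of_exponent_ge hs0 hs1 hτ1.le
  refine (freq_deriv_lower_bound (n := n) (by exact_mod_cast hn) hC hs0 hs1 hsT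
    (Real.rpow_le_one hs0.le hs1 hτ.le) ?_ hh hE (H.sq_p_le s) green poho hK hL
    (H.abs_k_le s hsR)).trans_eq ?_
  · have := mul_le_mul_of_nonneg_left hsb.2.le (show 0 ≤ 6 * C by positivity)
    linarith
  · simp only [Pi.mul_apply, id]
    field_simp
    ring

lemma neg_le_freq (H : IsRadialProfile n τ C R h p e q k l) (hC : 0 < C) (hn : 3 ≤ n)
    (hτ : 0 < τ) (hτ1 : τ < 1) (hR : R ≤ 1) {c s : ℝ} (hs : s ∈ Ioo 0 R) (hCs : 6 * C * s ≤ 1)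
    (hCN : 4 * C * s ≤ c) (hh : 0 < h s) : -(c / 2) ≤ s * p s / h s := by
  obtain ⟨E, K, L, hE, -, green, -, hK, -⟩ := H.exists_energy hC hn hτ hτ1 hR hs
  have hT1 := Real.rpow_le_one hs.1.le (hs.2.le.trans hR) hτ.le
  have h1 := energy_le_of_green hC hs.1 hT1 hCs hE green hK
  rw [le_div_iff₀ hh]
  have h2 : 4 * C * s ^ τ * s * h s ≤ 4 * C * 1 * s * h s := by
    have := hs.1
    gcongr
  have h3 := mul_le_mul_of_nonneg_right hCN hh.le
  linarith

lemma absolutelyContinuousOnInterval_freq (H : IsRadialProfile n τ C R h p e q k l) {a b : ℝ}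
    (ha : 0 < a) (hab : a ≤ b) (hb : b < R) (hh : ∀ s ∈ Icc a b, 0 < h s) :
    AbsolutelyContinuousOnInterval (fun s => s * p s / h s) a b := by
  have hb0 : b ∈ Ioo 0 R := ⟨ha.trans_le hab, hb⟩
  have h1 : AbsolutelyContinuousOnInterval
      (fun s => ∫ t in 0..s, t ^ (n - 1) * (e t + k t)) 0 b :=
    (H.intervalIntegrable_green hb0).absolutelyContinuousOnInterval_intervalIntegral (by simp)
  have h2 : AbsolutelyContinuousOnInterval
      (fun s => ∫ t in 0..s, t ^ (n - 1) * (e t + k t)) a b := by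
    refine h1.mono ?_
    rw [uIcc_of_le hab, uIcc_of_le hb0.1.le]
    exact Icc_subset_Icc_left ha.le
  have h3 : ContDiffOn ℝ 1 h (Ioo 0 R) := by
    refine (contDiffOn_succ_iff_deriv_of_isOpen (n := 0) isOpen_Ioo).2 ⟨fun t ht =>
      (H.hasDerivAt_h t ht).differentiableAt.differentiableWithinAt, by simp, ?_⟩
    refine contDiffOn_zero.2 ((continuous_const.mul H.continuous_p).continuousOn.congr
      (f := fun t => 2 * p t) ?_)
    exact fun t ht => (H.hasDerivAt_h t ht).deriv
  have h4 : ContDiffOn ℝ 1 (fun s => s * (s ^ (n - 1))⁻¹ * (h s)⁻¹) (uIcc a b) := by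
    rw [uIcc_of_le hab]
    refine (contDiffOn_id.mul ((contDiffOn_id.pow _).inv ?_)).mul ((h3.mono ?_).inv ?_)
    · exact fun s hs => (pow_pos (ha.trans_le hs.1) _).ne'
    · exact fun s hs => ⟨ha.trans_le hs.1, hs.2.trans_lt hb⟩
    · exact fun s hs => (hh s hs).ne'
  have h5 := h4.absolutelyContinuousOnInterval.mul h2
  have h6 : ∀ s ∈ uIcc a b, s * p s / h s = ((fun s => s * (s ^ (n - 1))⁻¹ * (h s)⁻¹) *
      fun s => ∫ t in 0..s, t ^ (n - 1) * (e t + k t)) s := by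
    intro s hs
    rw [uIcc_of_le hab] at hs
    simp only [Pi.mul_apply]
    rw [H.p_eq ⟨ha.trans_le hs.1, hs.2.trans_lt hb⟩]
    ring
  rw [absolutelyContinuousOnInterval_iff] at h5 ⊢
  intro ε hε
  obtain ⟨δ, hδ, h7⟩ := h5 ε hε
  refine ⟨δ, hδ, fun I hI hlt => ?_⟩
  refine lt_of_eq_of_lt (Finset.sum_congr rfl fun i hi => ?_) (h7 I hI hlt)
  rw [h6 _ (hI.1 i hi).1, h6 _ (hI.1 i hi).2]

lemma hasDerivAt_exp_rpow (A : ℝ) {τ s : ℝ} (hτ : 0 < τ) (hs : 0 < s) :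
    HasDerivAt (fun s => Real.exp (A / (τ + 1) * s ^ (τ + 1)))
      (Real.exp (A / (τ + 1) * s ^ (τ + 1)) * (A * s ^ τ)) s := by
  have h1 := (((Real.hasDerivAt_rpow_const (p := τ + 1) (Or.inl hs.ne')).const_mul
    (A / (τ + 1))).exp)
  refine h1.congr_deriv ?_
  rw [add_sub_cancel_right]
  field_simp

lemma freq_mono (H : IsRadialProfile n τ C R h p e q k l) (hC : 0 < C) (hn : 3 ≤ n)
    (hτ : 0 < τ) (hτ1 : τ < 1) (hR : R ≤ 1) {c : ℝ} (hc : 0 < c) {a b : ℝ} (ha : 0 < a)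
    (hab : a ≤ b) (hb : b < R) (hCb : 6 * C * b ≤ 1) (hCN : 4 * C * b ≤ c)
    (hh : ∀ s ∈ Icc a b, 0 < h s) {A : ℝ} (hA : A = C * (14 * n + 1) * (1 + 2 / c)) :
    Real.exp (A / (τ + 1) * a ^ (τ + 1)) * (a * p a / h a + c) ≤
      Real.exp (A / (τ + 1) * b ^ (τ + 1)) * (b * p b / h b + c) := by
  have h1 := H.absolutelyContinuousOnInterval_freq ha hab hb hh
  have hexp : ContDiffOn ℝ 1 (fun s => Real.exp (A / (τ + 1) * s ^ (τ + 1))) (uIcc a b) := by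
    rw [uIcc_of_le hab]
    refine (contDiffOn_const.mul (contDiffOn_id.rpow_const_of_ne ?_)).exp
    exact fun s hs => (ha.trans_le hs.1).ne'
  have h2 : AbsolutelyContinuousOnInterval
      ((fun s => Real.exp (A / (τ + 1) * s ^ (τ + 1))) * ((fun s => s * p s / h s) + fun _ => c))
      a b :=
    hexp.absolutelyContinuousOnInterval.mul
      (h1.add (contDiffOn_const (c := c)).absolutelyContinuousOnInterval)
  have h3 := h2.integral_deriv_eq_sub
  have h4 : 0 ≤ ∫ x in a..b, deriv ((fun s => Real.exp (A / (τ + 1) * s ^ (τ + 1))) *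
      ((fun s => s * p s / h s) + fun _ => c)) x := by
    refine intervalIntegral.integral_nonneg_of_ae_restrict hab ?_
    rw [← Measure.restrict_congr_set Ioo_ae_eq_Icc]
    refine (ae_restrict_iff' measurableSet_Ioo).2 ?_
    filter_upwards [H.ae_freq_deriv hC hn hτ hτ1 hR ⟨ha.trans_le hab, hb⟩ hCb] with s hs hsab
    have hs0 := ha.trans hsab.1
    have hhs := hh s ⟨hsab.1.le, hsab.2.le⟩
    obtain ⟨N', hN', hle⟩ := hs ⟨hs0, hsab.2⟩ hhs
    have h5 := (hasDerivAt_exp_rpow A hτ hs0).mul (hN'.add (hasDerivAt_const s c))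
    rw [h5.deriv]
    have h6 : -(c / 2) ≤ s * p s / h s := by
      refine H.neg_le_freq hC hn hτ hτ1 hR ⟨hs0, hsab.2.trans hb⟩ ?_ ?_ hhs
      · exact (mul_le_mul_of_nonneg_left hsab.2.le (by positivity)).trans hCb
      · exact (mul_le_mul_of_nonneg_left hsab.2.le (by positivity)).trans hCN
    obtain ⟨N, hN⟩ : ∃ N, N = s * p s / h s := ⟨_, rfl⟩
    have hT : 0 < s ^ τ := Real.rpow_pos_of_pos hs0 _
    rw [← hN] at hle h6
    have h7 : N + 1 ≤ (1 + 2 / c) * (N + c) := by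
      have : (1 + 2 / c) * (N + c) - (N + 1) = (2 / c) * (N + c / 2) + c := by
        field_simp; ring
      have h8 : 0 ≤ (2 / c) * (N + c / 2) := mul_nonneg (by positivity) (by linarith)
      linarith
    have h8 : C * (14 * n + 1) * s ^ τ * (N + 1) ≤
        C * (14 * n + 1) * s ^ τ * ((1 + 2 / c) * (N + c)) := by gcongr
    have h9 : 0 ≤ A * s ^ τ * (N + c) + N' := by
      rw [hA]; linarith
    simp only [Pi.zero_apply, Pi.add_apply, ← hN, add_zero]
    have := mul_nonneg (Real.exp_nonneg (A / (τ + 1) * s ^ (τ + 1))) h9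
    linarith
  rw [h3] at h4
  simp only [Pi.mul_apply, Pi.add_apply] at h4
  linarith

lemma h_eq_zero_of_le (H : IsRadialProfile n τ C R h p e q k l) (hC : 0 < C) (hn : 3 ≤ n)
    (hτ : 0 < τ) (hτ1 : τ < 1) (hR : R ≤ 1) {s : ℝ} (hs : s ∈ Ioo 0 R) (hCs : 6 * C * s ≤ 1)
    (hh : h s = 0) {t : ℝ} (ht : 0 < t) (hts : t ≤ s) : h t = 0 := by
  obtain ⟨E, K, L, hE, hEe, green, -, hK, -⟩ := H.exists_energy hC hn hτ hτ1 hR hs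
  have hT1 := Real.rpow_le_one hs.1.le (hs.2.le.trans hR) hτ.le
  have h1 := energy_le_of_green hC hs.1 hT1 hCs hE green hK
  have hps : p s = 0 := by
    have := H.sq_p_le s
    rw [hh, zero_mul] at this
    exact pow_eq_zero_iff two_ne_zero |>.1 (le_antisymm this (sq_nonneg _))
  rw [hh, hps] at h1
  have hE0 : E = 0 := by linarith
  rw [hE0, mul_zero] at hEe
  have hce := H.continuous_e
  have he : ∀ r ∈ Ioo 0 s, e r = 0 := by
    intro r hr
    by_contra hne
    have : 0 < ∫ t in 0..s, t ^ (n - 1) * e t := by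
      refine intervalIntegral.integral_pos hs.1 (by fun_prop)
        (fun x hx => mul_nonneg (pow_nonneg hx.1.le _) (H.e_nonneg x))
        ⟨r, ⟨hr.1.le, hr.2.le⟩, mul_pos (pow_pos hr.1 _) ((H.e_nonneg r).lt_of_ne' hne)⟩
    linarith
  have hp : ∀ r ∈ Ioo 0 s, p r = 0 := by
    intro r hr
    have h2 := H.sq_p_le r
    have h3 : q r = 0 := le_antisymm ((H.q_le_e r).trans_eq (he r hr)) (H.q_nonneg r)
    rw [h3, mul_zero] at h2
    exact pow_eq_zero_iff two_ne_zero |>.1 (le_antisymm h2 (sq_nonneg _))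
  rcases hts.eq_or_lt with rfl | hlt
  · exact hh
  obtain ⟨r, hr, hr'⟩ := exists_hasDerivAt_eq_slope h (fun t => 2 * p t) hlt
    H.continuous_h.continuousOn (fun r hr => H.hasDerivAt_h r ⟨ht.trans hr.1, hr.2.trans hs.2⟩)
  rw [hp r ⟨ht.trans hr.1, hr.2⟩, hh, eq_div_iff (sub_pos.2 hlt).ne'] at hr'
  linarith

lemma h_pos_or_eq_zero (H : IsRadialProfile n τ C R h p e q k l) (hC : 0 < C) (hn : 3 ≤ n)
    (hτ : 0 < τ) (hτ1 : τ < 1) (hR : R ≤ 1) {ρ c : ℝ} (hc : 0 < c) (hρ : ρ ≤ R)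
    (hCρ : 6 * C * ρ ≤ 1) (hCN : 4 * C * ρ ≤ c) :
    (∀ t ∈ Ioo 0 ρ, 0 < h t) ∨ ∀ t ∈ Ioo 0 ρ, h t = 0 := by
  have scale : ∀ {t : ℝ}, t ≤ ρ → 6 * C * t ≤ 1 ∧ 4 * C * t ≤ c := fun ht =>
    ⟨(mul_le_mul_of_nonneg_left ht (by positivity)).trans hCρ,
      (mul_le_mul_of_nonneg_left ht (by positivity)).trans hCN⟩
  by_contra! hcon
  obtain ⟨⟨s, hs, hs0⟩, ⟨b, hb, hb0⟩⟩ := hcon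
  have hhs : h s = 0 := le_antisymm hs0 (H.h_nonneg s)
  have hsb : s < b := by
    by_contra! hle
    exact hb0 (H.h_eq_zero_of_le hC hn hτ hτ1 hR ⟨hs.1, hs.2.trans_le hρ⟩
      (scale hs.2.le).1 hhs hb.1 hle)
  obtain ⟨z, ⟨hz, hz0⟩, hzmax⟩ := (isCompact_Icc.inter_right
    (isClosed_singleton.preimage H.continuous_h : IsClosed (h ⁻¹' {0}))).exists_isGreatest
    (s := Icc s b ∩ h ⁻¹' {0}) ⟨s, ⟨le_rfl, hsb.le⟩, hhs⟩
  have hz0' : h z = 0 := hz0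
  have hzp : 0 < z := hs.1.trans_le hz.1
  have hzb : z < b := lt_of_le_of_ne hz.2 (by rintro rfl; exact hb0 hz0')
  have hpos : ∀ t ∈ Ioc z b, 0 < h t := by
    intro t ht
    refine (H.h_nonneg t).lt_of_ne' fun h0 => ?_
    exact absurd (hzmax ⟨⟨hz.1.trans ht.1.le, ht.2⟩, h0⟩) (not_le.2 ht.1)
  obtain ⟨A, hA⟩ : ∃ A, A = C * (14 * n + 1) * (1 + 2 / c) := ⟨_, rfl⟩
  have hA0 : 0 ≤ A := hA ▸ by positivity
  obtain ⟨B, hB⟩ : ∃ B, B = Real.exp (A / (τ + 1) * b ^ (τ + 1)) * (b * p b / h b + c) :=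
    ⟨_, rfl⟩
  have hbound : ∀ t ∈ Ioc z b, 0 ≤ B ∧ t * p t ≤ B * h t := by
    intro t ht
    have ht0 := hzp.trans ht.1
    have h1 := H.freq_mono hC hn hτ hτ1 hR hc ht0 ht.2 (hb.2.trans_le hρ)
      (scale hb.2.le).1 (scale hb.2.le).2
      (fun r hr => hpos r ⟨ht.1.trans_le hr.1, hr.2⟩) hA
    have htρ : t ≤ ρ := ht.2.trans hb.2.le
    have h2 := H.neg_le_freq hC hn hτ hτ1 hR ⟨ht0, (ht.2.trans_lt hb.2).trans_le hρ⟩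
      (scale htρ).1 (scale htρ).2 (hpos t ht)
    have h3 : 1 ≤ Real.exp (A / (τ + 1) * t ^ (τ + 1)) :=
      Real.one_le_exp (by have := Real.rpow_nonneg ht0.le (τ + 1); positivity)
    rw [← hB] at h1
    have h4 := mul_le_mul_of_nonneg_right h3 (show 0 ≤ t * p t / h t + c by linarith)
    refine ⟨by linarith, ?_⟩
    rw [← div_le_iff₀ (hpos t ht)]
    linarith
  have hB0 : 0 ≤ B := (hbound b ⟨hzb, le_rfl⟩).1
  have hanti : AntitoneOn (fun t => h t * Real.exp (-(2 * B / z) * t)) (Icc z b) := by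
    refine antitoneOn_of_hasDerivWithinAt_nonpos
      (f' := fun t => (2 * p t) * Real.exp (-(2 * B / z) * t) +
        h t * (Real.exp (-(2 * B / z) * t) * (-(2 * B / z)))) (convex_Icc _ _) ?_ ?_ ?_
    · have := H.continuous_h
      fun_prop
    · intro t ht
      rw [interior_Icc] at ht
      refine HasDerivAt.hasDerivWithinAt ?_
      refine (H.hasDerivAt_h t ⟨hzp.trans ht.1, (ht.2.trans hb.2).trans_le hρ⟩).mul ?_
      simpa using ((hasDerivAt_id t).const_mul (-(2 * B / z))).exp
    · intro t ht
      rw [interior_Icc] at ht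
      have h1 := (hbound t ⟨ht.1, ht.2.le⟩).2
      have h2 : p t ≤ B / z * h t := by
        have ht0 := hzp.trans ht.1
        have : p t ≤ B * h t / t := by rw [le_div_iff₀ ht0]; linarith
        refine this.trans ?_
        rw [div_mul_eq_mul_div]
        have := (H.h_nonneg t)
        have := ht.1.le
        gcongr
      have h3 := mul_nonneg (Real.exp_nonneg (-(2 * B / z) * t)) (sub_nonneg.2 h2)
      have h4 : 2 * B / z = 2 * (B / z) := by ring
      rw [h4] at h3 ⊢
      linarith
  have := hanti ⟨le_rfl, hzb.le⟩ ⟨hzb.le, le_rfl⟩ hzb.le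
  simp only [hz0', zero_mul] at this
  have h5 := mul_pos (hpos b ⟨hzb, le_rfl⟩) (Real.exp_pos (-(2 * B / z) * b))
  linarith

lemma exists_tendsto_freq (H : IsRadialProfile n τ C R h p e q k l) (hC : 0 < C) (hn : 3 ≤ n)
    (hτ : 0 < τ) (hτ1 : τ < 1) (hR : R ≤ 1) {ρ c : ℝ} (hc : 0 < c) (hρ0 : 0 < ρ) (hρ : ρ ≤ R)
    (hCρ : 6 * C * ρ ≤ 1) (hCN : 4 * C * ρ ≤ c) (hpos : ∀ t ∈ Ioo 0 ρ, 0 < h t) {A : ℝ}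
    (hA : A = C * (14 * n + 1) * (1 + 2 / c)) :
    MonotoneOn (fun s => Real.exp (A / (τ + 1) * s ^ (τ + 1)) * (s * p s / h s + c)) (Ioo 0 ρ) ∧
    ∃ L, Filter.Tendsto (fun s => s * p s / h s) (nhdsWithin 0 (Ioi 0)) (nhds L) := by
  have scale : ∀ {t : ℝ}, t ≤ ρ → 6 * C * t ≤ 1 ∧ 4 * C * t ≤ c := fun ht =>
    ⟨(mul_le_mul_of_nonneg_left ht (by positivity)).trans hCρ,
      (mul_le_mul_of_nonneg_left ht (by positivity)).trans hCN⟩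
  have hmono : MonotoneOn (fun s => Real.exp (A / (τ + 1) * s ^ (τ + 1)) * (s * p s / h s + c))
      (Ioo 0 ρ) := by
    intro a ha b hb hab
    exact H.freq_mono hC hn hτ hτ1 hR hc ha.1 hab (hb.2.trans_le hρ) (scale hb.2.le).1
      (scale hb.2.le).2 (fun r hr => hpos r ⟨ha.1.trans_le hr.1, hr.2.trans_lt hb.2⟩) hA
  refine ⟨hmono, ?_⟩
  have h1 := hmono.tendsto_nhdsWithin_Ioo_right (nonempty_Ioo.2 hρ0) ⟨0, by
    rintro _ ⟨s, hs, rfl⟩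
    have h2 := H.neg_le_freq hC hn hτ hτ1 hR ⟨hs.1, hs.2.trans_le hρ⟩ (scale hs.2.le).1
      (scale hs.2.le).2 (hpos s hs)
    exact mul_nonneg (Real.exp_nonneg _) (by linarith)⟩
  have h3 : Filter.Tendsto (fun s : ℝ => Real.exp (-(A / (τ + 1) * s ^ (τ + 1))))
      (nhdsWithin 0 (Ioi 0)) (nhds 1) := by
    have : Continuous fun s : ℝ => Real.exp (-(A / (τ + 1) * s ^ (τ + 1))) := by
      have := Real.continuous_rpow_const (q := τ + 1) (by linarith)
      fun_prop
    have h4 := this.tendsto 0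
    rw [Real.zero_rpow (by linarith), mul_zero, neg_zero, Real.exp_zero] at h4
    exact h4.mono_left nhdsWithin_le_nhds
  refine ⟨_, ((h3.mul h1).sub_const c).congr fun s => ?_⟩
  rw [← mul_assoc, ← Real.exp_add, neg_add_cancel, Real.exp_zero]
  ring

end IsRadialProfile

/-- Two finite measures on a compact metric space for which the measure of a ball only depends on
its radius are proportional. -/
lemma exists_integral_eq_of_ball_measure_eq {S : Type*} [MetricSpace S] [CompactSpace S]
    [SecondCountableTopology S] [MeasurableSpace S] [BorelSpace S] (ν σ : Measure S)
    [IsFiniteMeasure ν] [IsFiniteMeasure σ] [NeZero ν] [NeZero σ] [σ.IsOpenPosMeasure]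
    (hν : ∀ x y r, ν (Metric.ball x r) = ν (Metric.ball y r))
    (hσ : ∀ x y r, σ (Metric.ball x r) = σ (Metric.ball y r)) :
    ∃ c : ℝ, 0 < c ∧ ∀ f : S → ℝ, Continuous f → ∫ x, f x ∂ν = c * ∫ x, f x ∂σ := by
  have hν0 : 0 < ν.real univ := measureReal_univ_pos
  have hσ0 : 0 < σ.real univ := measureReal_univ_pos
  obtain ⟨o⟩ : Nonempty S := by
    by_contra h
    rw [not_nonempty_iff] at h
    simp [Measure.eq_zero_of_isEmpty σ] at hσ0
  have key : ∀ f : S → ℝ, Continuous f → ∀ ε > 0, ∀ r > 0,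
      (∀ x y, dist x y < r → |f x - f y| ≤ ε) →
      |σ.real (Metric.ball o r) * ∫ x, f x ∂ν - ν.real (Metric.ball o r) * ∫ x, f x ∂σ| ≤
        ν.real (Metric.ball o r) * ε * σ.real univ := by
    intro f hf ε hε r hr hfr
    obtain ⟨B, hB⟩ : ∃ B, ∀ x, ‖f x‖ ≤ B := by
      obtain ⟨B, hB⟩ := isCompact_univ.exists_bound_of_continuousOn hf.continuousOn
      exact ⟨B, fun x => hB x (mem_univ _)⟩
    have hfi : ∀ (m : Measure S) [IsFiniteMeasure m], Integrable f m := fun m _ =>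
      Integrable.of_bound hf.aestronglyMeasurable B (Filter.Eventually.of_forall hB)
    have hmeas : MeasurableSet {z : S × S | dist z.1 z.2 < r} :=
      (isOpen_lt continuous_dist continuous_const).measurableSet
    have hprod : Integrable (Function.uncurry fun x y => indicator {z : S × S | dist z.1 z.2 < r}
        (fun z => f z.1) (x, y)) (ν.prod σ) := by
      refine Integrable.indicator (f := fun z : S × S => f z.1) ?_ hmeas
      exact Integrable.of_bound (hf.comp continuous_fst).aestronglyMeasurable B
        (Filter.Eventually.of_forall fun z => hB z.1)
    have hswap := integral_integral_swap hprod
    have e1 : ∀ x, ∫ y, indicator {z : S × S | dist z.1 z.2 < r} (fun z => f z.1) (x, y) ∂σ =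
        σ.real (Metric.ball o r) * f x := by
      intro x
      have : (fun y => indicator {z : S × S | dist z.1 z.2 < r} (fun z => f z.1) (x, y)) =
          indicator (Metric.ball x r) fun _ => f x := by
        ext y
        simp [indicator, Metric.mem_ball, dist_comm]
      rw [this, integral_indicator measurableSet_ball, setIntegral_const, smul_eq_mul,
        measureReal_def, measureReal_def, hσ x o r]
    have e2 : ∀ y, ∫ x, indicator {z : S × S | dist z.1 z.2 < r} (fun z => f z.1) (x, y) ∂ν =
        ∫ x in Metric.ball y r, f x ∂ν := by
      intro y
      rw [← integral_indicator measurableSet_ball]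
      rfl
    simp only [e1, e2] at hswap
    rw [integral_const_mul] at hswap
    rw [hswap, ← integral_const_mul, ← integral_sub, ← Real.norm_eq_abs]
    · refine norm_integral_le_of_norm_le_const (Filter.Eventually.of_forall fun y => ?_)
      have e3 : ν.real (Metric.ball o r) * f y = ∫ x in Metric.ball y r, f y ∂ν := by
        rw [setIntegral_const, smul_eq_mul, measureReal_def, measureReal_def, hν y o r]
      rw [e3, ← integral_sub (hfi _) (integrable_const _)]
      have e4 : ‖∫ x in Metric.ball y r, (f x - f y) ∂ν‖ ≤ ε * ν.real (Metric.ball y r) :=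
        norm_setIntegral_le_of_norm_le_const (measure_lt_top _ _) (fun x hx => hfr x y hx)
      refine e4.trans_eq ?_
      rw [mul_comm, measureReal_def, measureReal_def, hν y o r]
    · simp only [← e2]
      exact hprod.integral_prod_right
    · exact (hfi σ).const_mul _
  have hk : ∀ r > 0, 0 < σ.real (Metric.ball o r) := fun r hr =>
    ENNReal.toReal_pos (Metric.measure_ball_pos σ o hr).ne' (measure_ne_top _ _)
  have hone : ∀ r > 0, σ.real (Metric.ball o r) * ν.real univ
      = ν.real (Metric.ball o r) * σ.real univ := by
    intro r hr
    refine eq_of_abs_sub_le_all fun ε hε => ?_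
    obtain ⟨δ, hδ, hδε⟩ : ∃ δ > 0, ν.real (Metric.ball o r) * δ * σ.real univ ≤ ε := by
      refine ⟨ε / ((ν.real (Metric.ball o r) + 1) * σ.real univ), by positivity, ?_⟩
      have : 0 ≤ ν.real (Metric.ball o r) := measureReal_nonneg
      rw [mul_div_assoc', div_mul_eq_mul_div, div_le_iff₀ (by positivity)]
      nlinarith [mul_pos hε hσ0]
    have := key (fun _ => 1) continuous_const δ hδ r hr (by simpa using fun _ _ _ => hδ.le)
    simp only [integral_const, smul_eq_mul, mul_one] at this
    exact this.trans hδε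
  refine ⟨ν.real univ / σ.real univ, by positivity, fun f hf => ?_⟩
  refine eq_of_abs_sub_le_all fun ε hε => ?_
  have hunif := CompactSpace.uniformContinuous_of_continuous hf
  rw [Metric.uniformContinuous_iff] at hunif
  obtain ⟨r, hr, hfr⟩ := hunif (ε / ν.real univ) (by positivity)
  have h1 := key f hf (ε / ν.real univ) (by positivity) r hr (fun x y hxy => (hfr hxy).le)
  have hkr := hk r hr
  have h2 := hone r hr
  have h3 : ν.real (Metric.ball o r) = σ.real (Metric.ball o r) * (ν.real univ / σ.real univ) := by
    field_simp
    linarith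
  rw [h3, mul_assoc (σ.real (Metric.ball o r)), ← mul_sub, abs_mul, abs_of_pos hkr] at h1
  have h4 : σ.real (Metric.ball o r) * (ν.real univ / σ.real univ) * (ε / ν.real univ) *
      σ.real univ = σ.real (Metric.ball o r) * ε := by field_simp
  rw [h4] at h1
  exact le_of_mul_le_mul_left h1 hkr

section Sphere

variable {E : Type*} [NormedAddCommGroup E] [InnerProductSpace ℝ E] [FiniteDimensional ℝ E]
  [MeasurableSpace E] [BorelSpace E]

lemma hausdorffMeasure_half_sphere_lt_top {m : ℕ} (hm : Module.finrank ℝ E = m + 1) {v : E}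
    (hv : ‖v‖ = 1) : μH[m] {x : E | ‖x‖ = 1 ∧ inner ℝ v x ≤ 0} < ⊤ := by
  have hfr : Module.finrank ℝ (ℝ ∙ v)ᗮ = m :=
    haveI : Fact (Module.finrank ℝ E = m + 1) := ⟨hm⟩
    Submodule.finrank_orthogonal_span_singleton (by rintro rfl; simp at hv)
  obtain ⟨K, hK⟩ : ∃ K, LipschitzOnWith K (fun w : (ℝ ∙ v)ᗮ => stereoInvFunAux v (w : E))
      (Metric.closedBall 0 2) := by
    refine ContDiffOn.exists_lipschitzOnWith (n := 1) ?_ (by simp) (convex_closedBall _ _)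
      (isCompact_closedBall _ _)
    exact (contDiff_stereoInvFunAux.comp (ℝ ∙ v)ᗮ.subtypeL.contDiff).contDiffOn
  have h1 := hK.hausdorffMeasure_image_le (d := m) (Nat.cast_nonneg m)
  have h2 : μH[m] (Metric.closedBall (0 : (ℝ ∙ v)ᗮ) 2) < ⊤ := by
    have : (μH[(Module.finrank ℝ (ℝ ∙ v)ᗮ : ℝ)] : Measure (ℝ ∙ v)ᗮ).IsAddHaarMeasure :=
      inferInstance
    rw [hfr] at this
    exact (isCompact_closedBall _ _).measure_lt_top
  refine (measure_mono ?_).trans_lt (h1.trans_lt (ENNReal.mul_lt_top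
    (ENNReal.rpow_lt_top_of_nonneg (Nat.cast_nonneg m) ENNReal.coe_ne_top) h2))
  rintro x ⟨hx, hvx⟩
  have hxv : x ≠ v := by
    rintro rfl
    rw [real_inner_self_eq_norm_sq, hv] at hvx
    norm_num at hvx
  refine ⟨stereoToFun v x, ?_, ?_⟩
  · rw [mem_closedBall_zero_iff, stereoToFun_apply, norm_smul, innerSL_apply_apply,
      Real.norm_eq_abs, abs_of_pos (by apply div_pos <;> linarith)]
    have h3 : ‖(ℝ ∙ v)ᗮ.orthogonalProjectionOnto x‖ ≤ 1 :=
      ((ℝ ∙ v)ᗮ.norm_orthogonalProjectionOnto_apply_le x).trans hx.le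
    have h4 : 2 / (1 - inner ℝ v x) ≤ 2 := by
      rw [div_le_iff₀ (by linarith)]; linarith
    calc _ ≤ (2 : ℝ) * 1 := by gcongr
      _ = 2 := by norm_num
  · have := stereo_left_inv hv (x := ⟨x, by simpa using hx⟩) hxv
    exact congrArg Subtype.val this

lemma hausdorffMeasure_sphere_lt_top {m : ℕ} (hm : Module.finrank ℝ E = m + 1) :
    μH[m] (Metric.sphere (0 : E) 1) < ⊤ := by
  have : Nontrivial E := Module.nontrivial_of_finrank_pos (R := ℝ) (by omega)
  obtain ⟨v, hv⟩ := exists_norm_eq E zero_le_one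
  have h1 := hausdorffMeasure_half_sphere_lt_top hm hv
  have h2 := hausdorffMeasure_half_sphere_lt_top hm (v := -v) (by rwa [norm_neg])
  refine (measure_mono ?_).trans_lt ((measure_union_le _ _).trans_lt
    (ENNReal.add_lt_top.2 ⟨h1, h2⟩))
  intro x hx
  rw [mem_sphere_zero_iff_norm] at hx
  rcases le_total (inner ℝ v x) 0 with h | h
  · exact Or.inl ⟨hx, h⟩
  · exact Or.inr ⟨hx, by rw [inner_neg_left]; linarith⟩

lemma hausdorffMeasure_sphere_pos {m : ℕ} (hm : Module.finrank ℝ E = m + 1) :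
    0 < μH[m] (Metric.sphere (0 : E) 1) := by
  have : Nontrivial E := Module.nontrivial_of_finrank_pos (R := ℝ) (by omega)
  obtain ⟨v, hv⟩ := exists_norm_eq E zero_le_one
  have hfr : Module.finrank ℝ (ℝ ∙ v)ᗮ = m :=
    haveI : Fact (Module.finrank ℝ E = m + 1) := ⟨hm⟩
    Submodule.finrank_orthogonal_span_singleton (by rintro rfl; simp at hv)
  have h2 : 0 < μH[m] (Metric.ball (0 : (ℝ ∙ v)ᗮ) 1) := by
    have : (μH[(Module.finrank ℝ (ℝ ∙ v)ᗮ : ℝ)] : Measure (ℝ ∙ v)ᗮ).IsAddHaarMeasure :=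
      inferInstance
    rw [hfr] at this
    exact Metric.measure_ball_pos _ _ one_pos
  have h1 := (ℝ ∙ v)ᗮ.lipschitzWith_orthogonalProjectionOnto.hausdorffMeasure_image_le
    (d := m) (Nat.cast_nonneg m) (Metric.sphere (0 : E) 1)
  rw [ENNReal.coe_one, ENNReal.one_rpow, one_mul] at h1
  refine (h2.trans_le (measure_mono ?_)).trans_le h1
  intro w hw
  rw [mem_ball_zero_iff] at hw
  have hvw : inner ℝ (w : E) v = 0 := Submodule.mem_orthogonal_singleton_iff_inner_left.1 w.2
  refine ⟨w + √(1 - ‖w‖ ^ 2) • v, ?_, ?_⟩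
  · have h3 : 0 ≤ 1 - ‖w‖ ^ 2 := by nlinarith [norm_nonneg w]
    rw [mem_sphere_zero_iff_norm, ← sq_eq_sq₀ (norm_nonneg _) zero_le_one, norm_add_sq_real,
      inner_smul_right, hvw, norm_smul, hv, Real.norm_eq_abs, abs_of_nonneg (Real.sqrt_nonneg _),
      mul_one, Real.sq_sqrt h3, Submodule.coe_norm]
    ring
  · have h3 : (ℝ ∙ v)ᗮ.orthogonalProjectionOnto v = 0 := by
      rw [Submodule.orthogonalProjectionOnto_eq_zero_iff, Submodule.orthogonal_orthogonal]
      exact Submodule.mem_span_singleton_self v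
    rw [map_add, map_smul, h3, smul_zero, add_zero,
      Submodule.orthogonalProjectionOnto_mem_subspace_eq_self]

/-- A linear isometry restricted to the unit sphere. -/
def LinearIsometryEquiv.unitSphere (T : E ≃ₗᵢ[ℝ] E) :
    Metric.sphere (0 : E) 1 ≃ᵢ Metric.sphere (0 : E) 1 where
  toFun x := ⟨T x, by simp⟩
  invFun x := ⟨T.symm x, by simp⟩
  left_inv x := by simp
  right_inv x := by simp
  isometry_toFun x y := by simp [Subtype.edist_eq]

omit [FiniteDimensional ℝ E] [MeasurableSpace E] [BorelSpace E] in
lemma exists_unitSphere_apply_eq (x y : Metric.sphere (0 : E) 1) :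
    ∃ T : E ≃ₗᵢ[ℝ] E, T.unitSphere x = y := by
  refine ⟨(ℝ ∙ ((x : E) - y))ᗮ.reflection, Subtype.ext ?_⟩
  exact Submodule.reflection_sub (by simp)

open scoped Pointwise in
lemma toSphere_preimage_unitSphere (T : E ≃ₗᵢ[ℝ] E) {A : Set (Metric.sphere (0 : E) 1)}
    (hA : MeasurableSet A) :
    (volume : Measure E).toSphere (T.unitSphere ⁻¹' A) = (volume : Measure E).toSphere A := by
  have h1 : Ioo (0 : ℝ) 1 • ((↑) '' (T.unitSphere ⁻¹' A) : Set E) =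
      T ⁻¹' (Ioo (0 : ℝ) 1 • ((↑) '' A : Set E)) := by
    ext x
    constructor
    · rintro ⟨r, hr, _, ⟨w, hw, rfl⟩, rfl⟩
      exact ⟨r, hr, T w, ⟨T.unitSphere w, hw, rfl⟩, (map_smul T r (w : E)).symm⟩
    · rintro ⟨r, hr, _, ⟨w, hw, rfl⟩, hx⟩
      refine ⟨r, hr, T.unitSphere.symm w, ⟨_, by simpa using hw, rfl⟩, ?_⟩
      apply T.injective
      rw [← hx]
      exact (map_smul T r _).trans (congrArg (r • ·) (T.apply_symm_apply (w : E)))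
  rw [Measure.toSphere_apply' _ hA, Measure.toSphere_apply' _
    (T.unitSphere.continuous.measurable hA), h1]
  exact congrArg _ (T.measurePreserving.measure_preimage_emb
    T.toHomeomorph.measurableEmbedding _)

omit [FiniteDimensional ℝ E] [MeasurableSpace E] [BorelSpace E] in
lemma unitSphere_preimage_ball (T : E ≃ₗᵢ[ℝ] E) (x : Metric.sphere (0 : E) 1) (r : ℝ) :
    T.unitSphere ⁻¹' Metric.ball (T.unitSphere x) r = Metric.ball x r :=
  T.unitSphere.preimage_ball _ _ |>.trans (by simp)

/-- Integration over a sphere with respect to the Hausdorff measure in polar coordinates. -/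
lemma exists_integral_sphere_eq {m : ℕ} (hm : Module.finrank ℝ E = m + 1) :
    ∃ c : ℝ, 0 < c ∧ ∀ s > 0, ∀ f : E → ℝ, ContinuousOn f (Metric.sphere 0 s) →
      ∫ x in Metric.sphere (0 : E) s, f x ∂μH[m] =
        c * s ^ m *
          ∫ w : Metric.sphere (0 : E) 1, f (s • (w : E)) ∂(volume : Measure E).toSphere := by
  have : Nontrivial E := Module.nontrivial_of_finrank_pos (R := ℝ) (by omega)
  have hm0 : (0 : ℝ) ≤ m := Nat.cast_nonneg m
  have hmap : Measure.map ((↑) : Metric.sphere (0 : E) 1 → E) μH[m] =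
      μH[m].restrict (Metric.sphere 0 1) := by
    rw [isometry_subtype_coe.map_hausdorffMeasure (Or.inl hm0), Subtype.range_coe]
  have huniv : (μH[m] : Measure (Metric.sphere (0 : E) 1)) univ =
      μH[m] (Metric.sphere (0 : E) 1) := by
    rw [← isometry_subtype_coe.hausdorffMeasure_image (Or.inl hm0), image_univ, Subtype.range_coe]
  have : IsFiniteMeasure (μH[m] : Measure (Metric.sphere (0 : E) 1)) :=
    ⟨huniv ▸ hausdorffMeasure_sphere_lt_top hm⟩
  have : NeZero (μH[m] : Measure (Metric.sphere (0 : E) 1)) := ⟨fun h => by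
    have := hausdorffMeasure_sphere_pos (E := E) hm
    rw [← huniv, h] at this
    simp at this⟩
  have : NeZero (volume : Measure E).toSphere := ⟨Measure.toSphere_ne_zero _⟩
  obtain ⟨c, hc, hci⟩ := exists_integral_eq_of_ball_measure_eq
    (μH[m] : Measure (Metric.sphere (0 : E) 1)) (volume : Measure E).toSphere (by
      intro x y r
      obtain ⟨T, rfl⟩ := exists_unitSphere_apply_eq x y
      rw [← unitSphere_preimage_ball T, IsometryEquiv.hausdorffMeasure_preimage]) (by
      intro x y r
      obtain ⟨T, rfl⟩ := exists_unitSphere_apply_eq x y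
      rw [← unitSphere_preimage_ball T, toSphere_preimage_unitSphere _ measurableSet_ball])
  refine ⟨c, hc, fun s hs f hf => ?_⟩
  have hcont : Continuous fun w : Metric.sphere (0 : E) 1 => f (s • (w : E)) :=
    hf.comp_continuous (by fun_prop) fun w => by
      simp [norm_smul, abs_of_pos hs]
  rw [mul_comm c, mul_assoc, ← hci _ hcont]
  have hscale : (μH[m] : Measure E) =
      ENNReal.ofReal (s ^ m) • Measure.map (fun x : E => s • x) μH[m] := by
    ext A hA
    open Pointwise in
    have h1 : (fun x : E => s • x) ⁻¹' A = s⁻¹ • A := by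
      rw [Set.preimage_smul₀ hs.ne']
    rw [Measure.smul_apply, Measure.map_apply (measurable_const_smul s) hA, h1,
      Measure.hausdorffMeasure_smul₀ hm0 (inv_ne_zero hs.ne'), smul_eq_mul, ENNReal.smul_def,
      smul_eq_mul, ← mul_assoc]
    convert (one_mul _).symm
    rw [NNReal.rpow_natCast, nnnorm_inv, ENNReal.ofReal, ← ENNReal.coe_mul, ← ENNReal.coe_one]
    congr 1
    ext
    simp [Real.norm_eq_abs, abs_of_pos hs, hs.le, hs.ne']
  have hemb : MeasurableEmbedding fun x : E => s • x :=
    (Homeomorph.smulOfNeZero s hs.ne').measurableEmbedding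
  have hpre : (fun x : E => s • x) ⁻¹' Metric.sphere 0 s = Metric.sphere 0 1 := by
    ext x
    simp [norm_smul, abs_of_pos hs, hs.ne']
  rw [hscale, Measure.restrict_smul, integral_smul_measure, ENNReal.toReal_ofReal (by positivity),
    smul_eq_mul, hemb.setIntegral_map, hpre, ← hmap,
    (MeasurableEmbedding.subtype_coe (Metric.isClosed_sphere).measurableSet).integral_map]

end Sphere

section Radial

variable {E : Type*} [NormedAddCommGroup E] [InnerProductSpace ℝ E] [FiniteDimensional ℝ E]
  [MeasurableSpace E] [BorelSpace E]

/-- The integral of `f` over directions at distance `t` from the origin. -/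
noncomputable def sphereIntegral (f : E → ℝ) (t : ℝ) : ℝ :=
  ∫ w : Metric.sphere (0 : E) 1, f (t • (w : E)) ∂(volume : Measure E).toSphere

lemma continuous_sphereIntegral {f : E → ℝ} (hf : Continuous f) :
    Continuous (sphereIntegral f) := by
  have := continuous_parametric_integral_of_continuous
    (μ := (volume : Measure E).toSphere)
    (f := fun (t : ℝ) (w : Metric.sphere (0 : E) 1) => f (t • (w : E))) (by fun_prop)
    (isCompact_univ)
  rw [Measure.restrict_univ] at this
  exact this

lemma integrable_and_integral_eq_sphereIntegral {m : ℕ} (hm : Module.finrank ℝ E = m + 1)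
    {f : E → ℝ} (hf : Integrable f) :
    IntegrableOn (fun t => t ^ m * sphereIntegral f t) (Ioi 0) ∧
      ∫ x, f x = ∫ t in Ioi (0 : ℝ), t ^ m * sphereIntegral f t := by
  have hnt : Nontrivial E := Module.nontrivial_of_finrank_pos (R := ℝ) (by omega)
  have mp := (volume : Measure E).measurePreserving_homeomorphUnitSphereProd
  rw [hm, Nat.add_sub_cancel] at mp
  have hemb := (homeomorphUnitSphereProd E).measurableEmbedding
  have hms : MeasurableSet ({0}ᶜ : Set E) := (measurableSet_singleton _).compl
  have hcomp : ∀ x : ({0}ᶜ : Set E), f (((homeomorphUnitSphereProd E x).2 : ℝ) •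
      ((homeomorphUnitSphereProd E x).1 : E)) = f x := by
    intro x
    have hx : ‖(x : E)‖ ≠ 0 := norm_ne_zero_iff.2 x.2
    simp [smul_smul, hx]
  have h1 : Integrable (fun x : ({0}ᶜ : Set E) => f x) ((volume : Measure E).comap (↑)) := by
    exact (integrableOn_iff_comap_subtypeVal hms).1 hf.integrableOn
  have h2 : Integrable (fun z : Metric.sphere (0 : E) 1 × Ioi (0 : ℝ) => f ((z.2 : ℝ) • (z.1 : E)))
      ((volume : Measure E).toSphere.prod (Measure.volumeIoiPow m)) := by
    rw [← mp.integrable_comp_emb hemb]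
    exact h1.congr (Filter.Eventually.of_forall fun x => (hcomp x).symm)
  have h3 : ∫ x, f x = ∫ r : Ioi (0 : ℝ), sphereIntegral f r ∂(Measure.volumeIoiPow m) := by
    calc ∫ x, f x = ∫ x : ({0}ᶜ : Set E), f x ∂((volume : Measure E).comap (↑)) := by
          rw [integral_subtype_comap hms, restrict_compl_singleton]
      _ = ∫ z : Metric.sphere (0 : E) 1 × Ioi (0 : ℝ), f ((z.2 : ℝ) • (z.1 : E))
          ∂((volume : Measure E).toSphere.prod (Measure.volumeIoiPow m)) := by
          rw [← mp.integral_comp hemb]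
          simp only [hcomp]
      _ = _ := integral_prod_symm _ h2
  have h4 : Integrable (fun r : Ioi (0 : ℝ) => sphereIntegral f r) (Measure.volumeIoiPow m) :=
    h2.integral_prod_right
  have hmeas : Measurable fun r : Ioi (0 : ℝ) => ENNReal.ofReal (r.1 ^ m) :=
    (measurable_subtype_coe.pow_const _).ennreal_ofReal
  rw [Measure.volumeIoiPow] at h3 h4
  rw [integrable_withDensity_iff_integrable_smul' hmeas (by simp)] at h4
  rw [integral_withDensity_eq_integral_toReal_smul hmeas (by simp)] at h3
  have e1 : ∀ r : Ioi (0 : ℝ), (ENNReal.ofReal (r.1 ^ m)).toReal • sphereIntegral f r =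
      r.1 ^ m * sphereIntegral f r.1 := fun r => by
    rw [ENNReal.toReal_ofReal (pow_nonneg (le_of_lt r.2) _), smul_eq_mul]
  simp only [e1] at h3 h4
  rw [integral_subtype_comap measurableSet_Ioi (fun r => r ^ m * sphereIntegral f r)] at h3
  exact ⟨(integrableOn_iff_comap_subtypeVal measurableSet_Ioi).2 h4, h3⟩

lemma sphereIntegral_radial_mul (g : ℝ → ℝ) (f : E → ℝ) {t : ℝ} (ht : 0 ≤ t) :
    sphereIntegral (fun x => g ‖x‖ * f x) t = g t * sphereIntegral f t := by
  simp only [sphereIntegral]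
  rw [← integral_const_mul]
  refine integral_congr_ae (Filter.Eventually.of_forall fun w => ?_)
  simp [norm_smul, abs_of_nonneg ht]

lemma intervalIntegrable_sphereIntegral {m : ℕ} (hm : Module.finrank ℝ E = m + 1) {M : E → ℝ}
    (hM : Integrable M) {s : ℝ} (hs : 0 ≤ s) :
    IntervalIntegrable (fun t => t ^ m * sphereIntegral M t) volume 0 s := by
  rw [intervalIntegrable_iff_integrableOn_Ioc_of_le hs]
  exact (integrable_and_integral_eq_sphereIntegral hm hM).1.mono_set Ioc_subset_Ioi_self

/-- Passing from a family of identities tested against radial functions to an identity between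
spherical integrals. -/
lemma sphereIntegral_eq_of_radial_test {m : ℕ} (hm : Module.finrank ℝ E = m + 1) {R : ℝ}
    {B M : E → ℝ} (hB : Continuous B) (hM : Integrable M)
    (test : ∀ ψ : ℝ → ℝ, ContDiff ℝ ∞ ψ → HasCompactSupport ψ → tsupport ψ ⊆ Ioo 0 R →
      ∫ x, (∫ r in ‖x‖..R, ψ r) * M x = ∫ x, ψ ‖x‖ / ‖x‖ * B x) {s : ℝ} (hs : s ∈ Ioo 0 R) :
    s ^ m * (sphereIntegral B s / s) = ∫ t in 0..s, t ^ m * sphereIntegral M t := by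
  have hR : 0 < R := hs.1.trans hs.2
  have hMi : IntervalIntegrable (fun t => t ^ m * sphereIntegral M t) volume 0 R :=
    intervalIntegrable_sphereIntegral hm hM hR.le
  have hG : AbsolutelyContinuousOnInterval
      (fun s => ∫ t in 0..s, t ^ m * sphereIntegral M t) 0 R :=
    hMi.absolutelyContinuousOnInterval_intervalIntegral (by simp)
  have hGc := hG.continuousOn
  rw [uIcc_of_le hR.le] at hGc
  have hcB := continuous_sphereIntegral hB
  have hLc : ContinuousOn (fun s => s ^ m * (sphereIntegral B s / s)) (Ioo 0 R) :=
    (continuous_pow m).continuousOn.mul (hcB.continuousOn.div continuousOn_id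
      fun t ht => ht.1.ne')
  have hcont : ContinuousOn (fun s => s ^ m * (sphereIntegral B s / s) -
      ∫ t in 0..s, t ^ m * sphereIntegral M t) (Ioo 0 R) :=
    hLc.sub (hGc.mono Ioo_subset_Icc_self)
  suffices h : EqOn (fun s => s ^ m * (sphereIntegral B s / s) -
      ∫ t in 0..s, t ^ m * sphereIntegral M t) (fun _ => 0) (Ioo 0 R) from
    sub_eq_zero.1 (h hs)
  refine Measure.eqOn_open_of_ae_eq (μ := volume) ?_ isOpen_Ioo hcont continuousOn_const
  refine (ae_restrict_iff' measurableSet_Ioo).2 ?_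
  refine isOpen_Ioo.ae_eq_zero_of_integral_contDiff_smul_eq_zero
    (hcont.locallyIntegrableOn measurableSet_Ioo) fun ψ hψ hψc hψs => ?_
  have hψ0 : ∀ t, t ∉ Ioo 0 R → ψ t = 0 := fun t ht =>
    image_eq_zero_of_notMem_tsupport fun h => ht (hψs h)
  have hψcont : Continuous ψ := hψ.continuous
  have hη : ∀ t, HasDerivAt (fun t => ∫ r in t..R, ψ r) (-ψ t) t := fun t =>
    intervalIntegral.integral_hasDerivAt_left (hψcont.intervalIntegrable _ _)
      hψcont.stronglyMeasurable.stronglyMeasurableAtFilter hψcont.continuousAt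
  have hηR : ∀ t, R ≤ t → ∫ r in t..R, ψ r = 0 := fun t ht => by
    rw [intervalIntegral.integral_congr (g := fun _ => 0), intervalIntegral.integral_zero]
    intro r hr
    rw [uIcc_of_ge ht] at hr
    exact hψ0 r fun h => absurd h.2 (not_lt.2 hr.1)
  have hηc : Continuous (fun t => ∫ r in t..R, ψ r) :=
    continuous_iff_continuousAt.2 fun t => (hη t).continuousAt
  have hη1 : ContDiff ℝ 1 (fun t => ∫ r in t..R, ψ r) := by
    rw [contDiff_one_iff_deriv]
    refine ⟨fun t => (hη t).differentiableAt, ?_⟩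
    rw [funext fun t => (hη t).deriv]
    exact hψcont.neg
  obtain ⟨K, hK⟩ : ∃ K, ∀ t ∈ Icc 0 R, ‖∫ r in t..R, ψ r‖ ≤ K :=
    isCompact_Icc.exists_bound_of_continuousOn hηc.continuousOn
  have hK' : ∀ t, 0 ≤ t → ‖∫ r in t..R, ψ r‖ ≤ K := by
    intro t ht
    rcases le_total t R with h | h
    · exact hK t ⟨ht, h⟩
    · rw [hηR t h, norm_zero]
      exact (norm_nonneg _).trans (hK 0 ⟨le_rfl, hR.le⟩)
  have i1 : Integrable fun x : E => (∫ r in ‖x‖..R, ψ r) * M x :=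
    hM.bdd_mul (hηc.comp continuous_norm).aestronglyMeasurable
      (Filter.Eventually.of_forall fun x => hK' _ (norm_nonneg x))
  have i2 : Integrable fun x : E => ψ ‖x‖ / ‖x‖ * B x := by
    have hc : Continuous fun t : ℝ => ψ t / t := by
      rw [continuous_iff_continuousAt]
      intro t
      rcases eq_or_ne t 0 with rfl | h
      · have h0 : (fun t => ψ t / t) =ᶠ[nhds 0] fun _ => 0 := by
          have : (tsupport ψ)ᶜ ∈ nhds (0 : ℝ) :=
            (isClosed_tsupport ψ).isOpen_compl.mem_nhds fun h => absurd (hψs h).1 (lt_irrefl _)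
          filter_upwards [this] with t ht
          rw [image_eq_zero_of_notMem_tsupport ht, zero_div]
        exact continuousAt_const.congr h0.symm
      · exact hψcont.continuousAt.div continuousAt_id h
    refine Continuous.integrable_of_hasCompactSupport
      ((hc.comp continuous_norm).mul hB) ?_
    refine HasCompactSupport.of_support_subset_isCompact (isCompact_closedBall (0 : E) R) ?_
    intro x hx
    by_contra h
    rw [mem_closedBall_zero_iff, not_le] at h
    exact hx (by simp [hψ0 ‖x‖ fun h' => absurd h'.2 h.le.not_gt])
  have hmain := test ψ hψ hψc hψs
  rw [(integrable_and_integral_eq_sphereIntegral hm i1).2,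
    (integrable_and_integral_eq_sphereIntegral hm i2).2] at hmain
  have e1 : ∫ t in Ioi (0 : ℝ), t ^ m * sphereIntegral (fun x => (∫ r in ‖x‖..R, ψ r) * M x) t =
      ∫ t in 0..R, (∫ r in t..R, ψ r) * (t ^ m * sphereIntegral M t) := by
    rw [intervalIntegral.integral_of_le hR.le,
      setIntegral_eq_of_subset_of_forall_sdiff_eq_zero measurableSet_Ioi
        (show Ioc 0 R ⊆ Ioi 0 from Ioc_subset_Ioi_self)]
    · refine setIntegral_congr_fun measurableSet_Ioc fun t ht => ?_
      rw [sphereIntegral_radial_mul (fun t => ∫ r in t..R, ψ r) M ht.1.le]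
      ring
    · rintro t ⟨ht, ht'⟩
      have : R ≤ t := by
        by_contra! h
        exact ht' ⟨ht, h.le⟩
      rw [sphereIntegral_radial_mul (fun t => ∫ r in t..R, ψ r) M (le_of_lt ht), hηR t this,
        zero_mul, mul_zero]
  have e2 : ∫ t in Ioi (0 : ℝ), t ^ m * sphereIntegral (fun x => ψ ‖x‖ / ‖x‖ * B x) t =
      ∫ t in 0..R, ψ t * (t ^ m * (sphereIntegral B t / t)) := by
    rw [intervalIntegral.integral_of_le hR.le,
      setIntegral_eq_of_subset_of_forall_sdiff_eq_zero measurableSet_Ioi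
        (show Ioc 0 R ⊆ Ioi 0 from Ioc_subset_Ioi_self)]
    · refine setIntegral_congr_fun measurableSet_Ioc fun t ht => ?_
      rw [sphereIntegral_radial_mul (fun t => ψ t / t) B ht.1.le]
      ring
    · rintro t ⟨ht, ht'⟩
      rw [sphereIntegral_radial_mul (fun t => ψ t / t) B (le_of_lt ht),
        hψ0 t fun h => ht' ⟨ht, h.2.le⟩, zero_div, zero_mul, mul_zero]
  rw [e1, e2] at hmain
  have hparts := hG.integral_deriv_mul_eq_sub (g := fun t => ∫ r in t..R, ψ r)
    hη1.contDiffOn.absolutelyContinuousOnInterval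
  simp only [intervalIntegral.integral_same, mul_zero, zero_mul, sub_zero] at hparts
  have e3 : ∫ t in 0..R, deriv (fun s => ∫ t in 0..s, t ^ m * sphereIntegral M t) t *
      (∫ r in t..R, ψ r) + (∫ r in 0..t, r ^ m * sphereIntegral M r) *
        deriv (fun t => ∫ r in t..R, ψ r) t =
      ∫ t in 0..R, ((∫ r in t..R, ψ r) * (t ^ m * sphereIntegral M t) -
        ψ t * ∫ r in 0..t, r ^ m * sphereIntegral M r) := by
    refine intervalIntegral.integral_congr_ae ?_
    filter_upwards [hMi.ae_hasDerivAt_integral] with t ht ht'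
    rw [(ht (uIoc_subset_uIcc ht') 0 (by simp)).deriv, (hη t).deriv]
    ring
  have hGint : IntervalIntegrable (fun t => ψ t * ∫ r in 0..t, r ^ m * sphereIntegral M r)
      volume 0 R := by
    refine ContinuousOn.intervalIntegrable ?_
    rw [uIcc_of_le hR.le]
    exact hψcont.continuousOn.mul hGc
  rw [e3, intervalIntegral.integral_sub (hMi.continuousOn_mul hηc.continuousOn) hGint,
    sub_eq_zero] at hparts
  have hLint : IntervalIntegrable (fun t => ψ t * (t ^ m * (sphereIntegral B t / t)))
      volume 0 R := by
    rw [intervalIntegrable_iff_integrableOn_Ioc_of_le hR.le]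
    refine ((integrable_and_integral_eq_sphereIntegral hm i2).1.mono_set
      Ioc_subset_Ioi_self).congr_fun (fun t ht => ?_) measurableSet_Ioc
    simp only
    rw [sphereIntegral_radial_mul (fun t => ψ t / t) B ht.1.le]
    ring
  rw [hparts] at hmain
  have hfin : ∫ t in 0..R, ψ t • (t ^ m * (sphereIntegral B t / t) -
      ∫ r in 0..t, r ^ m * sphereIntegral M r) = 0 := by
    simp only [smul_eq_mul, mul_sub]
    rw [intervalIntegral.integral_sub hLint hGint, hmain, sub_self]
  rw [intervalIntegral.integral_of_le hR.le] at hfin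
  refine (setIntegral_eq_integral_of_forall_compl_eq_zero fun t ht => ?_).symm.trans hfin
  rw [hψ0 t fun h => ht ⟨h.1, h.2.le⟩, zero_smul]

end Radial

section Gradient

variable {E : Type*} [NormedAddCommGroup E] [InnerProductSpace ℝ E] [FiniteDimensional ℝ E]

lemma ContDiff.continuous_gradient {u : E → ℝ} (hu : ContDiff ℝ 1 u) :
    Continuous (gradient u) :=
  (InnerProductSpace.toDual ℝ E).symm.continuous.comp (hu.continuous_fderiv one_ne_zero)

lemma fderiv_apply_gradient (u ψ : E → ℝ) (x : E) :
    fderiv ℝ ψ x (gradient u x) = inner ℝ (gradient ψ x) (gradient u x) :=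
  inner_gradient_left.symm

lemma HasCompactSupport.gradient {u : E → ℝ} (hu : HasCompactSupport u) :
    HasCompactSupport (gradient u) :=
  (hu.fderiv (𝕜 := ℝ)).comp_left (g := (InnerProductSpace.toDual ℝ E).symm) (map_zero _)

end Gradient

section Weak

variable {E : Type*} [NormedAddCommGroup E] [InnerProductSpace ℝ E] [FiniteDimensional ℝ E]
  [MeasurableSpace E] [BorelSpace E]

lemma hasDerivAt_integral_translate_sub_mul {w k : E → ℝ} (hw : ContDiff ℝ 1 w)
    (hwc : HasCompactSupport w) (hk : Integrable k) (v : E) :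
    HasDerivAt (fun t : ℝ => ∫ x, (w (x + t • v) - w x) * k x) (∫ x, fderiv ℝ w x v * k x) 0 := by
  obtain ⟨K, hK⟩ := hw.lipschitzWith_of_hasCompactSupport hwc one_ne_zero
  have hwcont := hw.continuous
  have hlip : ∀ (x : E) (s t : ℝ), |w (x + s • v) - w (x + t • v)| ≤ K * (|s - t| * ‖v‖) := by
    intro x s t
    have := hK.norm_sub_le (x + s • v) (x + t • v)
    rwa [add_sub_add_left_eq_sub, ← sub_smul, norm_smul] at this
  refine (hasDerivAt_integral_of_dominated_loc_of_lip
    (F := fun t x => (w (x + t • v) - w x) * k x) (bound := fun x => K * ‖v‖ * |k x|)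
    (s := univ) Filter.univ_mem ?_ ?_ ?_ ?_ ?_ ?_).2
  · refine Filter.Eventually.of_forall fun t => AEStronglyMeasurable.mul ?_ hk.1
    exact (show Continuous fun x => w (x + t • v) - w x by fun_prop).aestronglyMeasurable
  · simp
  · have h := (hw.continuous_fderiv one_ne_zero).clm_apply (continuous_const (y := v))
    exact h.aestronglyMeasurable.mul hk.1
  · refine Filter.Eventually.of_forall fun x => ?_
    rw [lipschitzOnWith_univ]
    refine LipschitzWith.of_dist_le_mul fun s t => ?_
    rw [Real.dist_eq, Real.dist_eq, ← sub_mul, sub_sub_sub_cancel_right, abs_mul,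
      Real.coe_nnabs, abs_of_nonneg (a := K * ‖v‖ * |k x|) (by positivity)]
    calc |w (x + s • v) - w (x + t • v)| * |k x| ≤ K * (|s - t| * ‖v‖) * |k x| := by
          gcongr
          exact hlip x s t
      _ = _ := by ring
  · exact hk.abs.const_mul _
  · refine Filter.Eventually.of_forall fun x => ?_
    have h1 : HasDerivAt (fun t : ℝ => x + t • v) v 0 := by
      simpa using ((hasDerivAt_id (0 : ℝ)).smul_const v).const_add x
    have h2 : HasFDerivAt w (fderiv ℝ w x) (x + (0 : ℝ) • v) := by
      rw [zero_smul, add_zero]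
      exact (hw.differentiable one_ne_zero x).hasFDerivAt
    exact ((h2.comp_hasDerivAt 0 h1).sub_const _).mul_const _

/-- `Δu = F` holds weakly on the ball of radius `R`. -/
def IsWeakSolution (R : ℝ) (u F : E → ℝ) : Prop :=
  ∀ ψ : E → ℝ, ContDiff ℝ 1 ψ → HasCompactSupport ψ → tsupport ψ ⊆ Metric.ball 0 R →
    ∫ x, fderiv ℝ ψ x (gradient u x) = -∫ x, ψ x * F x

namespace IsWeakSolution

variable {R : ℝ} {u F : E → ℝ}

lemma integral_mul_energy (H : IsWeakSolution R u F) (hu : ContDiff ℝ 1 u)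
    (hF : Integrable F) {ψ : E → ℝ} (hψ : ContDiff ℝ 1 ψ)
    (hψc : HasCompactSupport ψ) (hψs : tsupport ψ ⊆ Metric.ball 0 R) :
    ∫ x, ψ x * (‖gradient u x‖ ^ 2 + F x * u x) = -∫ x, u x * fderiv ℝ ψ x (gradient u x) := by
  have hc1 := hu.continuous_gradient
  have hc2 := hψ.continuous_fderiv one_ne_zero
  have hc3 := hu.continuous
  have hc4 := hψ.continuous
  have h := H (fun x => ψ x * u x) (hψ.mul hu) hψc.mul_right
    ((tsupport_mul_subset_left).trans hψs)
  have i1 : Integrable fun x => ψ x * ‖gradient u x‖ ^ 2 :=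
    Continuous.integrable_of_hasCompactSupport (by fun_prop) hψc.mul_right
  have i2 : Integrable fun x => u x * fderiv ℝ ψ x (gradient u x) := by
    refine Continuous.integrable_of_hasCompactSupport (by fun_prop) ?_
    refine HasCompactSupport.mul_left ?_
    refine (hψc.fderiv (𝕜 := ℝ)).mono' ?_
    refine subset_trans (fun x hx => ?_) subset_closure
    intro h0
    exact hx (by simp [h0])
  have i3 : Integrable fun x => ψ x * u x * F x := by
    obtain ⟨K, hK⟩ := (hψc.mul_right (f' := u)).exists_bound_of_continuous (by fun_prop)
    exact hF.bdd_mul (by fun_prop) (Filter.Eventually.of_forall hK)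
  have e : ∀ x, fderiv ℝ (fun x => ψ x * u x) x (gradient u x) =
      ψ x * ‖gradient u x‖ ^ 2 + u x * fderiv ℝ ψ x (gradient u x) := by
    intro x
    rw [fderiv_fun_mul (hψ.differentiable one_ne_zero x) (hu.differentiable one_ne_zero x)]
    simp only [add_apply, smul_apply, smul_eq_mul]
    rw [fderiv_apply_gradient u u, real_inner_self_eq_norm_sq]
  simp only [e] at h
  rw [integral_add i1 i2] at h
  have e2 : ∀ x, ψ x * (‖gradient u x‖ ^ 2 + F x * u x) =
    ψ x * ‖gradient u x‖ ^ 2 + ψ x * u x * F x := fun x => by ring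
  simp only [e2]
  rw [integral_add i1 i3]
  linarith

/-- Domain variation in the direction `v`, for nonnegative cut-off functions. -/
lemma integral_mul_deriv_of_nonneg (H : IsWeakSolution R u F) (hu : ContDiff ℝ 1 u)
    (huc : HasCompactSupport u)
    (hF : Integrable F) {ψ : E → ℝ} (hψ : ContDiff ℝ 1 ψ)
    (hψc : HasCompactSupport ψ) (hψs : tsupport ψ ⊆ Metric.ball 0 R) (hψ0 : ∀ x, 0 ≤ ψ x)
    (v : E) :
    ∫ x, fderiv ℝ u x v * (ψ x * F x) =
      1 / 2 * (∫ x, fderiv ℝ ψ x v * ‖gradient u x‖ ^ 2) -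
        ∫ x, fderiv ℝ u x v * fderiv ℝ ψ x (gradient u x) := by
  have hc1 := hu.continuous_gradient
  have hc2 := hψ.continuous_fderiv one_ne_zero
  have hc3 := hu.continuous
  have hc4 := hψ.continuous
  have igrad : Integrable fun x => ‖gradient u x‖ ^ 2 :=
    Continuous.integrable_of_hasCompactSupport (by fun_prop)
      (huc.gradient.norm.comp_left (g := fun t : ℝ => t ^ 2) (by simp))
  have ipg : Integrable fun x => fderiv ℝ ψ x (gradient u x) := by
    refine Continuous.integrable_of_hasCompactSupport (by fun_prop) ?_
    refine huc.gradient.mono fun x hx h0 => hx ?_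
    simp [h0]
  have ipF : Integrable fun x => ψ x * F x := by
    obtain ⟨K, hK⟩ := hψc.exists_bound_of_continuous hc4
    exact hF.bdd_mul (by fun_prop) (Filter.Eventually.of_forall hK)
  have d1 := hasDerivAt_integral_translate_sub_mul hψ hψc igrad (-v)
  have d2 := hasDerivAt_integral_translate_sub_mul hu huc ipg v
  have d3 := hasDerivAt_integral_translate_sub_mul hu huc ipF v
  have key : ∀ t : ℝ, 1 / 2 * (∫ x, (ψ (x + t • -v) - ψ x) * ‖gradient u x‖ ^ 2) +
      (∫ x, (u (x + t • v) - u x) * fderiv ℝ ψ x (gradient u x)) +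
      (∫ x, (u (x + t • v) - u x) * (ψ x * F x)) =
      1 / 2 * ∫ x, ψ x * ‖gradient u (x + t • v) - gradient u x‖ ^ 2 := by
    intro t
    have hut : ContDiff ℝ 1 fun x => u (x + t • v) := hu.comp (contDiff_id.add contDiff_const)
    have h := H (fun x => ψ x * (u (x + t • v) - u x)) (hψ.mul (hut.sub hu)) hψc.mul_right
      ((tsupport_mul_subset_left).trans hψs)
    have e : ∀ x, fderiv ℝ (fun x => ψ x * (u (x + t • v) - u x)) x (gradient u x) =
        ψ x * inner ℝ (gradient u (x + t • v) - gradient u x) (gradient u x) +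
        (u (x + t • v) - u x) * fderiv ℝ ψ x (gradient u x) := by
      intro x
      rw [fderiv_fun_mul (hψ.differentiable one_ne_zero x)
        ((hut.sub hu).differentiable one_ne_zero x),
        fderiv_fun_sub (hut.differentiable one_ne_zero x) (hu.differentiable one_ne_zero x),
        fderiv_comp_add_right]
      simp only [add_apply, smul_apply, smul_eq_mul, sub_apply]
      rw [inner_sub_left, inner_gradient_left, inner_gradient_left]
    simp only [e] at h
    have j1 : Integrable fun x =>
        ψ x * inner ℝ (gradient u (x + t • v) - gradient u x) (gradient u x) :=
      Continuous.integrable_of_hasCompactSupport (by fun_prop) hψc.mul_right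
    have j2 : Integrable fun x => (u (x + t • v) - u x) * fderiv ℝ ψ x (gradient u x) := by
      refine Continuous.integrable_of_hasCompactSupport (by fun_prop) ?_
      refine huc.gradient.mono fun x hx h0 => hx ?_
      simp [h0]
    rw [integral_add j1 j2] at h
    have e3 : ∫ x, (u (x + t • v) - u x) * (ψ x * F x) =
        ∫ x, ψ x * (u (x + t • v) - u x) * F x := by
      refine integral_congr_ae (Filter.Eventually.of_forall fun x => ?_)
      simp only
      ring
    have j3 : Integrable fun x => ψ x * ‖gradient u (x + t • v)‖ ^ 2 :=
      Continuous.integrable_of_hasCompactSupport (by fun_prop) hψc.mul_right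
    have j4 : Integrable fun x => ψ x * ‖gradient u x‖ ^ 2 :=
      Continuous.integrable_of_hasCompactSupport (by fun_prop) hψc.mul_right
    have j5 : Integrable fun x => ψ (x + t • -v) * ‖gradient u x‖ ^ 2 := by
      refine Continuous.integrable_of_hasCompactSupport (by fun_prop) ?_
      exact HasCompactSupport.mul_left
        (huc.gradient.norm.comp_left (g := fun t : ℝ => t ^ 2) (by simp))
    have e1 : ∫ x, (ψ (x + t • -v) - ψ x) * ‖gradient u x‖ ^ 2 =
        (∫ x, ψ x * ‖gradient u (x + t • v)‖ ^ 2) - ∫ x, ψ x * ‖gradient u x‖ ^ 2 := by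
      simp only [sub_mul]
      rw [integral_sub j5 j4, ← integral_add_right_eq_self _ (t • v)]
      simp
    have j6 : Integrable fun x => ψ x * ‖gradient u (x + t • v)‖ ^ 2 - ψ x * ‖gradient u x‖ ^ 2 :=
      j3.sub j4
    have e4 : ∫ x, ψ x * ‖gradient u (x + t • v) - gradient u x‖ ^ 2 =
        (∫ x, ψ x * ‖gradient u (x + t • v)‖ ^ 2) - (∫ x, ψ x * ‖gradient u x‖ ^ 2) -
        2 * ∫ x, ψ x * inner ℝ (gradient u (x + t • v) - gradient u x) (gradient u x) := by
      rw [← integral_const_mul, ← integral_sub j3 j4, ← integral_sub j6 (j1.const_mul 2)]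
      refine integral_congr_ae (Filter.Eventually.of_forall fun x => ?_)
      simp only
      rw [norm_sub_sq_real, inner_sub_left, real_inner_self_eq_norm_sq]
      ring
    rw [e1, e3, e4]
    linarith
  have hd := ((d1.const_mul (1 / 2)).add d2).add d3
  have hmin : IsLocalMin (fun t : ℝ => 1 / 2 * (∫ x, (ψ (x + t • -v) - ψ x) * ‖gradient u x‖ ^ 2) +
      (∫ x, (u (x + t • v) - u x) * fderiv ℝ ψ x (gradient u x)) +
      (∫ x, (u (x + t • v) - u x) * (ψ x * F x))) 0 := by
    refine Filter.Eventually.of_forall fun t => ?_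
    simp only [key]
    simp only [zero_smul, add_zero, sub_self, norm_zero]
    simp only [ne_eq, OfNat.ofNat_ne_zero, not_false_eq_true, zero_pow, mul_zero, integral_zero]
    exact mul_nonneg (by norm_num) (integral_nonneg fun x => mul_nonneg (hψ0 x) (sq_nonneg _))
  have h0 := hmin.hasDerivAt_eq_zero hd
  simp only [map_neg, neg_mul, integral_neg] at h0
  linarith

end IsWeakSolution

lemma OrthonormalBasis.sum_inner_mul_apply {E : Type*} [NormedAddCommGroup E]
    [InnerProductSpace ℝ E] {ι : Type*} [Fintype ι]
    (b : OrthonormalBasis ι ℝ E) (L : E →L[ℝ] ℝ) (x : E) :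
    ∑ k, inner ℝ (b k) x * L (b k) = L x := by
  conv_rhs => rw [← b.sum_repr' x, map_sum]
  simp

namespace IsWeakSolution

variable {R : ℝ} {u F : E → ℝ}

/-- Domain variation in the direction `v`. -/
lemma integral_mul_deriv (H : IsWeakSolution R u F) (hR : 0 < R) (hu : ContDiff ℝ 1 u)
    (huc : HasCompactSupport u) (hF : Integrable F) {ψ : E → ℝ} (hψ : ContDiff ℝ 1 ψ)
    (hψc : HasCompactSupport ψ) (hψs : tsupport ψ ⊆ Metric.ball 0 R) (v : E) :
    ∫ x, fderiv ℝ u x v * (ψ x * F x) =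
      1 / 2 * (∫ x, fderiv ℝ ψ x v * ‖gradient u x‖ ^ 2) -
        ∫ x, fderiv ℝ u x v * fderiv ℝ ψ x (gradient u x) := by
  obtain ⟨r, hr, hrs⟩ := exists_pos_lt_subset_ball hR (isClosed_tsupport ψ) hψs
  obtain ⟨r', hr', hr''⟩ := exists_between hr.2
  let χ : ContDiffBump (0 : E) := ⟨r, r', hr.1, hr'⟩
  obtain ⟨K, hK⟩ := hψc.exists_bound_of_continuous hψ.continuous
  have hχ : ContDiff ℝ 1 (fun x => K * χ x) := contDiff_const.mul χ.contDiff
  have hχc : HasCompactSupport (fun x => K * χ x) := χ.hasCompactSupport.mul_left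
  have hχs : tsupport (fun x => K * χ x) ⊆ Metric.ball 0 R := by
    refine tsupport_mul_subset_right.trans ?_
    rw [χ.tsupport_eq]
    exact Metric.closedBall_subset_ball hr''
  have hK0 : 0 ≤ K := (norm_nonneg _).trans (hK 0)
  have hsum : ∀ x, 0 ≤ ψ x + K * χ x := by
    intro x
    by_cases hx : x ∈ tsupport ψ
    · rw [χ.one_of_mem_closedBall (Metric.ball_subset_closedBall (hrs hx)), mul_one]
      linarith [neg_le_of_abs_le (hK x)]
    · rw [image_eq_zero_of_notMem_tsupport hx, zero_add]
      exact mul_nonneg hK0 χ.nonneg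
  have h1 := H.integral_mul_deriv_of_nonneg hu huc hF hχ hχc hχs
    (fun x => mul_nonneg hK0 χ.nonneg) v
  have h2 := H.integral_mul_deriv_of_nonneg hu huc hF (hψ.add hχ) (hψc.add hχc)
    ((tsupport_add _ _).trans (union_subset hψs hχs)) hsum v
  have hc1 := hu.continuous_gradient
  have hc0 := hu.continuous_fderiv one_ne_zero
  have i1 : ∀ ψ : E → ℝ, ContDiff ℝ 1 ψ → HasCompactSupport ψ →
      Integrable fun x => fderiv ℝ u x v * (ψ x * F x) := by
    intro ψ hψ hψc
    have hc4 := hψ.continuous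
    obtain ⟨K, hK⟩ := (hψc.mul_left (f := fun x => fderiv ℝ u x v)).exists_bound_of_continuous
      (by fun_prop)
    simp only [← mul_assoc]
    exact hF.bdd_mul (by fun_prop) (Filter.Eventually.of_forall hK)
  have i2 : ∀ ψ : E → ℝ, ContDiff ℝ 1 ψ →
      Integrable fun x => fderiv ℝ ψ x v * ‖gradient u x‖ ^ 2 := by
    intro ψ hψ
    have hc4 := hψ.continuous_fderiv one_ne_zero
    refine Continuous.integrable_of_hasCompactSupport (by fun_prop) ?_
    exact HasCompactSupport.mul_left
      (huc.gradient.norm.comp_left (g := fun t : ℝ => t ^ 2) (by simp))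
  have i3 : ∀ ψ : E → ℝ, ContDiff ℝ 1 ψ →
      Integrable fun x => fderiv ℝ u x v * fderiv ℝ ψ x (gradient u x) := by
    intro ψ hψ
    have hc4 := hψ.continuous_fderiv one_ne_zero
    refine Continuous.integrable_of_hasCompactSupport (by fun_prop) ?_
    refine huc.gradient.mono fun x hx h0 => hx ?_
    simp [h0]
  have e : ∀ x, fderiv ℝ (fun x => ψ x + K * χ x) x =
      fderiv ℝ ψ x + fderiv ℝ (fun x => K * χ x) x :=
    fun x => fderiv_fun_add (hψ.differentiable one_ne_zero x) (hχ.differentiable one_ne_zero x)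
  simp only [e, add_apply, add_mul, mul_add] at h2
  rw [integral_add (i1 _ hψ hψc) (i1 _ hχ hχc), integral_add (i2 _ hψ) (i2 _ hχ),
    integral_add (i3 _ hψ) (i3 _ hχ)] at h2
  linarith

/-- The Pohozaev identity tested against a cut-off function. -/
lemma integral_pohozaev (H : IsWeakSolution R u F) (hR : 0 < R) (hu : ContDiff ℝ 1 u)
    (huc : HasCompactSupport u) (hF : Integrable F) {η : E → ℝ} (hη : ContDiff ℝ 1 η)
    (hηc : HasCompactSupport η) (hηs : tsupport η ⊆ Metric.ball 0 R) :
    ∫ x, fderiv ℝ u x x * (η x * F x) =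
      1 / 2 * (∫ x, (Module.finrank ℝ E * η x + fderiv ℝ η x x) * ‖gradient u x‖ ^ 2) -
        ∫ x, (η x * ‖gradient u x‖ ^ 2 + fderiv ℝ u x x * fderiv ℝ η x (gradient u x)) := by
  let b := stdOrthonormalBasis ℝ E
  have hψ : ∀ k, ContDiff ℝ 1 fun x => inner ℝ (b k) x * η x := fun k =>
    (contDiff_const.inner ℝ contDiff_id).mul hη
  have hc1 := hu.continuous_gradient
  have hc0 := hu.continuous_fderiv one_ne_zero
  have hcη := hη.continuous
  have hcη' := hη.continuous_fderiv one_ne_zero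
  have e : ∀ k x v, fderiv ℝ (fun x => inner ℝ (b k) x * η x) x v =
      inner ℝ (b k) v * η x + inner ℝ (b k) x * fderiv ℝ η x v := by
    intro k x v
    have h : HasFDerivAt (fun x => inner ℝ (b k) x) (innerSL ℝ (b k)) x :=
      (innerSL ℝ (b k)).hasFDerivAt
    rw [(h.fun_mul (hη.differentiable one_ne_zero x).hasFDerivAt).fderiv]
    simp [mul_comm, add_comm]
  have h := fun k => H.integral_mul_deriv hR hu huc hF (hψ k) hηc.mul_left
    (tsupport_mul_subset_right.trans hηs) (b k)
  have hs := Finset.sum_congr (rfl : (Finset.univ : Finset (Fin (Module.finrank ℝ E))) = _)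
    fun k _ => h k
  simp only [e] at hs
  rw [Finset.sum_sub_distrib, ← Finset.mul_sum, ← integral_finsetSum, ← integral_finsetSum,
    ← integral_finsetSum] at hs
  · convert hs using 1
    · refine integral_congr_ae (Filter.Eventually.of_forall fun x => ?_)
      simp only
      rw [← b.sum_inner_mul_apply (fderiv ℝ u x) x, Finset.sum_mul]
      exact Finset.sum_congr rfl fun k _ => by ring
    · congr 1
      · congr 1
        refine integral_congr_ae (Filter.Eventually.of_forall fun x => ?_)
        simp only
        rw [← Finset.sum_mul, Finset.sum_add_distrib, b.sum_inner_mul_apply]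
        simp
      · refine integral_congr_ae (Filter.Eventually.of_forall fun x => ?_)
        simp only
        rw [← real_inner_self_eq_norm_sq, inner_gradient_left,
          ← b.sum_inner_mul_apply (fderiv ℝ u x) x,
          ← b.sum_inner_mul_apply (fderiv ℝ u x) (gradient u x), Finset.mul_sum, Finset.sum_mul,
          ← Finset.sum_add_distrib]
        exact Finset.sum_congr rfl fun k _ => by ring
  · intro k _
    refine Continuous.integrable_of_hasCompactSupport (by fun_prop) ?_
    refine huc.gradient.mono fun x hx h0 => hx ?_
    have : fderiv ℝ u x (b k) = 0 := by rw [← inner_gradient_left, h0, inner_zero_left]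
    simp [this]
  · intro k _
    refine Continuous.integrable_of_hasCompactSupport (by fun_prop) ?_
    exact HasCompactSupport.mul_left
      (huc.gradient.norm.comp_left (g := fun t : ℝ => t ^ 2) (by simp))
  · intro k _
    obtain ⟨K, hK⟩ := ((hηc.mul_left (f := fun x => fderiv ℝ u x (b k) *
      inner ℝ (b k) x))).exists_bound_of_continuous (by fun_prop)
    have e' : ∀ x, fderiv ℝ u x (b k) * (inner ℝ (b k) x * η x * F x) =
      ((fun x => fderiv ℝ u x (b k) * inner ℝ (b k) x) * η) x * F x := fun x => by
        simp only [Pi.mul_apply]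
        ring
    simp only [e']
    exact hF.bdd_mul (by fun_prop) (Filter.Eventually.of_forall hK)

end IsWeakSolution

end Weak

section RadialCutoff

variable {E : Type*} [NormedAddCommGroup E] [InnerProductSpace ℝ E] {R : ℝ} {ψ : ℝ → ℝ}

lemma hasDerivAt_radialPrimitive (hψ : Continuous ψ) (t : ℝ) :
    HasDerivAt (fun t => ∫ r in t..R, ψ r) (-ψ t) t :=
  intervalIntegral.integral_hasDerivAt_left (hψ.intervalIntegrable _ _)
    hψ.stronglyMeasurable.stronglyMeasurableAtFilter hψ.continuousAt

lemma hasFDerivAt_radialPrimitive_norm (hψ : Continuous ψ) (hψs : tsupport ψ ⊆ Ioo 0 R) (x : E) :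
    HasFDerivAt (fun x : E => ∫ r in ‖x‖..R, ψ r) (-(ψ ‖x‖ / ‖x‖) • innerSL ℝ x) x := by
  rcases eq_or_ne x 0 with rfl | hx
  · obtain ⟨δ, hδ, hδ'⟩ := Metric.mem_nhds_iff.1
      ((isClosed_tsupport ψ).isOpen_compl.mem_nhds
        (fun h => absurd (hψs h).1 (lt_irrefl _) : (0 : ℝ) ∉ tsupport ψ))
    have h0 : (fun x : E => ∫ r in ‖x‖..R, ψ r) =ᶠ[nhds 0] fun _ => ∫ r in (0 : ℝ)..R, ψ r := by
      filter_upwards [Metric.ball_mem_nhds (0 : E) hδ] with x hx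
      rw [mem_ball_zero_iff] at hx
      have hz : ∫ r in (0 : ℝ)..‖x‖, ψ r = 0 := by
        rw [intervalIntegral.integral_congr (g := fun _ => 0), intervalIntegral.integral_zero]
        intro r hr
        rw [uIcc_of_le (norm_nonneg x)] at hr
        refine image_eq_zero_of_notMem_tsupport (hδ' ?_)
        rw [mem_ball_zero_iff, Real.norm_of_nonneg hr.1]
        exact hr.2.trans_lt hx
      rw [← intervalIntegral.integral_add_adjacent_intervals (hψ.intervalIntegrable 0 ‖x‖)
        (hψ.intervalIntegrable _ _), hz, zero_add]
    simpa using (hasFDerivAt_const _ (0 : E)).congr_of_eventuallyEq h0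
  · have h1 : HasFDerivAt (fun x : E => ‖x‖) ((1 / ‖x‖) • innerSL ℝ x) x := by
      have := (hasStrictFDerivAt_norm_sq x).hasFDerivAt.sqrt (by positivity)
      simp only [Real.sqrt_sq (norm_nonneg _)] at this
      convert this using 1
      ext v
      simp
      field_simp
    have h2 := (hasDerivAt_radialPrimitive (R := R) hψ ‖x‖).comp_hasFDerivAt x h1
    have h3 : -(ψ ‖x‖ / ‖x‖) • innerSL ℝ x = -ψ ‖x‖ • (1 / ‖x‖) • innerSL ℝ x := by
      rw [smul_smul]
      congr 1
      ring
    rw [h3]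
    exact h2

lemma fderiv_radialPrimitive_norm (hψ : Continuous ψ) (hψs : tsupport ψ ⊆ Ioo 0 R) (x v : E) :
    fderiv ℝ (fun x : E => ∫ r in ‖x‖..R, ψ r) x v = -(ψ ‖x‖ / ‖x‖) * inner ℝ x v := by
  rw [(hasFDerivAt_radialPrimitive_norm hψ hψs x).fderiv]
  simp

lemma continuous_radial_div (hψ : Continuous ψ) (hψs : tsupport ψ ⊆ Ioo 0 R) :
    Continuous fun t => ψ t / t := by
  rw [continuous_iff_continuousAt]
  intro t
  rcases eq_or_ne t 0 with rfl | h
  · have h0 : (fun t => ψ t / t) =ᶠ[nhds 0] fun _ => 0 := by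
      have : (tsupport ψ)ᶜ ∈ nhds (0 : ℝ) :=
        (isClosed_tsupport ψ).isOpen_compl.mem_nhds fun h => absurd (hψs h).1 (lt_irrefl _)
      filter_upwards [this] with t ht
      rw [image_eq_zero_of_notMem_tsupport ht, zero_div]
    exact continuousAt_const.congr h0.symm
  · exact hψ.continuousAt.div continuousAt_id h

lemma contDiff_radialPrimitive_norm (hψ : Continuous ψ) (hψs : tsupport ψ ⊆ Ioo 0 R) :
    ContDiff ℝ 1 (fun x : E => ∫ r in ‖x‖..R, ψ r) := by
  rw [contDiff_one_iff_hasFDerivAt]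
  refine ⟨_, ?_, hasFDerivAt_radialPrimitive_norm hψ hψs⟩
  exact ((continuous_radial_div hψ hψs).comp continuous_norm).neg.smul (innerSL ℝ).continuous

lemma radialPrimitive_eq_zero {r : ℝ} (hr : r ≤ R) (hψr : ∀ t, r < t → ψ t = 0)
    {t : ℝ} (ht : r ≤ t) : ∫ r in t..R, ψ r = 0 := by
  refine intervalIntegral.integral_zero_ae (Filter.Eventually.of_forall fun a ha => hψr a ?_)
  rcases mem_uIoc.1 ha with h | h
  · exact ht.trans_lt h.1
  · exact hr.trans_lt h.1

lemma tsupport_radialPrimitive_norm [FiniteDimensional ℝ E] (hR : 0 < R)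
    (hψs : tsupport ψ ⊆ Ioo 0 R) :
    HasCompactSupport (fun x : E => ∫ r in ‖x‖..R, ψ r) ∧
      tsupport (fun x : E => ∫ r in ‖x‖..R, ψ r) ⊆ Metric.ball 0 R := by
  obtain ⟨r, hr, hψr⟩ : ∃ r < R, ∀ t, r < t → ψ t = 0 := by
    obtain ⟨r, hr, hrs⟩ := exists_pos_lt_subset_ball (x := (0 : ℝ)) hR (isClosed_tsupport ψ)
      (fun t ht => by
        rw [mem_ball_zero_iff, Real.norm_of_nonneg (hψs ht).1.le]
        exact (hψs ht).2)
    refine ⟨r, hr.2, fun t ht => image_eq_zero_of_notMem_tsupport fun h => ?_⟩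
    have := hrs h
    rw [mem_ball_zero_iff, Real.norm_eq_abs] at this
    linarith [le_abs_self t]
  have hsub : Function.support (fun x : E => ∫ r in ‖x‖..R, ψ r) ⊆ Metric.closedBall 0 r := by
    intro x hx
    by_contra h
    rw [mem_closedBall_zero_iff, not_le] at h
    exact hx (radialPrimitive_eq_zero hr.le hψr h.le)
  exact ⟨HasCompactSupport.of_support_subset_isCompact (isCompact_closedBall _ _) hsub,
    (closure_minimal hsub Metric.isClosed_closedBall).trans (Metric.closedBall_subset_ball hr)⟩

end RadialCutoff

section RadialTest

variable {E : Type*} [NormedAddCommGroup E] [InnerProductSpace ℝ E] [FiniteDimensional ℝ E]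
  [MeasurableSpace E] [BorelSpace E]

namespace IsWeakSolution

variable {R : ℝ} {u F : E → ℝ}

lemma integrable_energy (hu : ContDiff ℝ 1 u) (huc : HasCompactSupport u) (hF : Integrable F) :
    Integrable fun x => ‖gradient u x‖ ^ 2 + F x * u x := by
  have hc1 := hu.continuous_gradient
  refine (Continuous.integrable_of_hasCompactSupport (by fun_prop)
      (huc.gradient.norm.comp_left (g := fun t : ℝ => t ^ 2) (by simp))).add ?_
  obtain ⟨K, hK⟩ := huc.exists_bound_of_continuous hu.continuous
  exact hF.mul_bdd hu.continuous.aestronglyMeasurable (Filter.Eventually.of_forall hK)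

lemma integrable_virial (hu : ContDiff ℝ 1 u) (huc : HasCompactSupport u) (hF : Integrable F)
    (c : ℝ) : Integrable fun x => c * ‖gradient u x‖ ^ 2 - F x * fderiv ℝ u x x := by
  have hc1 := hu.continuous_gradient
  have hc2 := hu.continuous_fderiv one_ne_zero
  have hgc : HasCompactSupport fun x => ‖gradient u x‖ ^ 2 :=
    huc.gradient.norm.comp_left (g := fun t : ℝ => t ^ 2) (by simp)
  have h1 : Integrable fun x => c * ‖gradient u x‖ ^ 2 :=
    Continuous.integrable_of_hasCompactSupport (by fun_prop) hgc.mul_left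
  refine h1.sub ?_
  have hs : HasCompactSupport fun x => fderiv ℝ u x x :=
    huc.gradient.mono fun x hx h0 => hx (by
      simp only
      rw [← inner_gradient_left, h0, inner_zero_left])
  obtain ⟨K, hK⟩ := hs.exists_bound_of_continuous (by fun_prop)
  exact hF.mul_bdd (Continuous.aestronglyMeasurable (by fun_prop)) (Filter.Eventually.of_forall hK)

lemma sphereIntegral_energy (H : IsWeakSolution R u F) (hu : ContDiff ℝ 1 u)
    (huc : HasCompactSupport u) (hF : Integrable F) {m : ℕ} (hm : Module.finrank ℝ E = m + 1)
    {s : ℝ} (hs : s ∈ Ioo 0 R) :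
    s ^ m * (sphereIntegral (fun x => u x * fderiv ℝ u x x) s / s) =
      ∫ t in 0..s, t ^ m * sphereIntegral (fun x => ‖gradient u x‖ ^ 2 + F x * u x) t := by
  have hc2 := hu.continuous_fderiv one_ne_zero
  have hc3 := hu.continuous
  refine sphereIntegral_eq_of_radial_test hm (by fun_prop) (integrable_energy hu huc hF)
    (fun ψ hψ hψc hψs => ?_) hs
  obtain ⟨hc, hts⟩ := tsupport_radialPrimitive_norm (E := E) (hs.1.trans hs.2) hψs
  rw [H.integral_mul_energy hu hF (contDiff_radialPrimitive_norm hψ.continuous hψs) hc hts,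
    ← integral_neg]
  refine integral_congr_ae (Filter.Eventually.of_forall fun x => ?_)
  simp only
  rw [fderiv_radialPrimitive_norm hψ.continuous hψs, real_inner_comm, inner_gradient_left]
  ring

lemma sphereIntegral_virial (H : IsWeakSolution R u F) (hu : ContDiff ℝ 1 u)
    (huc : HasCompactSupport u) (hF : Integrable F) {m : ℕ} (hm : Module.finrank ℝ E = m + 1)
    {s : ℝ} (hs : s ∈ Ioo 0 R) :
    s ^ m * (sphereIntegral
      (fun x => 1 / 2 * ‖x‖ ^ 2 * ‖gradient u x‖ ^ 2 - fderiv ℝ u x x ^ 2) s / s) =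
      ∫ t in 0..s, t ^ m * sphereIntegral
        (fun x => ((m + 1) / 2 - 1) * ‖gradient u x‖ ^ 2 - F x * fderiv ℝ u x x) t := by
  have hc1 := hu.continuous_gradient
  have hc2 := hu.continuous_fderiv one_ne_zero
  have hc3 := hu.continuous
  have hR := hs.1.trans hs.2
  refine sphereIntegral_eq_of_radial_test hm (by fun_prop) (integrable_virial hu huc hF _)
    (fun ψ hψ hψc hψs => ?_) hs
  obtain ⟨hc, hts⟩ := tsupport_radialPrimitive_norm (E := E) hR hψs
  have hη := contDiff_radialPrimitive_norm (E := E) hψ.continuous hψs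
  have hηcont := hη.continuous
  have h := H.integral_pohozaev hR hu huc hF hη hc hts
  simp only [fderiv_radialPrimitive_norm hψ.continuous hψs, real_inner_self_eq_norm_sq] at h
  have hdiv := (continuous_radial_div hψ.continuous hψs).comp (continuous_norm (E := E))
  simp only [Function.comp_def] at hdiv
  have hgc : HasCompactSupport fun x => ‖gradient u x‖ ^ 2 :=
    huc.gradient.norm.comp_left (g := fun t : ℝ => t ^ 2) (by simp)
  have i1 : Integrable fun x => fderiv ℝ u x x * ((∫ r in ‖x‖..R, ψ r) * F x) := by
    obtain ⟨K, hK⟩ := (hc.mul_left (f := fun x => fderiv ℝ u x x)).exists_bound_of_continuous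
      (by fun_prop)
    simp only [← mul_assoc]
    exact hF.bdd_mul (by fun_prop) (Filter.Eventually.of_forall hK)
  have i2 : Integrable fun x => (Module.finrank ℝ E * (∫ r in ‖x‖..R, ψ r) +
      -(ψ ‖x‖ / ‖x‖) * ‖x‖ ^ 2) * ‖gradient u x‖ ^ 2 :=
    Continuous.integrable_of_hasCompactSupport (by fun_prop) hgc.mul_left
  have i3 : Integrable fun x => (∫ r in ‖x‖..R, ψ r) * ‖gradient u x‖ ^ 2 +
      fderiv ℝ u x x * (-(ψ ‖x‖ / ‖x‖) * inner ℝ x (gradient u x)) :=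
    Continuous.integrable_of_hasCompactSupport (by fun_prop)
      (huc.gradient.mono fun x hx h0 => hx (by simp [h0]))
  have i4 : Integrable fun x => 1 / 2 * ((Module.finrank ℝ E * (∫ r in ‖x‖..R, ψ r) +
      -(ψ ‖x‖ / ‖x‖) * ‖x‖ ^ 2) * ‖gradient u x‖ ^ 2) - ((∫ r in ‖x‖..R, ψ r) *
      ‖gradient u x‖ ^ 2 + fderiv ℝ u x x * (-(ψ ‖x‖ / ‖x‖) * inner ℝ x (gradient u x))) :=
    (i2.const_mul _).sub i3
  rw [← sub_eq_zero, ← integral_const_mul, ← integral_sub (i2.const_mul _) i3,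
    ← integral_sub i1 i4] at h
  rw [← sub_eq_zero, ← integral_sub, ← neg_eq_zero, ← integral_neg, ← h]
  · refine integral_congr_ae (Filter.Eventually.of_forall fun x => ?_)
    simp only
    rw [real_inner_comm, inner_gradient_left, hm]
    push_cast
    ring
  · obtain ⟨K, hK⟩ := hc.exists_bound_of_continuous hηcont
    exact (integrable_virial hu huc hF _).bdd_mul hηcont.aestronglyMeasurable
      (Filter.Eventually.of_forall hK)
  · refine Continuous.integrable_of_hasCompactSupport (by fun_prop)
      (huc.gradient.mono fun x hx h0 => hx ?_)
    have : fderiv ℝ u x x = 0 := by rw [← inner_gradient_left, h0, inner_zero_left]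
    simp [h0, this]

end IsWeakSolution

end RadialTest

section DirIntegral

variable {E : Type*} [NormedAddCommGroup E] [InnerProductSpace ℝ E] [FiniteDimensional ℝ E]
  [MeasurableSpace E] [BorelSpace E]

/-- The integral over directions `w` of a quantity at `t • w` depending also on `w`. -/
noncomputable def dirIntegral (g : E → E → ℝ) (t : ℝ) : ℝ :=
  ∫ w : Metric.sphere (0 : E) 1, g (t • (w : E)) w ∂(volume : Measure E).toSphere

lemma continuous_dirIntegral {g : E → E → ℝ} (hg : Continuous (Function.uncurry g)) :
    Continuous (dirIntegral g) := by
  have := continuous_parametric_integral_of_continuous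
    (μ := (volume : Measure E).toSphere)
    (f := fun (t : ℝ) (w : Metric.sphere (0 : E) 1) => Function.uncurry g (t • (w : E), (w : E)))
    (by fun_prop) (isCompact_univ)
  rw [Measure.restrict_univ] at this
  exact this

lemma integrable_dir_of_continuous {g : E → E → ℝ} (hg : Continuous (Function.uncurry g))
    (t : ℝ) : Integrable (fun w : Metric.sphere (0 : E) 1 => g (t • (w : E)) w)
      (volume : Measure E).toSphere :=
  (show Continuous fun w : Metric.sphere (0 : E) 1 => Function.uncurry g (t • (w : E), (w : E)) by
    fun_prop).integrable_of_hasCompactSupport (HasCompactSupport.of_compactSpace _)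

lemma integrable_dir_of_bounded {g : E → E → ℝ} (hg : Measurable (Function.uncurry g))
    {K : ℝ} (hK : ∀ x w, ‖w‖ = 1 → |g x w| ≤ K) (t : ℝ) :
    Integrable (fun w : Metric.sphere (0 : E) 1 => g (t • (w : E)) w)
      (volume : Measure E).toSphere :=
  Integrable.of_bound (f := fun w : Metric.sphere (0 : E) 1 => g (t • (w : E)) w)
    (hg.comp ((measurable_subtype_coe.const_smul t).prodMk
    measurable_subtype_coe)).aestronglyMeasurable K
    (Filter.Eventually.of_forall fun w => hK _ _ (norm_eq_of_mem_sphere w))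

lemma intervalIntegrable_dirIntegral {g : E → E → ℝ} (hg : Measurable (Function.uncurry g))
    {K : ℝ} (hK : ∀ x w, ‖w‖ = 1 → |g x w| ≤ K) (a b : ℝ) :
    IntervalIntegrable (dirIntegral g) volume a b := by
  have hmeas : StronglyMeasurable (dirIntegral g) := by
    have : StronglyMeasurable fun z : ℝ × Metric.sphere (0 : E) 1 => g (z.1 • (z.2 : E)) z.2 := by
      refine Measurable.stronglyMeasurable (hg.comp (Measurable.prodMk ?_ ?_))
      · exact measurable_fst.smul (measurable_subtype_coe.comp measurable_snd)
      · exact measurable_subtype_coe.comp measurable_snd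
    exact this.integral_prod_right
  refine (intervalIntegrable_const (c := K * (volume : Measure E).toSphere.real univ)).mono_fun'
    hmeas.aestronglyMeasurable (Filter.Eventually.of_forall fun t => ?_)
  exact norm_integral_le_of_norm_le_const
    (Filter.Eventually.of_forall fun w => hK _ _ (norm_eq_of_mem_sphere w))

lemma dirIntegral_finsetSum {ι : Type*} (s : Finset ι) {g : ι → E → E → ℝ} {t : ℝ}
    (hg : ∀ a ∈ s, Integrable (fun w : Metric.sphere (0 : E) 1 => g a (t • (w : E)) w)
      (volume : Measure E).toSphere) :
    dirIntegral (fun x w => ∑ a ∈ s, g a x w) t = ∑ a ∈ s, dirIntegral (g a) t :=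
  integral_finsetSum s hg

lemma abs_dirIntegral_le {g f : E → E → ℝ} {t : ℝ} (ht : 0 ≤ t)
    (hf : Integrable (fun w : Metric.sphere (0 : E) 1 => f (t • (w : E)) w)
      (volume : Measure E).toSphere)
    (h : ∀ x w, ‖x‖ = t → ‖w‖ = 1 → |g x w| ≤ f x w) :
    |dirIntegral g t| ≤ dirIntegral f t :=
  norm_integral_le_of_norm_le (f := fun w : Metric.sphere (0 : E) 1 => g (t • (w : E)) w) hf
    (Filter.Eventually.of_forall fun w => h (t • (w : E)) w
      (by rw [norm_smul, norm_eq_of_mem_sphere w, mul_one, Real.norm_of_nonneg ht])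
      (norm_eq_of_mem_sphere w))

lemma hasDerivAt_dirIntegral {g g' : E → E → ℝ} (hg : Continuous (Function.uncurry g))
    (hg' : Continuous (Function.uncurry g'))
    (h : ∀ (t : ℝ) w, HasDerivAt (fun t : ℝ => g (t • w) w) (g' (t • w) w) t) (t : ℝ) :
    HasDerivAt (dirIntegral g) (dirIntegral g' t) t := by
  have hc : Continuous fun z : ℝ × Metric.sphere (0 : E) 1 =>
      Function.uncurry g' (z.1 • (z.2 : E), (z.2 : E)) := by fun_prop
  obtain ⟨K, hK⟩ := ((isCompact_closedBall t 1).prod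
    (isCompact_univ (X := Metric.sphere (0 : E) 1))).exists_bound_of_continuousOn hc.continuousOn
  refine (hasDerivAt_integral_of_dominated_loc_of_deriv_le
    (F := fun t (w : Metric.sphere (0 : E) 1) => g (t • (w : E)) w)
    (F' := fun t w => g' (t • (w : E)) w) (bound := fun _ => K)
    (s := Metric.closedBall t 1) (Metric.closedBall_mem_nhds t one_pos)
    (Filter.Eventually.of_forall fun t => (integrable_dir_of_continuous hg t).1)
    (integrable_dir_of_continuous hg t) (integrable_dir_of_continuous hg' t).1
    (Filter.Eventually.of_forall fun w s hs => hK (s, w) ⟨hs, mem_univ _⟩)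
    (integrable_const _) (Filter.Eventually.of_forall fun w s hs => h s w)).2

end DirIntegral

namespace IsWeakSolution

variable {E : Type*} [NormedAddCommGroup E] [InnerProductSpace ℝ E] [FiniteDimensional ℝ E]
  [MeasurableSpace E] [BorelSpace E] {R : ℝ} {u F : E → ℝ}

lemma dirIntegral_energy (H : IsWeakSolution R u F) (hu : ContDiff ℝ 1 u)
    (huc : HasCompactSupport u) (hF : Integrable F)
    (hFu : ∀ t : ℝ, Integrable (fun w : Metric.sphere (0 : E) 1 =>
      F (t • (w : E)) * u (t • (w : E))) (volume : Measure E).toSphere)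
    {m : ℕ} (hm : Module.finrank ℝ E = m + 1)
    {s : ℝ} (hs : s ∈ Ioo 0 R) :
    s ^ m * dirIntegral (fun x w => u x * fderiv ℝ u x w) s =
      ∫ t in 0..s, t ^ m * (dirIntegral (fun x _ => ‖gradient u x‖ ^ 2) t +
        dirIntegral (fun x _ => F x * u x) t) := by
  have hc1 := hu.continuous_gradient
  convert H.sphereIntegral_energy hu huc hF hm hs using 1
  · congr 1
    rw [eq_div_iff hs.1.ne', mul_comm, dirIntegral, sphereIntegral, ← integral_const_mul]
    refine integral_congr_ae (Filter.Eventually.of_forall fun w => ?_)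
    simp only [map_smul, smul_eq_mul]
    ring
  · refine intervalIntegral.integral_congr fun t _ => ?_
    congr 1
    exact (integral_add (integrable_dir_of_continuous (g := fun x _ => ‖gradient u x‖ ^ 2)
      (by simp only [Function.uncurry_def]; fun_prop) t) (hFu t)).symm

lemma dirIntegral_virial (H : IsWeakSolution R u F) (hu : ContDiff ℝ 1 u)
    (huc : HasCompactSupport u) (hF : Integrable F)
    (hFu : ∀ t : ℝ, Integrable (fun w : Metric.sphere (0 : E) 1 =>
      F (t • (w : E)) * fderiv ℝ u (t • (w : E)) w) (volume : Measure E).toSphere)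
    {m : ℕ} (hm : Module.finrank ℝ E = m + 1)
    {s : ℝ} (hs : s ∈ Ioo 0 R) :
    s ^ (m + 1) * (dirIntegral (fun x _ => ‖gradient u x‖ ^ 2) s -
        2 * dirIntegral (fun x w => fderiv ℝ u x w ^ 2) s) =
      ∫ t in 0..s, t ^ m *
        ((((m + 1 : ℕ) : ℝ) - 2) * dirIntegral (fun x _ => ‖gradient u x‖ ^ 2) t -
        2 * t * dirIntegral (fun x w => F x * fderiv ℝ u x w) t) := by
  have hc1 := hu.continuous_gradient
  have hc2 := hu.continuous_fderiv one_ne_zero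
  have i1 := integrable_dir_of_continuous (g := fun x _ => ‖gradient u x‖ ^ 2)
      (by simp only [Function.uncurry_def]; fun_prop)
  have i2 := integrable_dir_of_continuous (g := fun x w => fderiv ℝ u x w ^ 2)
      (by simp only [Function.uncurry_def]; fun_prop)
  have e1 : sphereIntegral
      (fun x => 1 / 2 * ‖x‖ ^ 2 * ‖gradient u x‖ ^ 2 - fderiv ℝ u x x ^ 2) s / s =
      s / 2 * (dirIntegral (fun x _ => ‖gradient u x‖ ^ 2) s -
        2 * dirIntegral (fun x w => fderiv ℝ u x w ^ 2) s) := by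
    rw [div_eq_iff hs.1.ne', dirIntegral, dirIntegral, ← integral_const_mul,
      ← integral_sub (i1 s) ((i2 s).const_mul 2), ← integral_const_mul, ← integral_mul_const,
      sphereIntegral]
    refine integral_congr_ae (Filter.Eventually.of_forall fun w => ?_)
    simp only [map_smul, smul_eq_mul, norm_smul, norm_eq_of_mem_sphere w, mul_one,
      Real.norm_of_nonneg hs.1.le]
    ring
  have e2 : ∀ t, sphereIntegral
        (fun x => ((m + 1) / 2 - 1) * ‖gradient u x‖ ^ 2 - F x * fderiv ℝ u x x) t =
      1 / 2 * ((((m + 1 : ℕ) : ℝ) - 2) * dirIntegral (fun x _ => ‖gradient u x‖ ^ 2) t -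
        2 * t * dirIntegral (fun x w => F x * fderiv ℝ u x w) t) := by
    intro t
    rw [dirIntegral, dirIntegral, ← integral_const_mul, ← integral_const_mul,
      ← integral_sub ((i1 t).const_mul _) ((hFu t).const_mul _), ← integral_const_mul,
      sphereIntegral]
    refine integral_congr_ae (Filter.Eventually.of_forall fun w => ?_)
    simp only [map_smul, smul_eq_mul]
    push_cast
    ring
  have h := H.sphereIntegral_virial hu huc hF hm hs
  rw [e1] at h
  simp only [e2] at h
  have e3 : ∀ t : ℝ, t ^ m * (1 / 2 * ((((m + 1 : ℕ) : ℝ) - 2) *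
        dirIntegral (fun x _ => ‖gradient u x‖ ^ 2) t -
        2 * t * dirIntegral (fun x w => F x * fderiv ℝ u x w) t)) = 1 / 2 *
      (t ^ m * ((((m + 1 : ℕ) : ℝ) - 2) * dirIntegral (fun x _ => ‖gradient u x‖ ^ 2) t -
        2 * t * dirIntegral (fun x w => F x * fderiv ℝ u x w) t)) := fun t => by ring
  simp only [e3] at h
  rw [intervalIntegral.integral_const_mul] at h
  linear_combination 2 * h

end IsWeakSolution

lemma norm_fderiv_apply_le_norm_gradient {E : Type*} [NormedAddCommGroup E]
    [InnerProductSpace ℝ E] [CompleteSpace E] {u : E → ℝ} {x w : E} (hw : ‖w‖ = 1) :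
    |fderiv ℝ u x w| ≤ ‖gradient u x‖ := by
  rw [← inner_gradient_left]
  simpa [hw] using abs_real_inner_le_norm (gradient u x) w

section System

variable {E : Type*} [NormedAddCommGroup E] [InnerProductSpace ℝ E] [FiniteDimensional ℝ E]
  [MeasurableSpace E] [BorelSpace E]

lemma dirIntegral_linear {A B : E → E → ℝ} (hA : Continuous (Function.uncurry A))
    (hB : Continuous (Function.uncurry B)) (a b t : ℝ) :
    dirIntegral (fun x w => a * A x w + b * B x w) t =
      a * dirIntegral A t + b * dirIntegral B t := by
  have h1 := (integrable_dir_of_continuous hA t).const_mul a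
  have h2 := (integrable_dir_of_continuous hB t).const_mul b
  rw [dirIntegral, dirIntegral, dirIntegral, ← integral_const_mul, ← integral_const_mul,
    ← integral_add h1 h2]

lemma abs_dirIntegral_le_linear {f A B : E → E → ℝ} {a b t : ℝ} (ht : 0 ≤ t)
    (hA : Continuous (Function.uncurry A)) (hB : Continuous (Function.uncurry B))
    (h : ∀ x w, ‖x‖ = t → ‖w‖ = 1 → |f x w| ≤ a * A x w + b * B x w) :
    |dirIntegral f t| ≤ a * dirIntegral A t + b * dirIntegral B t := by
  rw [← dirIntegral_linear hA hB]
  exact abs_dirIntegral_le ht (((integrable_dir_of_continuous hA t).const_mul a).add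
    ((integrable_dir_of_continuous hB t).const_mul b)) h

lemma sq_dirIntegral_le {ι : Type*} [Fintype ι] {a b : ι → E → E → ℝ}
    (ha : ∀ i, Continuous (Function.uncurry (a i)))
    (hb : ∀ i, Continuous (Function.uncurry (b i))) (t : ℝ) :
    dirIntegral (fun x w => ∑ i, a i x w * b i x w) t ^ 2 ≤
      dirIntegral (fun x w => ∑ i, a i x w ^ 2) t *
        dirIntegral (fun x w => ∑ i, b i x w ^ 2) t := by
  have hA : Continuous (Function.uncurry fun x w => ∑ i, a i x w ^ 2) :=
    continuous_finsetSum _ fun i _ => (ha i).pow 2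
  have hB : Continuous (Function.uncurry fun x w => ∑ i, b i x w ^ 2) :=
    continuous_finsetSum _ fun i _ => (hb i).pow 2
  have hAB : Continuous (Function.uncurry fun x w => ∑ i, a i x w * b i x w) :=
    continuous_finsetSum _ fun i _ => (ha i).mul (hb i)
  have key : ∀ r : ℝ, 0 ≤ dirIntegral (fun x w => ∑ i, a i x w ^ 2) t * (r * r) +
      2 * dirIntegral (fun x w => ∑ i, a i x w * b i x w) t * r +
        dirIntegral (fun x w => ∑ i, b i x w ^ 2) t := by
    intro r
    have h0 : 0 ≤ dirIntegral (fun x w => ∑ i, (r * a i x w + b i x w) ^ 2) t :=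
      integral_nonneg fun w => Finset.sum_nonneg fun i _ => sq_nonneg _
    have h1 : (fun x w => ∑ i, (r * a i x w + b i x w) ^ 2) = fun x w : E =>
        1 * (fun x w => (r * r) * (∑ i, a i x w ^ 2) + (2 * r) * ∑ i, a i x w * b i x w) x w +
          1 * ∑ i, b i x w ^ 2 := by
      funext x w
      simp only [Finset.mul_sum, one_mul, ← Finset.sum_add_distrib]
      exact Finset.sum_congr rfl fun i _ => by ring
    rw [h1, dirIntegral_linear (by
      exact (hA.const_mul (r * r)).add (hAB.const_mul (2 * r))) hB,
      dirIntegral_linear hA hAB] at h0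
    linarith
  have := discrim_le_zero key
  rw [discrim] at this
  nlinarith

lemma dirIntegral_mono {f g : E → E → ℝ} (hf : Continuous (Function.uncurry f))
    (hg : Continuous (Function.uncurry g)) (h : ∀ x w, ‖w‖ = 1 → f x w ≤ g x w) (t : ℝ) :
    dirIntegral f t ≤ dirIntegral g t :=
  integral_mono (integrable_dir_of_continuous hf t) (integrable_dir_of_continuous hg t)
    fun w => h _ _ (norm_eq_of_mem_sphere w)

variable {ι : Type*} [Fintype ι] {u F : ι → E → ℝ} {τ R C₀ K : ℝ} {m : ℕ}

theorem IsWeakSolution.isRadialProfile (H : ∀ a, IsWeakSolution R (u a) (F a))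
    (hu : ∀ a, ContDiff ℝ 1 (u a)) (huc : ∀ a, HasCompactSupport (u a))
    (hFm : ∀ a, Measurable (F a)) (hFi : ∀ a, Integrable (F a)) (hK : ∀ a x, |F a x| ≤ K)
    (hC₀ : 0 ≤ C₀) (hm : Module.finrank ℝ E = m + 1)
    (hF : ∀ a, ∀ x ∈ Metric.ball (0 : E) R, |F a x| ≤
      C₀ * (√(∑ b, u b x ^ 2) + ‖x‖ ^ τ * √(∑ b, ‖gradient (u b) x‖ ^ 2))) :
    IsRadialProfile (m + 1) τ (Fintype.card ι * C₀) R
      (dirIntegral fun x _ => ∑ a, u a x ^ 2)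
      (dirIntegral fun x w => ∑ a, u a x * fderiv ℝ (u a) x w)
      (dirIntegral fun x _ => ∑ a, ‖gradient (u a) x‖ ^ 2)
      (dirIntegral fun x w => ∑ a, fderiv ℝ (u a) x w ^ 2)
      (dirIntegral fun x _ => ∑ a, F a x * u a x)
      (dirIntegral fun x w => ∑ a, F a x * fderiv ℝ (u a) x w) := by
  have hu0 : ∀ a, Continuous (u a) := fun a => (hu a).continuous
  have hu1 : ∀ a, Continuous (fderiv ℝ (u a)) := fun a => (hu a).continuous_fderiv one_ne_zero
  have hu2 : ∀ a, Continuous (gradient (u a)) := fun a => (hu a).continuous_gradient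
  have cv : ∀ a, Continuous (Function.uncurry fun x (_ : E) => u a x) := fun a =>
    (hu0 a).comp continuous_fst
  have cd : ∀ a, Continuous (Function.uncurry fun x w => fderiv ℝ (u a) x w) := fun a =>
    ((hu1 a).comp continuous_fst).clm_apply continuous_snd
  have cg : ∀ a, Continuous (Function.uncurry fun x (_ : E) => ‖gradient (u a) x‖ ^ 2) := fun a =>
    (((hu2 a).comp continuous_fst).norm).pow 2
  have ch : Continuous (Function.uncurry fun x (_ : E) => ∑ a, u a x ^ 2) :=
    continuous_finsetSum _ fun a _ => (cv a).pow 2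
  have cp : Continuous (Function.uncurry fun x w => ∑ a, u a x * fderiv ℝ (u a) x w) :=
    continuous_finsetSum _ fun a _ => (cv a).mul (cd a)
  have ce : Continuous (Function.uncurry fun x (_ : E) => ∑ a, ‖gradient (u a) x‖ ^ 2) :=
    continuous_finsetSum _ fun a _ => cg a
  have cq : Continuous (Function.uncurry fun x w => ∑ a, fderiv ℝ (u a) x w ^ 2) :=
    continuous_finsetSum _ fun a _ => (cd a).pow 2
  have bu : ∀ a, ∃ B, ∀ x, |u a x| ≤ B := fun a =>
    (huc a).exists_bound_of_continuous (hu0 a)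
  have bg : ∀ a, ∃ B, ∀ x, ‖gradient (u a) x‖ ≤ B := fun a =>
    ((huc a).gradient).exists_bound_of_continuous (hu2 a)
  choose B hB using bu
  choose B' hB' using bg
  have mk : ∀ a, Measurable (Function.uncurry fun x (_ : E) => F a x * u a x) := fun a =>
    ((hFm a).comp measurable_fst).mul (cv a).measurable
  have ml : ∀ a, Measurable (Function.uncurry fun x w => F a x * fderiv ℝ (u a) x w) := fun a =>
    ((hFm a).comp measurable_fst).mul (cd a).measurable
  have bk : ∀ a, ∀ x w : E, ‖w‖ = 1 → |F a x * u a x| ≤ K * B a := fun a x w _ => by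
    rw [abs_mul]
    exact mul_le_mul (hK a x) (hB a x) (abs_nonneg _) ((abs_nonneg _).trans (hK a x))
  have bl : ∀ a, ∀ x w : E, ‖w‖ = 1 → |F a x * fderiv ℝ (u a) x w| ≤ K * B' a := fun a x w hw => by
    rw [abs_mul]
    exact mul_le_mul (hK a x) ((norm_fderiv_apply_le_norm_gradient hw).trans (hB' a x))
      (abs_nonneg _) ((abs_nonneg _).trans (hK a x))
  have ik := fun a t => integrable_dir_of_bounded (mk a) (bk a) t
  have il := fun a t => integrable_dir_of_bounded (ml a) (bl a) t
  have sp := fun t => dirIntegral_finsetSum Finset.univ (t := t)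
    (g := fun a x w => u a x * fderiv ℝ (u a) x w)
    fun a _ => integrable_dir_of_continuous
      (g := fun x w => u a x * fderiv ℝ (u a) x w) ((cv a).mul (cd a)) t
  have se := fun t => dirIntegral_finsetSum Finset.univ (t := t)
    (g := fun a x _ => ‖gradient (u a) x‖ ^ 2) fun a _ => integrable_dir_of_continuous
      (g := fun x _ => ‖gradient (u a) x‖ ^ 2) (cg a) t
  have sq := fun t => dirIntegral_finsetSum Finset.univ (t := t)
    (g := fun a x w => fderiv ℝ (u a) x w ^ 2)
    fun a _ => integrable_dir_of_continuous
      (g := fun x w => fderiv ℝ (u a) x w ^ 2) (by exact (cd a).pow 2) t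
  have sk := fun t => dirIntegral_finsetSum Finset.univ (t := t)
    (g := fun a x _ => F a x * u a x) fun a _ => ik a t
  have sl := fun t => dirIntegral_finsetSum Finset.univ (t := t)
    (g := fun a x w => F a x * fderiv ℝ (u a) x w) fun a _ => il a t
  have jk := fun a s => intervalIntegrable_dirIntegral (mk a) (bk a) 0 s
  have jl := fun a s => intervalIntegrable_dirIntegral (ml a) (bl a) 0 s
  have je : ∀ a s, IntervalIntegrable (dirIntegral fun x _ => ‖gradient (u a) x‖ ^ 2) volume 0 s :=
    fun a s => (continuous_dirIntegral (cg a)).intervalIntegrable 0 s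
  have hU : ∀ x a, |u a x| ≤ √(∑ b, u b x ^ 2) := fun x a =>
    Real.abs_le_sqrt (Finset.single_le_sum (f := fun b => u b x ^ 2)
      (fun b _ => sq_nonneg _) (Finset.mem_univ a))
  have hG : ∀ x a, ‖gradient (u a) x‖ ≤ √(∑ b, ‖gradient (u b) x‖ ^ 2) := fun x a =>
    Real.le_sqrt_of_sq_le (Finset.single_le_sum (f := fun b => ‖gradient (u b) x‖ ^ 2)
      (fun b _ => sq_nonneg _) (Finset.mem_univ a))
  have hU2 : ∀ x, √(∑ b, u b x ^ 2) ^ 2 = ∑ b, u b x ^ 2 := fun x =>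
    Real.sq_sqrt (Finset.sum_nonneg fun b _ => sq_nonneg _)
  have hG2 : ∀ x, √(∑ b, ‖gradient (u b) x‖ ^ 2) ^ 2 = ∑ b, ‖gradient (u b) x‖ ^ 2 := fun x =>
    Real.sq_sqrt (Finset.sum_nonneg fun b _ => sq_nonneg _)
  refine
    { continuous_h := continuous_dirIntegral ch
      continuous_p := continuous_dirIntegral cp
      continuous_e := continuous_dirIntegral ce
      continuous_q := continuous_dirIntegral cq
      h_nonneg := fun t => integral_nonneg fun w => Finset.sum_nonneg fun i _ => sq_nonneg _
      hasDerivAt_h := fun t _ => ?_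
      sq_p_le := sq_dirIntegral_le cv cd
      q_nonneg := fun t => integral_nonneg fun w => Finset.sum_nonneg fun i _ => sq_nonneg _
      q_le_e := fun t => dirIntegral_mono cq ce (fun x w hw => Finset.sum_le_sum fun a _ => ?_) t
      integrable_k := fun s _ => ?_
      integrable_l := fun s _ => ?_
      green := fun s hs => ?_
      pohozaev := fun s hs => ?_
      abs_k_le := fun t ht μ hμ => ?_
      abs_l_le := fun t ht => ?_ }
  · have h1 := hasDerivAt_dirIntegral (g := fun x _ => ∑ a, u a x ^ 2)
      (g' := fun x w => 2 * (∑ a, u a x * fderiv ℝ (u a) x w) +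
        0 * ∑ a, u a x * fderiv ℝ (u a) x w) ch
      ((cp.const_mul 2).add (cp.const_mul 0)) (fun t w => ?_) t
    · rwa [dirIntegral_linear cp cp, zero_mul, add_zero] at h1
    · have h2 : ∀ a, HasDerivAt (fun t : ℝ => u a (t • w)) (fderiv ℝ (u a) (t • w) w) t := by
        intro a
        have h3 := (((hu a).differentiable one_ne_zero) (t • w)).hasFDerivAt.comp_hasDerivAt t
          ((hasDerivAt_id t).smul_const w)
        simpa only [one_smul] using! h3
      have h4 := HasDerivAt.fun_sum (u := Finset.univ) fun a _ => (h2 a).fun_pow 2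
      refine h4.congr_deriv ?_
      rw [zero_mul, add_zero, Finset.mul_sum]
      exact Finset.sum_congr rfl fun a _ => by push_cast; ring
  · exact sq_le_sq' (neg_le_of_abs_le (norm_fderiv_apply_le_norm_gradient hw))
      (le_of_abs_le (norm_fderiv_apply_le_norm_gradient hw))
  · rw [funext sk]
    simpa only [Finset.sum_fn] using IntervalIntegrable.sum Finset.univ fun a _ => jk a s
  · rw [funext sl]
    simpa only [Finset.sum_fn] using IntervalIntegrable.sum Finset.univ fun a _ => jl a s
  · simp only [sp, se, sk, add_tsub_cancel_right, Finset.mul_sum, ← Finset.sum_add_distrib]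
    rw [intervalIntegral.integral_finsetSum]
    · exact Finset.sum_congr rfl fun a _ =>
        (H a).dirIntegral_energy (hu a) (huc a) (hFi a) (ik a) hm hs
    · exact fun a _ => ((je a s).add (jk a s)).continuousOn_mul (by fun_prop)
  · simp only [se, sq, sl, add_tsub_cancel_right, Finset.mul_sum, ← Finset.sum_sub_distrib]
    rw [intervalIntegral.integral_finsetSum]
    · exact Finset.sum_congr rfl fun a _ =>
        (H a).dirIntegral_virial (hu a) (huc a) (hFi a) (il a) hm hs
    · exact fun a _ => (((je a s).const_mul _).sub
        ((jl a s).continuousOn_mul (g := fun t => 2 * t) (by fun_prop))).continuousOn_mul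
        (by fun_prop)
  · have h1 : Fintype.card ι * C₀ * (dirIntegral (fun x _ => ∑ a, u a x ^ 2) t + t ^ τ *
        (μ * dirIntegral (fun x _ => ∑ a, ‖gradient (u a) x‖ ^ 2) t +
          dirIntegral (fun x _ => ∑ a, u a x ^ 2) t / μ)) =
        (Fintype.card ι * C₀ * (1 + t ^ τ / μ)) * dirIntegral (fun x _ => ∑ a, u a x ^ 2) t +
          (Fintype.card ι * C₀ * (t ^ τ * μ)) *
            dirIntegral (fun x _ => ∑ a, ‖gradient (u a) x‖ ^ 2) t := by
      ring
    rw [h1]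
    refine abs_dirIntegral_le_linear ht.1.le ch ce fun x w hx hw => ?_
    have hxR : x ∈ Metric.ball (0 : E) R := by rw [mem_ball_zero_iff, hx]; exact ht.2
    rw [← hU2, ← hG2]
    have h2 : ∀ a ∈ Finset.univ, |F a x * u a x| ≤
        C₀ * (√(∑ b, u b x ^ 2) + t ^ τ * √(∑ b, ‖gradient (u b) x‖ ^ 2)) *
          √(∑ b, u b x ^ 2) := fun a _ => by
      rw [abs_mul, ← hx]
      exact mul_le_mul (hF a x hxR) (hU x a) (abs_nonneg _) ((abs_nonneg _).trans (hF a x hxR))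
    refine (Finset.abs_sum_le_sum_abs _ _).trans ((Finset.sum_le_card_nsmul _ _ _ h2).trans ?_)
    rw [nsmul_eq_mul, Finset.card_univ]
    set U := √(∑ b, u b x ^ 2)
    set G := √(∑ b, ‖gradient (u b) x‖ ^ 2)
    have h3 : G * U ≤ μ * G ^ 2 + U ^ 2 / μ := by
      have : μ * G ^ 2 + U ^ 2 / μ - G * U = (μ * (G - U / (2 * μ)) ^ 2) + 3 / 4 * (U ^ 2 / μ) := by
        field_simp
        ring
      have : 0 ≤ μ * G ^ 2 + U ^ 2 / μ - G * U := by rw [this]; positivity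
      linarith
    have h4 := mul_le_mul_of_nonneg_left h3 (Real.rpow_nonneg ht.1.le τ)
    have h5 := mul_le_mul_of_nonneg_left (add_le_add_right h4 (U ^ 2))
      (show 0 ≤ Fintype.card ι * C₀ by positivity)
    refine le_trans (le_of_eq (by ring)) (h5.trans (le_of_eq (by ring)))
  · have h1 : Fintype.card ι * C₀ * (dirIntegral (fun x _ => ∑ a, u a x ^ 2) t / t +
        t * dirIntegral (fun x _ => ∑ a, ‖gradient (u a) x‖ ^ 2) t +
          t ^ τ * dirIntegral (fun x _ => ∑ a, ‖gradient (u a) x‖ ^ 2) t) =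
        (Fintype.card ι * C₀ / t) * dirIntegral (fun x _ => ∑ a, u a x ^ 2) t +
          (Fintype.card ι * C₀ * (t + t ^ τ)) *
            dirIntegral (fun x _ => ∑ a, ‖gradient (u a) x‖ ^ 2) t := by
      ring
    rw [h1]
    refine abs_dirIntegral_le_linear ht.1.le ch ce fun x w hx hw => ?_
    have hxR : x ∈ Metric.ball (0 : E) R := by rw [mem_ball_zero_iff, hx]; exact ht.2
    rw [← hU2, ← hG2]
    have h2 : ∀ a ∈ Finset.univ, |F a x * fderiv ℝ (u a) x w| ≤
        C₀ * (√(∑ b, u b x ^ 2) + t ^ τ * √(∑ b, ‖gradient (u b) x‖ ^ 2)) *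
          √(∑ b, ‖gradient (u b) x‖ ^ 2) := fun a _ => by
      rw [abs_mul, ← hx]
      exact mul_le_mul (hF a x hxR) ((norm_fderiv_apply_le_norm_gradient hw).trans (hG x a))
        (abs_nonneg _) ((abs_nonneg _).trans (hF a x hxR))
    refine (Finset.abs_sum_le_sum_abs _ _).trans ((Finset.sum_le_card_nsmul _ _ _ h2).trans ?_)
    rw [nsmul_eq_mul, Finset.card_univ]
    set U := √(∑ b, u b x ^ 2)
    set G := √(∑ b, ‖gradient (u b) x‖ ^ 2)
    have ht0 := ht.1
    have h3 : G * U ≤ t * G ^ 2 + U ^ 2 / t := by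
      have : t * G ^ 2 + U ^ 2 / t - G * U = (t * (G - U / (2 * t)) ^ 2) + 3 / 4 * (U ^ 2 / t) := by
        field_simp
        ring
      have : 0 ≤ t * G ^ 2 + U ^ 2 / t - G * U := by rw [this]; positivity
      linarith
    have h5 := mul_le_mul_of_nonneg_left h3 (show 0 ≤ Fintype.card ι * C₀ by positivity)
    refine le_trans (le_of_eq (by ring)) ((add_le_add_left h5 (Fintype.card ι * C₀ *
      (t ^ τ * G ^ 2))).trans (le_of_eq (by ring)))

end System

lemma integral_sum_fderiv_single_eq_zero {m : ℕ}
    {X : Fin (m + 1) → EuclideanSpace ℝ (Fin (m + 1)) → ℝ}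
    (hX : ∀ i, Differentiable ℝ (X i)) (hc : ∀ i, HasCompactSupport (X i))
    (hi : Integrable fun x => ∑ i, fderiv ℝ (X i) x (EuclideanSpace.single i 1)) :
    ∫ x, ∑ i, fderiv ℝ (X i) x (EuclideanSpace.single i 1) = 0 := by
  obtain ⟨r, hr0, hr⟩ : ∃ r : ℝ, 0 < r ∧ ∀ i x, r ≤ ‖x‖ →
      X i x = 0 ∧ fderiv ℝ (X i) x = 0 := by
    have hb : Bornology.IsBounded (⋃ i, tsupport (X i)) :=
      (isCompact_iUnion fun i => (hc i)).isBounded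
    obtain ⟨r, hr0, hr⟩ := hb.exists_pos_norm_lt
    refine ⟨r, hr0, fun i x hx => ?_⟩
    have h1 : x ∉ tsupport (X i) := fun h => (hr x (mem_iUnion.2 ⟨i, h⟩)).not_ge hx
    exact ⟨image_eq_zero_of_notMem_tsupport h1, Function.notMem_support.1 fun h =>
      h1 (support_fderiv_subset ℝ h)⟩
  let eL := (EuclideanSpace.equiv (Fin (m + 1)) ℝ).symm
  have hle : (fun _ : Fin (m + 1) => -r) ≤ fun _ => r := fun _ => by dsimp only; linarith
  have hmp := PiLp.volume_preserving_toLp (Fin (m + 1))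
  have hme : MeasurableEmbedding (WithLp.toLp 2 : (Fin (m + 1) → ℝ) → _) :=
    (MeasurableEquiv.toLp 2 (Fin (m + 1) → ℝ)).measurableEmbedding
  have hnorm : ∀ (y : Fin (m + 1) → ℝ) i, |y i| ≤ ‖WithLp.toLp 2 y‖ := fun y i =>
    PiLp.norm_apply_le (WithLp.toLp 2 y) i
  have hdiv := integral_divergence_of_hasFDerivAt_off_countable' (fun _ : Fin (m + 1) => -r)
    (fun _ => r) hle (fun i y => X i (WithLp.toLp 2 y))
    (fun i y => (fderiv ℝ (X i) (WithLp.toLp 2 y)).comp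
      (eL : (Fin (m + 1) → ℝ) →L[ℝ] EuclideanSpace ℝ (Fin (m + 1)))) ∅ countable_empty
    (fun i => ((hX i).continuous.comp eL.continuous).continuousOn)
    (fun y _ i => ((hX i) _).hasFDerivAt.comp y eL.hasFDerivAt)
    ((hmp.integrable_comp_emb hme).2 hi).integrableOn
  have hface : ∀ (i : Fin (m + 1)) (c : ℝ) (y : Fin m → ℝ), |c| = r →
      X i (WithLp.toLp 2 (i.insertNth c y)) = 0 := fun i c y h => by
    refine (hr i _ ?_).1
    simpa [h] using hnorm (i.insertNth c y) i
  simp only [hface _ r _ (abs_of_pos hr0), hface _ (-r) _ ((abs_neg r).trans (abs_of_pos hr0)),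
    integral_zero, sub_zero, Finset.sum_const_zero] at hdiv
  rw [← hmp.integral_comp hme, ← hdiv]
  refine (setIntegral_eq_integral_of_forall_compl_eq_zero fun y hy => ?_).symm
  refine Finset.sum_eq_zero fun i _ => ?_
  have : ∃ j, r < |y j| := by
    by_contra! h
    exact hy ⟨fun j => (abs_le.1 (h j)).1, fun j => (abs_le.1 (h j)).2⟩
  obtain ⟨j, hj⟩ := this
  rw [(hr i _ (hj.le.trans (hnorm y j))).2]
  rfl

section Symmetry

variable {E : Type*} [NormedAddCommGroup E] [InnerProductSpace ℝ E] [FiniteDimensional ℝ E]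
  [MeasurableSpace E] [BorelSpace E]

lemma integral_fderiv_mul_fderiv_comm {ψ u : E → ℝ} (hψ : ContDiff ℝ 1 ψ)
    (hψc : HasCompactSupport ψ) (hu : ContDiff ℝ 1 u) (huc : HasCompactSupport u) (v w : E) :
    ∫ x, fderiv ℝ ψ x v * fderiv ℝ u x w = ∫ x, fderiv ℝ ψ x w * fderiv ℝ u x v := by
  have hu1 : Continuous fun x => fderiv ℝ u x w :=
    (hu.continuous_fderiv one_ne_zero).clm_apply continuous_const
  have hψ1 : Continuous fun x => fderiv ℝ ψ x w :=
    (hψ.continuous_fderiv one_ne_zero).clm_apply continuous_const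
  have hu1c : HasCompactSupport fun x => fderiv ℝ u x w := huc.fderiv_apply ℝ w
  have hψ1c : HasCompactSupport fun x => fderiv ℝ ψ x w := hψc.fderiv_apply ℝ w
  have d1 := hasDerivAt_integral_translate_sub_mul hψ hψc
    (hu1.integrable_of_hasCompactSupport hu1c) v
  have d2 := hasDerivAt_integral_translate_sub_mul hu huc
    (hψ1.integrable_of_hasCompactSupport hψ1c) (-v)
  have key : ∀ t : ℝ, ∫ x, (ψ (x + t • v) - ψ x) * fderiv ℝ u x w =
      -∫ x, (u (x + t • -v) - u x) * fderiv ℝ ψ x w := by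
    intro t
    have hu0 := hu.continuous
    have hψ0 := hψ.continuous
    have hτ : ContDiff ℝ 1 fun x => ψ (x + t • v) := hψ.comp (contDiff_id.add contDiff_const)
    have hτc : HasCompactSupport fun x => ψ (x + t • v) :=
      hψc.comp_homeomorph (Homeomorph.addRight (t • v))
    have hτd : ∀ x, fderiv ℝ (fun x => ψ (x + t • v)) x w = fderiv ℝ ψ (x + t • v) w := fun x => by
      rw [fderiv_comp_add_right]
    have parts : ∀ {χ : E → ℝ}, ContDiff ℝ 1 χ → HasCompactSupport χ →
        ∫ x, χ x * fderiv ℝ u x w = -∫ x, fderiv ℝ χ x w * u x := by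
      intro χ hχ hχc
      have hχ0 := hχ.continuous
      have hχ1 : Continuous fun x => fderiv ℝ χ x w :=
        (hχ.continuous_fderiv one_ne_zero).clm_apply continuous_const
      exact integral_mul_fderiv_eq_neg_fderiv_mul_of_integrable
        ((hχ1.mul hu0).integrable_of_hasCompactSupport huc.mul_left)
        ((hχ0.mul hu1).integrable_of_hasCompactSupport hχc.mul_right)
        ((hχ0.mul hu0).integrable_of_hasCompactSupport hχc.mul_right)
        (fun x _ => hχ.differentiable one_ne_zero x) (fun x _ => hu.differentiable one_ne_zero x)
    have hu' : Continuous fun x => u (x + t • -v) := by fun_prop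
    have hψ' : Continuous fun x => ψ (x + t • v) := by fun_prop
    have i1 : Integrable fun x => ψ (x + t • v) * fderiv ℝ u x w :=
      (hψ'.mul hu1).integrable_of_hasCompactSupport hu1c.mul_left
    have i2 : Integrable fun x => ψ x * fderiv ℝ u x w :=
      (hψ0.mul hu1).integrable_of_hasCompactSupport hu1c.mul_left
    have i3 : Integrable fun x => u (x + t • -v) * fderiv ℝ ψ x w :=
      (hu'.mul hψ1).integrable_of_hasCompactSupport hψ1c.mul_left
    have i4 : Integrable fun x => u x * fderiv ℝ ψ x w :=
      (hu0.mul hψ1).integrable_of_hasCompactSupport hψ1c.mul_left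
    simp only [sub_mul]
    rw [integral_sub i1 i2, integral_sub i3 i4, parts hτ hτc, parts hψ hψc]
    have e1 : ∫ x, fderiv ℝ (fun x => ψ (x + t • v)) x w * u x =
        ∫ x, u (x + t • -v) * fderiv ℝ ψ x w := by
      rw [← integral_add_right_eq_self (fun x => u (x + t • -v) * fderiv ℝ ψ x w) (t • v)]
      refine integral_congr_ae (Filter.Eventually.of_forall fun x => ?_)
      simp only [hτd]
      rw [smul_neg, add_neg_cancel_right, mul_comm]
    rw [e1]
    simp only [mul_comm (fderiv ℝ ψ _ w)]
    ring
  rw [funext key] at d1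
  have h := d1.unique d2.fun_neg
  rw [h, ← integral_neg]
  refine integral_congr_ae (Filter.Eventually.of_forall fun x => ?_)
  simp only [map_neg]
  ring

end Symmetry

section Clifford

variable {m : ℕ} {V : Type*} [NormedAddCommGroup V] [NormedSpace ℝ V]

lemma sum_integral_fderiv_mul_fderiv_clifford {ι : Type*} [Fintype ι] [DecidableEq ι]
    {E : Type*} [NormedAddCommGroup E] [InnerProductSpace ℝ E] [FiniteDimensional ℝ E]
    [MeasurableSpace E] [BorelSpace E] (b : OrthonormalBasis ι ℝ E)
    {Γ : ι → V →L[ℝ] V}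
    (hΓ : ∀ i j v, Γ i (Γ j v) + Γ j (Γ i v) = if i = j then (-2 : ℝ) • v else 0)
    {φ : E → V} (hφ : ContDiff ℝ 1 φ) (hφc : HasCompactSupport φ) (L : V →L[ℝ] ℝ)
    {ψ : E → ℝ} (hψ : ContDiff ℝ 1 ψ) (hψc : HasCompactSupport ψ) :
    ∑ j, ∑ i, ∫ x, fderiv ℝ ψ x (b j) * L (Γ j (Γ i (fderiv ℝ φ x (b i)))) =
      -∫ x, fderiv ℝ ψ x (gradient (fun x => L (φ x)) x) := by
  have hd : ∀ (T : V →L[ℝ] ℝ) x v, fderiv ℝ (fun x => T (φ x)) x v = T (fderiv ℝ φ x v) := by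
    intro T x v
    have := T.hasFDerivAt.comp x (hφ.differentiable one_ne_zero x).hasFDerivAt
    exact congrArg (· v) this.fderiv
  have hi : ∀ (T : V →L[ℝ] ℝ) v w, Integrable fun x => fderiv ℝ ψ x v * T (fderiv ℝ φ x w) := by
    intro T v w
    have h1 : Continuous fun x => fderiv ℝ ψ x v :=
      (hψ.continuous_fderiv one_ne_zero).clm_apply continuous_const
    have h2 : Continuous fun x => fderiv ℝ φ x w :=
      (hφ.continuous_fderiv one_ne_zero).clm_apply continuous_const
    exact (h1.mul (T.continuous.comp h2)).integrable_of_hasCompactSupport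
      (hψc.fderiv_apply ℝ v).mul_right
  have hsymm : ∀ (T : V →L[ℝ] ℝ) v w, ∫ x, fderiv ℝ ψ x v * T (fderiv ℝ φ x w) =
      ∫ x, fderiv ℝ ψ x w * T (fderiv ℝ φ x v) := by
    intro T v w
    have := integral_fderiv_mul_fderiv_comm hψ hψc (u := fun x => T (φ x))
      (T.contDiff.comp hφ) (hφc.comp_left (g := T) (map_zero T)) v w
    simpa only [hd] using this
  have hij : ∀ i j, (∫ x, fderiv ℝ ψ x (b j) * L (Γ j (Γ i (fderiv ℝ φ x (b i))))) +
      (∫ x, fderiv ℝ ψ x (b i) * L (Γ i (Γ j (fderiv ℝ φ x (b j))))) =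
      if i = j then -2 * ∫ x, fderiv ℝ ψ x (b i) * L (fderiv ℝ φ x (b i)) else 0 := by
    intro i j
    have s1 := hsymm (L.comp ((Γ i).comp (Γ j))) (b i) (b j)
    have i1 := hi (L.comp ((Γ j).comp (Γ i))) (b j) (b i)
    have i2 := hi (L.comp ((Γ i).comp (Γ j))) (b j) (b i)
    simp only [ContinuousLinearMap.comp_apply] at s1 i1 i2
    rw [s1, ← integral_add i1 i2]
    have : ∀ x, fderiv ℝ ψ x (b j) * L (Γ j (Γ i (fderiv ℝ φ x (b i)))) +
        fderiv ℝ ψ x (b j) * L (Γ i (Γ j (fderiv ℝ φ x (b i)))) =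
        if i = j then -2 * (fderiv ℝ ψ x (b i) * L (fderiv ℝ φ x (b i))) else 0 := by
      intro x
      rw [← mul_add, ← map_add, hΓ]
      rcases eq_or_ne i j with rfl | h
      · rw [if_pos rfl, if_pos rfl, map_smul, smul_eq_mul]
        ring
      · rw [if_neg h, if_neg h.symm, map_zero, mul_zero]
    simp only [this]
    split_ifs
    · rw [integral_const_mul]
    · simp
  have hsum : ∑ j, ∑ i, ((∫ x, fderiv ℝ ψ x (b j) * L (Γ j (Γ i (fderiv ℝ φ x (b i))))) +
      (∫ x, fderiv ℝ ψ x (b i) * L (Γ i (Γ j (fderiv ℝ φ x (b j)))))) =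
      -2 * ∑ i, ∫ x, fderiv ℝ ψ x (b i) * L (fderiv ℝ φ x (b i)) := by
    simp only [hij, Finset.sum_ite_eq', Finset.mem_univ, if_true, Finset.mul_sum]
  simp only [Finset.sum_add_distrib] at hsum
  rw [Finset.sum_comm (f := fun j i => ∫ x, fderiv ℝ ψ x (b i) *
    L (Γ i (Γ j (fderiv ℝ φ x (b j)))))] at hsum
  have hgrad : ∫ x, fderiv ℝ ψ x (gradient (fun x => L (φ x)) x) =
      ∑ i, ∫ x, fderiv ℝ ψ x (b i) * L (fderiv ℝ φ x (b i)) := by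
    rw [← integral_finsetSum _ fun i _ => hi L (b i) (b i)]
    refine integral_congr_ae (Filter.Eventually.of_forall fun x => ?_)
    simp only
    conv_lhs => rw [← b.sum_repr (gradient (fun x => L (φ x)) x), map_sum]
    refine Finset.sum_congr rfl fun i _ => ?_
    rw [map_smul, smul_eq_mul, b.repr_apply_apply, real_inner_comm, inner_gradient_left, hd,
      mul_comm]
  rw [hgrad]
  linarith

theorem isWeakSolution_of_dirac {Γ : Fin (m + 1) → V →L[ℝ] V}
    (hΓ : ∀ i j v, Γ i (Γ j v) + Γ j (Γ i v) = if i = j then (-2 : ℝ) • v else 0)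
    {φ g : EuclideanSpace ℝ (Fin (m + 1)) → V} (hφ : ContDiff ℝ 1 φ) (hφc : HasCompactSupport φ)
    {R : ℝ} (hg : ∀ x ∈ Metric.ball (0 : EuclideanSpace ℝ (Fin (m + 1))) R, DifferentiableAt ℝ g x)
    (hgφ : ∀ x ∈ Metric.ball (0 : EuclideanSpace ℝ (Fin (m + 1))) R,
      g x = ∑ i, Γ i (fderiv ℝ φ x (EuclideanSpace.single i 1)))
    (L : V →L[ℝ] ℝ) {F : EuclideanSpace ℝ (Fin (m + 1)) → ℝ} (hFi : Integrable F)
    (hF : ∀ x ∈ Metric.ball (0 : EuclideanSpace ℝ (Fin (m + 1))) R,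
      F x = -L (∑ i, Γ i (fderiv ℝ g x (EuclideanSpace.single i 1)))) :
    IsWeakSolution R (fun x => L (φ x)) F := by
  intro ψ hψ hψc hψs
  have hX0 : ∀ x, x ∉ tsupport ψ → ∀ j, (fun x => ψ x * L (Γ j (g x))) =ᶠ[nhds x] fun _ => 0 := by
    intro x hx j
    filter_upwards [notMem_tsupport_iff_eventuallyEq.1 hx] with y hy
    simp [hy]
  have hXd : ∀ x ∈ Metric.ball (0 : EuclideanSpace ℝ (Fin (m + 1))) R, ∀ j,
      HasFDerivAt (fun x => ψ x * L (Γ j (g x)))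
        (ψ x • (L.comp ((Γ j).comp (fderiv ℝ g x))) + L (Γ j (g x)) • fderiv ℝ ψ x) x :=
    fun x hx j => (hψ.differentiable one_ne_zero x).hasFDerivAt.fun_mul
      (L.hasFDerivAt.comp x ((Γ j).hasFDerivAt.comp x (hg x hx).hasFDerivAt))
  have hdiv : ∀ x, ∑ j, fderiv ℝ (fun x => ψ x * L (Γ j (g x))) x (EuclideanSpace.single j 1) =
      (∑ j, ∑ i, fderiv ℝ ψ x (EuclideanSpace.single j 1) *
        L (Γ j (Γ i (fderiv ℝ φ x (EuclideanSpace.single i 1))))) - ψ x * F x := by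
    intro x
    by_cases hx : x ∈ tsupport ψ
    · rw [hF x (hψs hx), mul_neg, sub_neg_eq_add, map_sum, Finset.mul_sum,
        ← Finset.sum_add_distrib]
      refine Finset.sum_congr rfl fun j _ => ?_
      rw [(hXd x (hψs hx) j).fderiv, hgφ x (hψs hx)]
      simp only [add_apply, smul_apply, smul_eq_mul, ContinuousLinearMap.comp_apply, map_sum,
        Finset.sum_mul]
      rw [add_comm]
      congr 1
      exact Finset.sum_congr rfl fun i _ => mul_comm _ _
    · have h1 : fderiv ℝ ψ x = 0 := Function.notMem_support.1 fun h =>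
        hx (support_fderiv_subset ℝ h)
      rw [image_eq_zero_of_notMem_tsupport hx, h1]
      simp [(hX0 x hx _).fderiv_eq]
  have i1 : ∀ j i, Integrable fun x => fderiv ℝ ψ x (EuclideanSpace.single j 1) *
        L (Γ j (Γ i (fderiv ℝ φ x (EuclideanSpace.single i 1)))) := by
    intro j i
    have h1 : Continuous fun x => fderiv ℝ ψ x (EuclideanSpace.single j 1) :=
      (hψ.continuous_fderiv one_ne_zero).clm_apply continuous_const
    have h2 : Continuous fun x => fderiv ℝ φ x (EuclideanSpace.single i 1) :=
      (hφ.continuous_fderiv one_ne_zero).clm_apply continuous_const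
    exact (h1.mul (by fun_prop)).integrable_of_hasCompactSupport
      (hψc.fderiv_apply ℝ _).mul_right
  have i2 : Integrable fun x => ψ x * F x := by
    have h1 := hψ.continuous
    obtain ⟨K, hK⟩ := hψc.exists_bound_of_continuous h1
    exact hFi.bdd_mul (by fun_prop) (Filter.Eventually.of_forall hK)
  have i3 : Integrable fun x => ∑ j, ∑ i, fderiv ℝ ψ x (EuclideanSpace.single j 1) *
        L (Γ j (Γ i (fderiv ℝ φ x (EuclideanSpace.single i 1)))) :=
    integrable_finsetSum _ fun j _ => integrable_finsetSum _ fun i _ => i1 j i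
  have hzero := integral_sum_fderiv_single_eq_zero (X := fun j x => ψ x * L (Γ j (g x)))
    (fun j x => by
      by_cases hx : x ∈ tsupport ψ
      · exact (hXd x (hψs hx) j).differentiableAt
      · exact (hX0 x hx j).differentiableAt_iff.2 (differentiableAt_const 0))
    (fun j => hψc.mul_right) (by simp only [hdiv]; exact i3.sub i2)
  simp only [hdiv] at hzero
  rw [integral_sub i3 i2, integral_finsetSum _ fun j _ => integrable_finsetSum _ fun i _ => i1 j i]
    at hzero
  simp only [integral_finsetSum _ fun i _ => i1 _ i] at hzero
  have hcl := sum_integral_fderiv_mul_fderiv_clifford (EuclideanSpace.basisFun (Fin (m + 1)) ℝ)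
    hΓ hφ hφc L hψ hψc
  simp only [EuclideanSpace.basisFun_apply] at hcl
  rw [hcl] at hzero
  linarith

end Clifford

/-- `Dφ = g` on the ball of radius `R` for the Dirac operator with Clifford multiplication `Γ`,
where `φ` vanishes at the origin and `Dg` is controlled by `φ` and its derivative. -/
structure IsDiracSolution {n : ℕ} {V : Type*} [NormedAddCommGroup V] [NormedSpace ℝ V]
    (Γ : Fin n → V →L[ℝ] V) (τ C M R : ℝ) (φ g : EuclideanSpace ℝ (Fin n) → V) : Prop where
  contDiffOn : ContDiffOn ℝ 1 φ (Metric.ball 0 R)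
  norm_le : ∀ x ∈ Metric.ball 0 R, ‖φ x‖ ≤ M
  norm_fderiv_le : ∀ x ∈ Metric.ball 0 R, ‖fderiv ℝ φ x‖ ≤ M
  map_zero : φ 0 = 0
  eq_sum : ∀ x ∈ Metric.ball 0 R, g x = ∑ i, Γ i (fderiv ℝ φ x (EuclideanSpace.single i 1))
  differentiableAt : ∀ x ∈ Metric.ball 0 R, DifferentiableAt ℝ g x
  norm_sum_le : ∀ x ∈ Metric.ball 0 R, ‖∑ i, Γ i (fderiv ℝ g x (EuclideanSpace.single i 1))‖ ≤
    C * (‖φ x‖ + ‖φ x‖ ^ τ * ‖fderiv ℝ φ x‖)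

lemma exists_contDiff_hasCompactSupport_eqOn_ball {E V : Type*} [NormedAddCommGroup E]
    [InnerProductSpace ℝ E] [FiniteDimensional ℝ E] [NormedAddCommGroup V] [NormedSpace ℝ V]
    {φ : E → V} {ρ R : ℝ} (hφ : ContDiffOn ℝ 1 φ (Metric.ball 0 R)) (hρ0 : 0 < ρ) (hρ : ρ < R) :
    ∃ φ' : E → V, ContDiff ℝ 1 φ' ∧ HasCompactSupport φ' ∧ EqOn φ' φ (Metric.ball 0 ρ) := by
  let χ : ContDiffBump (0 : E) := ⟨ρ, (ρ + R) / 2, hρ0, by linarith⟩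
  refine ⟨fun x => χ x • φ x, ?_, χ.hasCompactSupport.smul_right, fun x hx => ?_⟩
  · refine contDiff_iff_contDiffAt.2 fun x => ?_
    by_cases hx : x ∈ Metric.ball (0 : E) R
    · exact χ.contDiff.contDiffAt.smul (hφ.contDiffAt (Metric.isOpen_ball.mem_nhds hx))
    · have h1 : x ∉ tsupport χ := fun h => hx (by
        rw [χ.tsupport_eq] at h
        refine Metric.closedBall_subset_ball ?_ h
        change (ρ + R) / 2 < R
        linarith)
      refine (contDiffAt_const (c := (0 : V))).congr_of_eventuallyEq ?_
      filter_upwards [notMem_tsupport_iff_eventuallyEq.1 h1] with y hy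
      simp [hy]
  · simp only
    rw [χ.one_of_mem_closedBall (Metric.ball_subset_closedBall hx), one_smul]

namespace IsDiracSolution

variable {m : ℕ} {V : Type*} [NormedAddCommGroup V] [NormedSpace ℝ V]
  {Γ : Fin (m + 1) → V →L[ℝ] V} {τ C M R ρ : ℝ} {φ g : EuclideanSpace ℝ (Fin (m + 1)) → V}

lemma norm_le_mul (H : IsDiracSolution Γ τ C M R φ g)
    {x : EuclideanSpace ℝ (Fin (m + 1))} (hx : x ∈ Metric.ball 0 R) : ‖φ x‖ ≤ M * ‖x‖ := by
  have h0 : (0 : EuclideanSpace ℝ (Fin (m + 1))) ∈ Metric.ball 0 R :=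
    Metric.mem_ball_self (dist_nonneg.trans_lt hx)
  have := (convex_ball (0 : EuclideanSpace ℝ (Fin (m + 1))) R).norm_image_sub_le_of_norm_fderiv_le
    (𝕜 := ℝ) (fun y hy => (H.contDiffOn.contDiffAt
      (Metric.isOpen_ball.mem_nhds hy)).differentiableAt one_ne_zero) H.norm_fderiv_le h0 hx
  simpa [H.map_zero] using this

lemma continuous_sphere (H : IsDiracSolution Γ τ C M R φ g) {t : ℝ} (ht : t ∈ Ico 0 R) :
    Continuous fun w : Metric.sphere (0 : EuclideanSpace ℝ (Fin (m + 1))) 1 => φ (t • (w : _)) := by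
  refine H.contDiffOn.continuousOn.comp_continuous (by fun_prop) fun w => ?_
  rw [mem_ball_zero_iff, norm_smul, norm_eq_of_mem_sphere w, mul_one, Real.norm_of_nonneg ht.1]
  exact ht.2

lemma dirIntegral_eq_zero_iff (H : IsDiracSolution Γ τ C M R φ g) {t : ℝ} (ht : t ∈ Ico 0 R) :
    dirIntegral (fun x _ => ‖φ x‖ ^ 2) t = 0 ↔ ∀ x, ‖x‖ = t → φ x = 0 := by
  have hc : Continuous fun w : Metric.sphere (0 : EuclideanSpace ℝ (Fin (m + 1))) 1 =>
    ‖φ (t • (w : EuclideanSpace ℝ (Fin (m + 1))))‖ ^ 2 := (H.continuous_sphere ht).norm.pow 2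
  have hi := hc.integrable_of_hasCompactSupport (μ := (volume : Measure (EuclideanSpace ℝ
    (Fin (m + 1)))).toSphere) (HasCompactSupport.of_compactSpace _)
  constructor
  · intro h x hx
    rcases ht.1.eq_or_lt with h0 | h0
    · rw [← h0, norm_eq_zero] at hx
      rw [hx, H.map_zero]
    have h1 := (integral_eq_zero_iff_of_nonneg (fun w => sq_nonneg _) hi).1 h
    have h2 := (Continuous.ae_eq_iff_eq _ hc continuous_const).1 h1
    have h3 : ‖φ (t • (t⁻¹ • x))‖ ^ 2 = 0 := congrFun h2 ⟨t⁻¹ • x, by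
      rw [mem_sphere_zero_iff_norm, norm_smul, hx, norm_inv, Real.norm_of_nonneg ht.1,
        inv_mul_cancel₀ h0.ne']⟩
    rwa [smul_smul, mul_inv_cancel₀ h0.ne', one_smul, sq_eq_zero_iff, norm_eq_zero] at h3
  · intro h
    refine integral_eq_zero_of_ae (Filter.Eventually.of_forall fun w => ?_)
    simp [h (t • (w : EuclideanSpace ℝ (Fin (m + 1)))) (by
      rw [norm_smul, norm_eq_of_mem_sphere w, mul_one, Real.norm_of_nonneg ht.1])]

lemma translate (H : IsDiracSolution Γ τ C M R φ g) {y : EuclideanSpace ℝ (Fin (m + 1))}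
    (hy : φ y = 0) :
    IsDiracSolution Γ τ C M (R - ‖y‖) (fun x => φ (y + x)) (fun x => g (y + x)) := by
  have hmem : ∀ x ∈ Metric.ball (0 : EuclideanSpace ℝ (Fin (m + 1))) (R - ‖y‖),
      y + x ∈ Metric.ball (0 : EuclideanSpace ℝ (Fin (m + 1))) R := by
    intro x hx
    rw [mem_ball_zero_iff] at hx ⊢
    linarith [norm_add_le y x]
  refine ⟨H.contDiffOn.comp (contDiff_const.add contDiff_id).contDiffOn hmem,
    fun x hx => H.norm_le _ (hmem x hx), fun x hx => ?_, by simpa using hy, fun x hx => ?_,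
    fun x hx => ?_, fun x hx => ?_⟩
  · rw [fderiv_comp_add_left]
    exact H.norm_fderiv_le _ (hmem x hx)
  · simp only [fderiv_comp_add_left]
    exact H.eq_sum _ (hmem x hx)
  · exact (H.differentiableAt _ (hmem x hx)).comp x (by fun_prop)
  · simp only [fderiv_comp_add_left]
    exact H.norm_sum_le _ (hmem x hx)

variable [CompleteSpace V] {ι : Type*} [Fintype ι] {L : ι → V →L[ℝ] ℝ}

theorem exists_isRadialProfile (H : IsDiracSolution Γ τ C M R φ g)
    (hΓ : ∀ i j v, Γ i (Γ j v) + Γ j (Γ i v) = if i = j then (-2 : ℝ) • v else 0)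
    (hL : ∀ v, ∑ a, L a v ^ 2 = ‖v‖ ^ 2) (hτ : 0 < τ) (hC : 0 < C) (hM : 0 < M)
    (hρ0 : 0 < ρ) (hρ : ρ < R) :
    ∃ h p e q k l : ℝ → ℝ,
      IsRadialProfile (m + 1) τ (Fintype.card ι * (C * (1 + M ^ τ))) ρ h p e q k l ∧
      ∀ t ∈ Ioo 0 ρ,
        h t = dirIntegral (fun x _ => ‖φ x‖ ^ 2) t ∧
        p t = dirIntegral (fun x w => ∑ a, L a (φ x) * L a (fderiv ℝ φ x w)) t := by
  let _ : MeasurableSpace V := borel V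
  have _ : BorelSpace V := ⟨rfl⟩
  obtain ⟨φ', hφ', hφc, heq⟩ := exists_contDiff_hasCompactSupport_eqOn_ball H.contDiffOn hρ0 hρ
  have hsub : Metric.ball (0 : EuclideanSpace ℝ (Fin (m + 1))) ρ ⊆ Metric.ball 0 R :=
    Metric.ball_subset_ball hρ.le
  have hfd : ∀ x ∈ Metric.ball (0 : EuclideanSpace ℝ (Fin (m + 1))) ρ,
      fderiv ℝ φ' x = fderiv ℝ φ x := fun x hx =>
    (heq.eventuallyEq_of_mem (Metric.isOpen_ball.mem_nhds hx)).fderiv_eq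
  have hd : ∀ (T : V →L[ℝ] ℝ) x v, fderiv ℝ (fun x => T (φ' x)) x v = T (fderiv ℝ φ' x v) := by
    intro T x v
    have := T.hasFDerivAt.comp x (hφ'.differentiable one_ne_zero x).hasFDerivAt
    exact congrArg (· v) this.fderiv
  have hLn : ∀ a v, |L a v| ≤ ‖v‖ := fun a v => by
    refine abs_le_of_sq_le_sq ?_ (norm_nonneg v)
    rw [← hL]
    exact Finset.single_le_sum (f := fun b => L b v ^ 2) (fun b _ => sq_nonneg _)
      (Finset.mem_univ a)
  set B := Metric.ball (0 : EuclideanSpace ℝ (Fin (m + 1))) ρ with hBdef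
  let G : EuclideanSpace ℝ (Fin (m + 1)) → V :=
    fun x => ∑ i, Γ i (fderiv ℝ g x (EuclideanSpace.single i 1))
  let F : ι → EuclideanSpace ℝ (Fin (m + 1)) → ℝ := fun a => B.indicator fun x => -L a (G x)
  have hFB : ∀ a, ∀ x ∈ B, F a x = -L a (G x) := fun a x hx => indicator_of_mem hx _
  have hGm : ∀ a, Measurable fun x => -L a (G x) := by
    intro a
    simp only [G, map_sum]
    exact (Finset.measurable_fun_sum _ fun i _ =>
      ((L a).comp (Γ i)).measurable.comp (measurable_fderiv_apply_const ℝ g _)).neg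
  have hFm : ∀ a, Measurable (F a) := fun a => (hGm a).indicator Metric.isOpen_ball.measurableSet
  have hFb : ∀ a, ∀ x ∈ B, |F a x| ≤ C * (‖φ x‖ + ‖φ x‖ ^ τ * ‖fderiv ℝ φ x‖) := by
    intro a x hx
    rw [hFB a x hx, abs_neg]
    exact (hLn a _).trans (H.norm_sum_le x (hsub hx))
  have hK : ∀ a x, |F a x| ≤ C * (M + M ^ τ * M) := by
    intro a x
    by_cases hx : x ∈ B
    · refine (hFb a x hx).trans ?_
      have := H.norm_le x (hsub hx)
      have := H.norm_fderiv_le x (hsub hx)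
      gcongr
    · rw [show F a x = 0 from indicator_of_notMem hx _, abs_zero]
      positivity
  have hFi : ∀ a, Integrable (F a) := by
    intro a
    rw [integrable_indicator_iff Metric.isOpen_ball.measurableSet]
    refine Measure.integrableOn_of_bounded (M := C * (M + M ^ τ * M)) measure_ball_lt_top.ne
      (hGm a).aestronglyMeasurable ?_
    refine (ae_restrict_iff' Metric.isOpen_ball.measurableSet).2
      (Filter.Eventually.of_forall fun x hx => ?_)
    rw [← hFB a x hx]
    exact hK a x
  have hU : ∀ x ∈ B, √(∑ b, L b (φ' x) ^ 2) = ‖φ x‖ := fun x hx => by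
    rw [hL, heq hx, Real.sqrt_sq (norm_nonneg _)]
  have hGr : ∀ x ∈ B, ‖fderiv ℝ φ x‖ ≤ √(∑ b, ‖gradient (fun x => L b (φ' x)) x‖ ^ 2) := by
    intro x hx
    refine ContinuousLinearMap.opNorm_le_bound _ (Real.sqrt_nonneg _) fun v => ?_
    refine abs_le_of_sq_le_sq' ?_ (by positivity) |>.2
    rw [mul_pow, Real.sq_sqrt (Finset.sum_nonneg fun b _ => sq_nonneg _), ← hL, ← hfd x hx,
      Finset.sum_mul]
    refine Finset.sum_le_sum fun b _ => ?_
    rw [← hd, ← inner_gradient_left, ← mul_pow, ← sq_abs]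
    gcongr
    exact abs_real_inner_le_norm _ _
  have hprof := IsWeakSolution.isRadialProfile (R := ρ) (u := fun a x => L a (φ' x)) (F := F)
    (τ := τ) (C₀ := C * (1 + M ^ τ)) (K := C * (M + M ^ τ * M)) (m := m)
    (fun a => isWeakSolution_of_dirac hΓ hφ' hφc (g := g)
      (fun x hx => H.differentiableAt x (hsub hx))
      (fun x hx => by rw [H.eq_sum x (hsub hx), hfd x hx]) (L a) (hFi a) (hFB a))
    (fun a => (L a).contDiff.comp hφ') (fun a => hφc.comp_left (g := L a) (_root_.map_zero (L a)))
    hFm hFi hK (by positivity) (by simp) (fun a x hx => by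
      rw [hU x hx]
      refine (hFb a x hx).trans ?_
      have h1 : ‖φ x‖ ^ τ ≤ M ^ τ * ‖x‖ ^ τ := by
        rw [← Real.mul_rpow hM.le (norm_nonneg x)]
        exact Real.rpow_le_rpow (norm_nonneg _) (H.norm_le_mul (hsub hx)) hτ.le
      have h2 := mul_le_mul h1 (hGr x hx) (norm_nonneg _) (by positivity)
      have h3 : 0 ≤ M ^ τ := by positivity
      have h4 : 0 ≤ ‖x‖ ^ τ * √(∑ b, ‖gradient (fun x => L b (φ' x)) x‖ ^ 2) := by positivity
      rw [mul_assoc]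
      refine mul_le_mul_of_nonneg_left ?_ hC.le
      nlinarith [mul_nonneg h3 (norm_nonneg (φ x))])
  refine ⟨_, _, _, _, _, _, hprof, fun t ht => ?_⟩
  have hmem : ∀ w : Metric.sphere (0 : EuclideanSpace ℝ (Fin (m + 1))) 1, 
      t • (w : EuclideanSpace ℝ (Fin (m + 1))) ∈ B := by
    intro w
    rw [hBdef, mem_ball_zero_iff, norm_smul, norm_eq_of_mem_sphere w, mul_one,
      Real.norm_of_nonneg ht.1.le]
    exact ht.2
  refine ⟨integral_congr_ae (Filter.Eventually.of_forall fun w => ?_),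
    integral_congr_ae (Filter.Eventually.of_forall fun w => ?_)⟩
  · simp only
    rw [hL, heq (hmem w)]
  · simp only [hd]
    rw [heq (hmem w), hfd _ (hmem w)]

variable [Nonempty ι]

theorem eq_zero_or_monotoneOn_frequency (H : IsDiracSolution Γ τ C M R φ g)
    (hΓ : ∀ i j v, Γ i (Γ j v) + Γ j (Γ i v) = if i = j then (-2 : ℝ) • v else 0)
    (hL : ∀ v, ∑ a, L a v ^ 2 = ‖v‖ ^ 2) (hm : 3 ≤ m + 1) (hτ : 0 < τ) (hτ1 : τ < 1) (hC : 0 < C)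
    (hM : 0 < M) {c K A : ℝ} (hc : 0 < c) (hK : K = Fintype.card ι * (C * (1 + M ^ τ)))
    (hA : A = K * (14 * (m + 1 : ℕ) + 1) * (1 + 2 / c))
    (hρ0 : 0 < ρ) (hρ : ρ < R) (hρ1 : ρ ≤ 1) (hKρ : 6 * K * ρ ≤ 1) (hKc : 4 * K * ρ ≤ c) :
    (∀ x ∈ Metric.ball 0 ρ, φ x = 0) ∨
    ((∀ t ∈ Ioo 0 ρ, 0 < dirIntegral (fun x _ => ‖φ x‖ ^ 2) t) ∧
      MonotoneOn (fun s => Real.exp (A / (τ + 1) * s ^ (τ + 1)) *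
        (s * dirIntegral (fun x w => ∑ a, L a (φ x) * L a (fderiv ℝ φ x w)) s /
          dirIntegral (fun x _ => ‖φ x‖ ^ 2) s + c)) (Ioo 0 ρ) ∧
      ∃ l, Filter.Tendsto
        (fun s => s * dirIntegral (fun x w => ∑ a, L a (φ x) * L a (fderiv ℝ φ x w)) s /
          dirIntegral (fun x _ => ‖φ x‖ ^ 2) s) (nhdsWithin 0 (Ioi 0)) (nhds l)) := by
  obtain ⟨h, p, e, q, k, l, hprof, hhp⟩ := H.exists_isRadialProfile hΓ hL hτ hC hM hρ0 hρ
  rw [← hK] at hprof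
  have hK0 : 0 < K := by
    have : (0 : ℝ) < Fintype.card ι := by exact_mod_cast Fintype.card_pos
    rw [hK]
    positivity
  rcases hprof.h_pos_or_eq_zero hK0 hm hτ hτ1 hρ1 hc le_rfl hKρ hKc with hpos | hzero
  · refine Or.inr ⟨fun t ht => (hhp t ht).1 ▸ hpos t ht, ?_⟩
    obtain ⟨hmono, l, hl⟩ := hprof.exists_tendsto_freq hK0 hm hτ hτ1 hρ1 hc hρ0 le_rfl hKρ hKc
      hpos hA
    refine ⟨hmono.congr fun t ht => ?_, l, hl.congr' ?_⟩
    · simp only [(hhp t ht).1, (hhp t ht).2]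
    · filter_upwards [Ioo_mem_nhdsGT hρ0] with t ht
      simp only [(hhp t ht).1, (hhp t ht).2]
  · refine Or.inl fun x hx => ?_
    rw [mem_ball_zero_iff] at hx
    rcases (norm_nonneg x).eq_or_lt with h0 | h0
    · rw [norm_eq_zero.1 h0.symm, H.map_zero]
    · exact (H.dirIntegral_eq_zero_iff ⟨h0.le, hx.trans hρ⟩).1
        ((hhp _ ⟨h0, hx⟩).1 ▸ hzero _ ⟨h0, hx⟩) x rfl

/-- Unique continuation. -/
theorem eq_zero_of_eventuallyEq (H : IsDiracSolution Γ τ C M R φ g)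
    (hΓ : ∀ i j v, Γ i (Γ j v) + Γ j (Γ i v) = if i = j then (-2 : ℝ) • v else 0)
    (hL : ∀ v, ∑ a, L a v ^ 2 = ‖v‖ ^ 2) (hm : 3 ≤ m + 1) (hτ : 0 < τ) (hτ1 : τ < 1) (hC : 0 < C)
    (hM : 0 < M) (hR : 0 < R) (h0 : φ =ᶠ[nhds 0] fun _ => 0) {x : EuclideanSpace ℝ (Fin (m + 1))}
    (hx : x ∈ Metric.ball 0 R) : φ x = 0 := by
  set u := {x | φ =ᶠ[nhds x] fun _ => 0} with hu
  refine Filter.EventuallyEq.eq_of_nhds (show φ =ᶠ[nhds x] fun _ => 0 from ?_)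
  refine (convex_ball (0 : EuclideanSpace ℝ (Fin (m + 1))) R).isPreconnected
    |>.subset_of_closure_inter_subset (u := u) isOpen_setOfPred_eventually_nhds
    ⟨0, Metric.mem_ball_self hR, h0⟩ ?_ hx
  rintro z ⟨hzu, hz⟩
  rw [mem_ball_zero_iff] at hz
  obtain ⟨K, hK⟩ : ∃ K : ℝ, K = Fintype.card ι * (C * (1 + M ^ τ)) := ⟨_, rfl⟩
  have hK0 : 0 ≤ K := by
    rw [hK]
    positivity
  have hδ : 0 < R - ‖z‖ := by linarith
  obtain ⟨ρ, hρ0, hρ1, hρz, hKρ⟩ : ∃ ρ : ℝ, 0 < ρ ∧ ρ ≤ 1 ∧ 2 * ρ < R - ‖z‖ ∧ 6 * K * ρ ≤ 1 := by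
    refine ⟨min (min 1 ((R - ‖z‖) / 3)) (1 / (6 * K + 1)), by positivity,
      (min_le_left _ _).trans (min_le_left _ _), ?_, ?_⟩
    · have := (min_le_left (min 1 ((R - ‖z‖) / 3)) (1 / (6 * K + 1))).trans (min_le_right _ _)
      linarith
    · have h1 := min_le_right (min 1 ((R - ‖z‖) / 3)) (1 / (6 * K + 1))
      have h2 := mul_le_mul_of_nonneg_left h1 (show 0 ≤ 6 * K by positivity)
      refine h2.trans ?_
      rw [mul_one_div, div_le_one (by positivity)]
      linarith
  obtain ⟨y, hy, hyz⟩ := Metric.mem_closure_iff.1 hzu ρ hρ0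
  have hy0 : φ y = 0 := hy.eq_of_nhds
  have hyn : ‖y‖ ≤ ‖z‖ + ρ := by
    have := norm_le_norm_add_norm_sub z y
    rw [dist_eq_norm] at hyz
    linarith
  have hT := H.translate hy0
  have hρR : ρ < R - ‖y‖ := by linarith
  have hzero : ∀ x ∈ Metric.ball 0 ρ, φ (y + x) = 0 := by
    refine (hT.eq_zero_or_monotoneOn_frequency hΓ hL hm hτ hτ1 hC hM one_pos hK rfl hρ0 hρR hρ1
      hKρ (by nlinarith)).resolve_right fun hpos => ?_
    obtain ⟨r, hr0, hr⟩ := Metric.eventually_nhds_iff.1 hy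
    have ht : min r ρ / 2 ∈ Ioo 0 ρ := by
      have : 0 < min r ρ := lt_min hr0 hρ0
      constructor
      · positivity
      · linarith [min_le_right r ρ]
    refine (hpos.1 _ ht).ne' ((hT.dirIntegral_eq_zero_iff ⟨ht.1.le, ht.2.trans hρR⟩).2
      fun x hx => hr ?_)
    rw [dist_self_add_left, hx]
    linarith [min_le_left r ρ, lt_min hr0 hρ0]
  filter_upwards [Metric.isOpen_ball.mem_nhds (show z ∈ Metric.ball y ρ from hyz)] with w hw
  have := hzero (w - y) (by simpa [dist_eq_norm] using hw)
  simpa using this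

end IsDiracSolution

section DiracSpinor

/-- Left multiplication by a complex matrix as a real linear map. -/
noncomputable def cliffordMul {N : ℕ} (A : Matrix (Fin N) (Fin N) ℂ) :
    EuclideanSpace ℂ (Fin N) →L[ℝ] EuclideanSpace ℂ (Fin N) :=
  (Matrix.toEuclideanCLM (𝕜 := ℂ) (n := Fin N) A).restrictScalars ℝ

lemma dirac_eq_sum_cliffordMul {n N : ℕ} (γ : Fin n → Matrix (Fin N) (Fin N) ℂ)
    (φ : EuclideanSpace ℝ (Fin n) → EuclideanSpace ℂ (Fin N)) (x : EuclideanSpace ℝ (Fin n)) :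
    dirac γ φ x = ∑ j, cliffordMul (γ j) (fderiv ℝ φ x (EuclideanSpace.single j 1)) :=
  WithLp.toLp_sum _ _ _ _

lemma cliffordMul_add_cliffordMul {n N : ℕ} {γ : Fin n → Matrix (Fin N) (Fin N) ℂ}
    (hγ : ∀ i j, γ i * γ j + γ j * γ i = if i = j then (-2 : ℂ) • 1 else 0) (i j : Fin n)
    (v : EuclideanSpace ℂ (Fin N)) :
    cliffordMul (γ i) (cliffordMul (γ j) v) + cliffordMul (γ j) (cliffordMul (γ i) v) =
      if i = j then (-2 : ℝ) • v else 0 := by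
  have h := congrArg (fun A => Matrix.toEuclideanCLM (𝕜 := ℂ) (n := Fin N) A v) (hγ i j)
  simp only [map_add, map_mul] at h
  refine Eq.trans h ?_
  split_ifs
  · rw [map_smul, map_one]
    ext k
    simp
  · simp

/-- The real and imaginary parts of the coordinates of a spinor. -/
noncomputable def realCoord {N : ℕ} : Fin N ⊕ Fin N → EuclideanSpace ℂ (Fin N) →L[ℝ] ℝ
  | .inl i => Complex.reCLM.comp
      ((EuclideanSpace.proj i : EuclideanSpace ℂ (Fin N) →L[ℂ] ℂ).restrictScalars ℝ)
  | .inr i => Complex.imCLM.comp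
      ((EuclideanSpace.proj i : EuclideanSpace ℂ (Fin N) →L[ℂ] ℂ).restrictScalars ℝ)

lemma re_inner_eq_sum_realCoord {N : ℕ} (v w : EuclideanSpace ℂ (Fin N)) :
    (inner (𝕜 := ℂ) v w).re = ∑ a, realCoord a w * realCoord a v := by
  simp [PiLp.inner_apply, realCoord, Fintype.sum_sum_type, Finset.sum_add_distrib, Complex.mul_re]

lemma sum_realCoord_sq {N : ℕ} (v : EuclideanSpace ℂ (Fin N)) :
    ∑ a, realCoord a v ^ 2 = ‖v‖ ^ 2 := by
  have h := re_inner_eq_sum_realCoord v v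
  simp only [← sq] at h
  rw [← h]
  exact inner_self_eq_norm_sq (𝕜 := ℂ) v

lemma radialDeriv_eq {m N : ℕ} (φ : EuclideanSpace ℝ (Fin (m + 1)) → EuclideanSpace ℂ (Fin N))
    (x : EuclideanSpace ℝ (Fin (m + 1))) : radialDeriv φ x = fderiv ℝ φ x (‖x‖⁻¹ • x) := by
  have h : x = ∑ j, x j • EuclideanSpace.single j (1 : ℝ) := by
    ext k
    simp [Finset.sum_apply, Pi.single_apply]
  conv_rhs => rw [h]
  rw [radialDeriv, ← h, map_smul, h, map_sum, Finset.smul_sum, ← h]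
  refine Finset.sum_congr rfl fun j _ => ?_
  rw [map_smul, smul_smul, div_eq_inv_mul]

/-- The height and the boundary integral in polar coordinates. -/
lemma exists_Hfn_Dfn_eq (m N : ℕ) : ∃ c : ℝ, 0 < c ∧
    ∀ φ : EuclideanSpace ℝ (Fin (m + 1)) → EuclideanSpace ℂ (Fin N),
      ContDiffOn ℝ 1 φ (Metric.ball 0 1) → ∀ s ∈ Ioo (0 : ℝ) 1,
        Hfn φ s = c * s ^ m * dirIntegral (fun x _ => ‖φ x‖ ^ 2) s ∧
        Dfn φ s = c * s ^ m *
          dirIntegral (fun x w => ∑ a, realCoord a (φ x) * realCoord a (fderiv ℝ φ x w)) s := by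
  obtain ⟨c, hc, h⟩ := exists_integral_sphere_eq (E := EuclideanSpace ℝ (Fin (m + 1))) (m := m)
    (by simp)
  have hm : ((m + 1 : ℕ) : ℝ) - 1 = m := by simp
  refine ⟨c, hc, fun φ hφ s hs => ?_⟩
  have hsub : Metric.sphere (0 : EuclideanSpace ℝ (Fin (m + 1))) s ⊆ Metric.ball 0 1 :=
    Metric.sphere_subset_ball hs.2
  have hφc : ContinuousOn φ (Metric.sphere 0 s) := hφ.continuousOn.mono hsub
  have hφd : ContinuousOn (fderiv ℝ φ) (Metric.sphere 0 s) :=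
    (hφ.continuousOn_fderiv_of_isOpen Metric.isOpen_ball le_rfl).mono hsub
  have hne : ∀ x ∈ Metric.sphere (0 : EuclideanSpace ℝ (Fin (m + 1))) s, ‖x‖ ≠ 0 := fun x hx => by
    rw [mem_sphere_zero_iff_norm.1 hx]
    exact hs.1.ne'
  constructor
  · rw [Hfn, hm, h s hs.1 (fun x => ‖φ x‖ ^ 2) (hφc.norm.pow 2)]
    rfl
  · rw [Dfn, hm]
    simp only [radialDeriv_eq]
    rw [h s hs.1 (fun x => (inner (𝕜 := ℂ) (fderiv ℝ φ x (‖x‖⁻¹ • x)) (φ x)).re)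
      (Complex.continuous_re.comp_continuousOn
      ((hφd.clm_apply ((continuousOn_id.norm.inv₀ hne).smul continuousOn_id)).inner hφc))]
    congr 1
    refine integral_congr_ae (Filter.Eventually.of_forall fun w => ?_)
    simp only [re_inner_eq_sum_realCoord]
    rw [norm_smul, norm_eq_of_mem_sphere w, mul_one, Real.norm_of_nonneg hs.1.le, smul_smul,
      inv_mul_cancel₀ hs.1.ne', one_smul]

end DiracSpinor

end FrequencyMonotonicity

/-- Almost monotonicity of the frequency function for `C^{1,α}` solutions of
`Dφ = f(φ)φ`: for every `C_N > 0` there are `β ∈ (0,1)`, `r_am ∈ (0,1)`, `C_am > 0`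
depending only on the structural constants and the `C^{1,α}` bound `M` for `φ` (but not
otherwise on `φ`) such that `H > 0` on `(0, r_am)` and
`s ↦ exp((C_am/(β+1)) s^{β+1}) (N(s)+C_N)` is non-decreasing there; in particular
`N(0⁺)` exists. -/
theorem frequency_almost_monotone {n N : ℕ} (hn : 3 ≤ n) (hN : 1 ≤ N)
    (γ : Fin n → Matrix (Fin N) (Fin N) ℂ)
    (hγ : ∀ i j, γ i * γ j + γ j * γ i = if i = j then (-2 : ℂ) • 1 else 0)
    (α τ : ℝ) (hα : α ∈ Set.Ioo (0 : ℝ) 1) (hτ : τ ∈ Set.Ioo (0 : ℝ) 1)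
    (CL Cf M : ℝ) (hCL : 0 < CL) (hCf : 0 < Cf) (hM : 0 < M)
    (CN : ℝ) (hCN : 0 < CN) :
    ∃ β ∈ Set.Ioo (0 : ℝ) 1, ∃ ram ∈ Set.Ioo (0 : ℝ) 1, ∃ Cam > (0 : ℝ),
      ∀ (φ : EuclideanSpace ℝ (Fin n) → EuclideanSpace ℂ (Fin N))
        (f : EuclideanSpace ℂ (Fin N) → ℝ),
        ContDiffOn ℝ 1 φ (Metric.ball (0 : EuclideanSpace ℝ (Fin n)) 1) →
        HolderOnWith M.toNNReal α.toNNReal (fun x => fderiv ℝ φ x)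
          (Metric.ball (0 : EuclideanSpace ℝ (Fin n)) 1) →
        (∀ x ∈ Metric.ball (0 : EuclideanSpace ℝ (Fin n)) 1,
          ‖φ x‖ ≤ M ∧ ‖fderiv ℝ φ x‖ ≤ M) →
        φ 0 = 0 →
        (∃ x ∈ Metric.ball (0 : EuclideanSpace ℝ (Fin n)) 1, φ x ≠ 0) →
        (∀ x ∈ Metric.ball (0 : EuclideanSpace ℝ (Fin n)) 1,
          dirac γ φ x = f (φ x) • φ x) →
        (∀ x ∈ Metric.ball (0 : EuclideanSpace ℝ (Fin n)) 1, |f (φ x)| ≤ CL) →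
        DifferentiableOn ℝ (fun x => f (φ x) • φ x)
          (Metric.ball (0 : EuclideanSpace ℝ (Fin n)) 1) →
        (∀ x ∈ Metric.ball (0 : EuclideanSpace ℝ (Fin n)) 1,
          ‖dirac γ (fun y => f (φ y) • φ y) x‖ ≤
            Cf * (‖φ x‖ + ‖φ x‖ ^ τ * ‖fderiv ℝ φ x‖)) →
        (∀ s ∈ Set.Ioo (0 : ℝ) ram, 0 < Hfn φ s) ∧
        MonotoneOn
          (fun s => Real.exp ((Cam / (β + 1)) * s ^ (β + 1)) * (freq φ s + CN))
          (Set.Ioo (0 : ℝ) ram) ∧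
        ∃ l : ℝ, Filter.Tendsto (freq φ) (nhdsWithin 0 (Set.Ioi 0)) (nhds l) := by
  obtain ⟨m, rfl⟩ : ∃ m, n = m + 1 := ⟨n - 1, by omega⟩
  have : Nonempty (Fin N) := ⟨⟨0, hN⟩⟩
  have hclifford := cliffordMul_add_cliffordMul hγ
  obtain ⟨c, hc, hHD⟩ := exists_Hfn_Dfn_eq m N
  obtain ⟨K, hK⟩ : ∃ K : ℝ, K = Fintype.card (Fin N ⊕ Fin N) * (Cf * (1 + M ^ τ)) := ⟨_, rfl⟩
  have hK0 : 0 < K := by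
    have : (0 : ℝ) < Fintype.card (Fin N ⊕ Fin N) := by exact_mod_cast Fintype.card_pos
    rw [hK]
    positivity
  obtain ⟨ρ, hρ0, hρ1, hKρ, hKc⟩ : ∃ ρ : ℝ, 0 < ρ ∧ ρ < 1 ∧ 6 * K * ρ ≤ 1 ∧ 4 * K * ρ ≤ CN := by
    refine ⟨min (1 / 2) (min (1 / (6 * K)) (CN / (4 * K))), by positivity,
      (min_le_left _ _).trans_lt (by norm_num), ?_, ?_⟩
    · rw [mul_comm, ← le_div_iff₀ (by positivity)]
      exact (min_le_right _ _).trans (min_le_left _ _)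
    · rw [mul_comm, ← le_div_iff₀ (by positivity)]
      exact (min_le_right _ _).trans (min_le_right _ _)
  refine ⟨τ, hτ, ρ, ⟨hρ0, hρ1⟩, K * (14 * (m + 1 : ℕ) + 1) * (1 + 2 / CN), by positivity, ?_⟩
  rintro φ f hφ - hbound h0 ⟨x, hx, hφx⟩ heq - hdiff hD
  have H : IsDiracSolution (fun j => cliffordMul (γ j)) τ Cf M 1 φ (fun y => f (φ y) • φ y) :=
    ⟨hφ, fun y hy => (hbound y hy).1, fun y hy => (hbound y hy).2, h0,
      fun y hy => by rw [← heq y hy, dirac_eq_sum_cliffordMul],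
      fun y hy => hdiff.differentiableAt (Metric.isOpen_ball.mem_nhds hy),
      fun y hy => by
        rw [← dirac_eq_sum_cliffordMul]
        exact hD y hy⟩
  have hfreq : ∀ s ∈ Set.Ioo 0 ρ,
      s * dirIntegral (fun x w => ∑ a, realCoord a (φ x) * realCoord a (fderiv ℝ φ x w)) s /
        dirIntegral (fun x _ => ‖φ x‖ ^ 2) s = freq φ s := by
    intro s hs
    obtain ⟨hH, hDs⟩ := hHD φ hφ s ⟨hs.1, hs.2.trans hρ1⟩
    have : c * s ^ m ≠ 0 := (mul_pos hc (pow_pos hs.1 m)).ne'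
    rw [freq, hH, hDs, mul_left_comm, mul_div_mul_left _ _ this]
  rcases H.eq_zero_or_monotoneOn_frequency hclifford sum_realCoord_sq hn hτ.1 hτ.2 hCf hM hCN hK
    rfl hρ0 hρ1 hρ1.le hKρ hKc with hzero | ⟨hpos, hmono, l, hl⟩
  · refine absurd (H.eq_zero_of_eventuallyEq hclifford sum_realCoord_sq hn hτ.1 hτ.2 hCf hM one_pos
      ?_ hx) hφx
    filter_upwards [Metric.ball_mem_nhds _ hρ0] with y hy using hzero y hy
  · refine ⟨fun s hs => ?_, hmono.congr fun s hs => ?_, l, hl.congr' ?_⟩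
    · rw [(hHD φ hφ s ⟨hs.1, hs.2.trans hρ1⟩).1]
      exact mul_pos (mul_pos hc (pow_pos hs.1 m)) (hpos s hs)
    · simp only [hfreq s hs]
    · filter_upwards [Ioo_mem_nhdsGT hρ0] with s hs using hfreq s hs
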